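/- arXiv:2510.08361 — 5 statements merged into one kernel-verified Lean document; each statement's English description precedes it below -/
import Mathlib

section
/- If G is a connected graph with exactly m edges, G contains no triangle, and G is not a 4-cycle, then the 𝓒-isolation number of G satisfies ι(G, 𝓒) ≤ (m+1)/6. -/
open SimpleGraph

/-- The closed neighbourhood `N[D]` of a set `D` of vertices of the graph `G`. -/
def closedNbhd {V : Type*} (G : SimpleGraph V) (D : Set V) : Set V :=
  D ∪ {v | ∃ u ∈ D, G.Adj u v}

/-- `G` contains a copy of `F`, i.e. a subgraph isomorphic to `F`. -/
def HasCopy {W V : Type*} (F : SimpleGraph W) (G : SimpleGraph V) : Prop :=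
  ∃ f : F →g G, Function.Injective f

/-- `D` is an isolating set of `G` with respect to the family of all cycles of length
at least `k` : the graph `G − N[D]` contains no copy of `C_n` for any `n ≥ k`.
For `k = 3` this is the family 𝓒 of all cycles; for `k = 4` it is the family 𝓒' of
non-triangle cycles. -/
def IsCycIsolatingGE {V : Type*} (k : ℕ) (G : SimpleGraph V) (D : Set V) : Prop :=
  ∀ n, k ≤ n → ¬ HasCopy (cycleGraph n) (G.induce (closedNbhd G D)ᶜ)

/-- The isolation number of `G` with respect to the family of cycles of length at least `k`:
the least cardinality of an isolating set. -/
noncomputable def iotaCycGE {V : Type*} (k : ℕ) (G : SimpleGraph V) : ℕ :=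
  sInf {r | ∃ D : Set V, D.ncard = r ∧ IsCycIsolatingGE k G D}

section IsolationOfCycles

open Finset

variable {V : Type*} (G : SimpleGraph V) [DecidableRel G.Adj]

/-- The number of ordered adjacent pairs in `A × B`. -/
def adjCount (A B : Finset V) : ℕ := ∑ x ∈ A, ∑ y ∈ B, if G.Adj x y then 1 else 0

variable {G}

lemma adjCount_comm (A B : Finset V) : adjCount G A B = adjCount G B A := by
  unfold adjCount
  rw [Finset.sum_comm]
  simp only [G.adj_comm]

@[simp] lemma adjCount_empty_left (A : Finset V) : adjCount G ∅ A = 0 := by simp [adjCount]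

@[simp] lemma adjCount_empty_right (A : Finset V) : adjCount G A ∅ = 0 := by simp [adjCount]

lemma adjCount_eq_zero_iff {A B : Finset V} :
    adjCount G A B = 0 ↔ ∀ a ∈ A, ∀ b ∈ B, ¬ G.Adj a b := by
  simp [adjCount]

lemma exists_adj_of_adjCount_pos {A B : Finset V} (h : 1 ≤ adjCount G A B) :
    ∃ a ∈ A, ∃ b ∈ B, G.Adj a b := by
  by_contra! hc
  have := adjCount_eq_zero_iff.2 hc
  omega

lemma adjCount_pos {A B : Finset V} {a b : V} (ha : a ∈ A) (hb : b ∈ B) (h : G.Adj a b) :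
    1 ≤ adjCount G A B := by
  by_contra! hc
  exact adjCount_eq_zero_iff.1 (by omega) a ha b hb h

lemma adjCount_eq_sum (A B : Finset V) : adjCount G A B = ∑ x ∈ A, adjCount G {x} B := by
  simp [adjCount]

lemma adjCount_singleton_left (x : V) (B : Finset V) :
    adjCount G {x} B = #(B.filter (G.Adj x)) := by
  simp [adjCount]

variable [DecidableEq V] (G)

/-- The vertices of `S` outside the closed neighbourhood of `D`. -/
def residue (S D : Finset V) : Finset V := {x ∈ S | ∀ u ∈ D, x ≠ u ∧ ¬ G.Adj u x}

/-- `S` induces a forest, phrased as a bound on the edge number of its induced subgraphs. -/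
def InducesForest (S : Finset V) : Prop :=
  ∀ X ⊆ S, X.Nonempty → adjCount G X X + 2 ≤ 2 * #X

/-- `S` induces a connected subgraph (or is empty). -/
def InducesConnected (S : Finset V) : Prop :=
  ∀ T ⊆ S, T.Nonempty → T ≠ S → 1 ≤ adjCount G T (S \ T)

/-- `p q r s` is a 4-cycle. -/
structure IsFourCycle (p q r s : V) : Prop where
  pq : G.Adj p q
  qr : G.Adj q r
  rs : G.Adj r s
  sp : G.Adj s p
  pr : p ≠ r
  qs : q ≠ s

/-- `S` is the vertex set of a 4-cycle. -/
def SpansFourCycle (S : Finset V) : Prop :=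
  ∃ p q r s, S = {p, q, r, s} ∧ IsFourCycle G p q r s

/-- The cycle isolation bound for the subgraph induced by `S`. -/
def HasIsolationBound (S : Finset V) : Prop :=
  ∃ D : Finset V, InducesForest G (residue G S D) ∧ 12 * #D ≤ adjCount G S S + 2

/-- Once `v` is chosen, the cycles left in `C` can be isolated with slack `t` relative to the
number of edges that meet `C`, where `W` is the set of outside vertices adjacent to `C`. -/
def HasSlack (v : V) (W C : Finset V) (t : ℕ) : Prop :=
  ∃ D : Finset V, InducesForest G (residue G C (insert v D)) ∧
    12 * #D + 2 * t ≤ adjCount G C C + 2 * adjCount G C W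

/-- `S` is an inclusion-minimal counterexample to the isolation bound. -/
structure IsMinimalCounterexample (S : Finset V) : Prop where
  triangleFree : ∀ a b c, G.Adj a b → G.Adj b c → ¬ G.Adj a c
  connected : InducesConnected G S
  not_fourCycle : ¬ SpansFourCycle G S
  not_bound : ¬ HasIsolationBound G S
  bound_of_ssubset : ∀ T ⊂ S, T.Nonempty → InducesConnected G T → ¬ SpansFourCycle G T →
    HasIsolationBound G T

variable {G}

lemma adjCount_sdiff_left {A B : Finset V} (h : A ⊆ B) (C : Finset V) :
    adjCount G B C = adjCount G A C + adjCount G (B \ A) C := by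
  unfold adjCount
  rw [add_comm, Finset.sum_sdiff h]

lemma adjCount_sdiff_right {A B : Finset V} (h : A ⊆ B) (C : Finset V) :
    adjCount G C B = adjCount G C A + adjCount G C (B \ A) := by
  simp only [adjCount_comm C, adjCount_sdiff_left h]

lemma adjCount_union_left {A B : Finset V} (h : Disjoint A B) (C : Finset V) :
    adjCount G (A ∪ B) C = adjCount G A C + adjCount G B C :=
  Finset.sum_union h

lemma adjCount_union_right {A B : Finset V} (h : Disjoint A B) (C : Finset V) :
    adjCount G C (A ∪ B) = adjCount G C A + adjCount G C B := by
  simp only [adjCount_comm C, adjCount_union_left h]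

lemma adjCount_union_self {A B : Finset V} (h : Disjoint A B) :
    adjCount G (A ∪ B) (A ∪ B) = adjCount G A A + 2 * adjCount G A B + adjCount G B B := by
  rw [adjCount_union_left h, adjCount_union_right h, adjCount_union_right h, adjCount_comm B A]
  ring

lemma adjCount_mono {A B C D : Finset V} (h : A ⊆ B) (h' : C ⊆ D) :
    adjCount G A C ≤ adjCount G B D := by
  rw [adjCount_sdiff_left h, adjCount_sdiff_right h']
  omega

lemma two_le_adjCount {A B : Finset V} {x p q : V} (hx : x ∈ A) (hp : p ∈ B) (hq : q ∈ B)
    (hpq : p ≠ q) (h1 : G.Adj x p) (h2 : G.Adj x q) : 2 ≤ adjCount G A B := by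
  have h : adjCount G {x} {p, q} = 2 := by simp [adjCount, -Finset.sum_boole, hpq, h1, h2]
  rw [← h]
  exact adjCount_mono (by simpa using hx) (by simp [Finset.insert_subset_iff, hp, hq])

lemma exists_adj_ne {B : Finset V} {x z : V} (h : 2 ≤ adjCount G {x} B) :
    ∃ y ∈ B, y ≠ z ∧ G.Adj x y := by
  by_contra! hc
  have h1 : B.filter (G.Adj x) ⊆ {z} := fun y hy => by
    simp only [Finset.mem_filter] at hy
    by_contra hne
    exact hc y hy.1 (by simpa using hne) hy.2
  have := Finset.card_le_card h1
  rw [adjCount_singleton_left] at h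
  simp at this
  omega

lemma residue_subset (S D : Finset V) : residue G S D ⊆ S := Finset.filter_subset _ _

lemma residue_mono {S T D E : Finset V} (h : S ⊆ T) (h' : E ⊆ D) :
    residue G S D ⊆ residue G T E := by
  intro x hx
  simp only [residue, Finset.mem_filter] at hx ⊢
  exact ⟨h hx.1, fun u hu => hx.2 u (h' hu)⟩

omit [DecidableEq V] in
lemma InducesForest.mono {S T : Finset V} (h : InducesForest G T) (hST : S ⊆ T) :
    InducesForest G S :=
  fun X hX hne => h X (hX.trans hST) hne

lemma InducesForest.union {A B : Finset V} (hA : InducesForest G A) (hB : InducesForest G B)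
    (hAB : adjCount G A B ≤ 1) (hd : Disjoint A B) : InducesForest G (A ∪ B) := by
  intro X hX hne
  have hXe : X = (X ∩ A) ∪ (X ∩ B) := by
    rw [← Finset.inter_union_distrib_left, Finset.inter_eq_left.2 hX]
  have hd' : Disjoint (X ∩ A) (X ∩ B) :=
    hd.mono Finset.inter_subset_right Finset.inter_subset_right
  have h1 := adjCount_union_self (G := G) hd'
  have h2 := Finset.card_union_of_disjoint hd'
  rw [← hXe] at h1 h2
  have h3 : adjCount G (X ∩ A) (X ∩ B) ≤ adjCount G A B :=
    adjCount_mono Finset.inter_subset_right Finset.inter_subset_right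
  rcases (X ∩ A).eq_empty_or_nonempty with ha | ha
  · rcases (X ∩ B).eq_empty_or_nonempty with hb | hb
    · rw [hXe, ha, hb] at hne
      simp at hne
    · have := hB _ Finset.inter_subset_right hb
      rw [ha] at h1 h2
      simp at h1 h2
      omega
  · have hA' := hA _ Finset.inter_subset_right ha
    rcases (X ∩ B).eq_empty_or_nonempty with hb | hb
    · rw [hb] at h1 h2
      simp at h1 h2
      omega
    · have := hB _ Finset.inter_subset_right hb
      omega

omit [DecidableEq V] in
lemma inducesForest_empty : InducesForest G ∅ := by
  intro X hX hne
  simp_all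

lemma exists_minDegree_two_of_not_inducesForest {S : Finset V} (h : ¬ InducesForest G S) :
    ∃ X ⊆ S, X.Nonempty ∧ ∀ x ∈ X, 2 ≤ adjCount G {x} X := by
  unfold InducesForest at h
  push Not at h
  obtain ⟨X, ⟨hXS, hne, hX⟩, hmin⟩ := exists_minimal_of_wellFoundedLT
    (fun X : Finset V => X ⊆ S ∧ X.Nonempty ∧ 2 * #X < adjCount G X X + 2) h
  refine ⟨X, hXS, hne, fun x hx => ?_⟩
  by_contra! hlt
  have hx' : {x} ⊆ X := by simpa using hx
  have h1 := adjCount_sdiff_left (G := G) hx' X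
  have h2 := adjCount_sdiff_right (G := G) hx' (X \ {x})
  have h3 := adjCount_sdiff_right (G := G) hx' {x}
  have h4 : adjCount G {x} {x} = 0 := by simp [adjCount]
  have h5 := adjCount_comm (G := G) (X \ {x}) {x}
  have h6 := Finset.card_sdiff_add_card_eq_card hx'
  rw [Finset.card_singleton] at h6
  rcases (X \ {x}).eq_empty_or_nonempty with he | he
  · rw [he] at h1 h2 h3 h6
    simp at h1 h2 h3 h6
    omega
  · have := hmin (y := X \ {x}) ⟨Finset.sdiff_subset.trans hXS, he, by omega⟩ Finset.sdiff_subset hx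
    simp at this

lemma inducesForest_of_card_le_three
    (h3 : ∀ a b c, G.Adj a b → G.Adj b c → ¬ G.Adj a c) {S : Finset V} (hS : #S ≤ 3) :
    InducesForest G S := by
  intro X hX hne
  have hc := Finset.card_le_card hX
  have hpos := hne.card_pos
  have hcases : #X = 1 ∨ #X = 2 ∨ #X = 3 := by omega
  rcases hcases with h | h | h
  · obtain ⟨a, rfl⟩ := Finset.card_eq_one.1 h
    simp [adjCount]
  · obtain ⟨a, b, hab, rfl⟩ := Finset.card_eq_two.1 h
    by_cases h1 : G.Adj a b
    · simp [adjCount, -Finset.sum_boole, hab, h1, h1.symm]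
    · simp [adjCount, -Finset.sum_boole, hab, h1, G.adj_comm b a]
  · obtain ⟨a, b, c, hab, hac, hbc, rfl⟩ := Finset.card_eq_three.1 h
    have h3' := h3 a b c
    rw [h]
    simp [adjCount, -Finset.sum_boole, hab, hac, hbc, G.adj_comm b a, G.adj_comm c a, G.adj_comm c b]
    split_ifs <;> simp_all

lemma HasSlack.mono {v : V} {W C : Finset V} {s t : ℕ} (h : HasSlack G v W C t) (hst : s ≤ t) :
    HasSlack G v W C s := by
  obtain ⟨D, hD, hc⟩ := h
  exact ⟨D, hD, by omega⟩

lemma HasSlack.union {v : V} {W A B : Finset V} {s t : ℕ} (hA : HasSlack G v W A s)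
    (hB : HasSlack G v W B t) (hd : Disjoint A B) (h0 : adjCount G A B = 0) :
    HasSlack G v W (A ∪ B) (s + t) := by
  obtain ⟨D, hD, hDc⟩ := hA
  obtain ⟨E, hE, hEc⟩ := hB
  refine ⟨D ∪ E, ?_, ?_⟩
  · have hle : adjCount G (residue G A (insert v D)) (residue G B (insert v E)) ≤
        adjCount G A B := adjCount_mono (residue_subset _ _) (residue_subset _ _)
    refine (hD.union hE (by omega)
      (hd.mono (residue_subset _ _) (residue_subset _ _))).mono fun x hx => ?_
    have hx' := residue_subset _ _ hx
    rcases Finset.mem_union.1 hx' with h | h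
    · refine Finset.mem_union_left _ ?_
      simp only [residue, Finset.mem_filter, Finset.mem_insert, Finset.mem_union] at hx ⊢
      exact ⟨h, fun u hu => hx.2 u (by tauto)⟩
    · refine Finset.mem_union_right _ ?_
      simp only [residue, Finset.mem_filter, Finset.mem_insert, Finset.mem_union] at hx ⊢
      exact ⟨h, fun u hu => hx.2 u (by tauto)⟩
  · have h1 := adjCount_union_self (G := G) hd
    have h2 := adjCount_union_left (G := G) hd W
    have h3 := Finset.card_union_le D E
    omega

lemma exists_component {R : Finset V} {x : V} (hx : x ∈ R) :
    ∃ C ⊆ R, x ∈ C ∧ adjCount G C (R \ C) = 0 ∧ InducesConnected G C := by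
  obtain ⟨C, ⟨hCR, hxC, hC⟩, hmin⟩ := exists_minimal_of_wellFoundedLT
    (fun C : Finset V => C ⊆ R ∧ x ∈ C ∧ adjCount G C (R \ C) = 0) ⟨R, by simp [hx]⟩
  refine ⟨C, hCR, hxC, hC, fun T hT hne hTC => ?_⟩
  by_contra! hlt
  have h0 : adjCount G T (C \ T) = 0 := by omega
  rw [adjCount_eq_zero_iff] at hC h0
  by_cases hxT : x ∈ T
  · refine hTC (hT.antisymm (hmin (y := T) ⟨hT.trans hCR, hxT, ?_⟩ hT))
    rw [adjCount_eq_zero_iff]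
    intro a ha b hb
    simp only [Finset.mem_sdiff] at hb hC h0
    by_cases hbC : b ∈ C
    · exact h0 a ha b ⟨hbC, hb.2⟩
    · exact hC a (hT ha) b ⟨hb.1, hbC⟩
  · obtain ⟨y, hy⟩ := hne
    have := hmin (y := C \ T) ⟨Finset.sdiff_subset.trans hCR, by simp [hxC, hxT], ?_⟩
      Finset.sdiff_subset (hT hy)
    · simp [hy] at this
    rw [adjCount_eq_zero_iff]
    intro a ha b hb hab
    simp only [Finset.mem_sdiff] at ha hb hC h0
    by_cases hbC : b ∈ C
    · exact h0 b (by tauto) a ha hab.symm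
    · exact hC a ha.1 b ⟨hb.1, hbC⟩ hab

lemma adjCount_sdiff_sdiff_eq_zero {R S C : Finset V}
    (hS : adjCount G S (R \ S) = 0) (hC : adjCount G C (S \ C) = 0) (hCS : C ⊆ S) :
    adjCount G C (R \ C) = 0 ∧ adjCount G (S \ C) (R \ (S \ C)) = 0 := by
  simp only [adjCount_eq_zero_iff, Finset.mem_sdiff] at *
  refine ⟨fun a ha b hb hab => ?_, fun a ha b hb hab => ?_⟩
  · by_cases hbS : b ∈ S
    · exact hC a ha b ⟨hbS, hb.2⟩ hab
    · exact hS a (hCS ha) b ⟨hb.1, hbS⟩ hab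
  · by_cases hbS : b ∈ S
    · exact hC b (by tauto) a ha hab.symm
    · exact hS a ha.1 b ⟨hb.1, hbS⟩ hab

lemma hasSlack_zero_of_components {v : V} {W R : Finset V}
    (H : ∀ C ⊆ R, C.Nonempty → adjCount G C (R \ C) = 0 → InducesConnected G C →
      HasSlack G v W C 0) (S : Finset V) (hSR : S ⊆ R) (hS : adjCount G S (R \ S) = 0) :
    HasSlack G v W S 0 := by
  induction S using Finset.strongInduction with
  | H S ih =>
    rcases S.eq_empty_or_nonempty with rfl | ⟨x, hx⟩
    · exact ⟨∅, inducesForest_empty.mono (residue_subset _ _), by simp⟩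
    obtain ⟨C, hCS, hxC, hC, hconn⟩ := exists_component (G := G) hx
    obtain ⟨h1, h2⟩ := adjCount_sdiff_sdiff_eq_zero hS hC hCS
    have h3 := H C (hCS.trans hSR) ⟨x, hxC⟩ h1 hconn
    have h4 := ih (S \ C) (Finset.sdiff_ssubset hCS ⟨x, hxC⟩)
      (Finset.sdiff_subset.trans hSR) h2
    have := h3.union h4 Finset.disjoint_sdiff hC
    rwa [Finset.union_sdiff_of_subset hCS] at this

lemma HasSlack.extend {v : V} {W R C : Finset V} {t : ℕ}
    (H : ∀ C ⊆ R, C.Nonempty → adjCount G C (R \ C) = 0 → InducesConnected G C →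
      HasSlack G v W C 0) (hCR : C ⊆ R) (hC : adjCount G C (R \ C) = 0)
    (h : HasSlack G v W C t) : HasSlack G v W R t := by
  have h1 := hasSlack_zero_of_components H (R \ C) Finset.sdiff_subset
    (adjCount_sdiff_sdiff_eq_zero (by simp) hC hCR).2
  have := h.union h1 Finset.disjoint_sdiff hC
  rwa [Finset.union_sdiff_of_subset hCR] at this

lemma hasIsolationBound_of_hasSlack {v : V} {S W : Finset V} {k t : ℕ} (hWS : W ⊆ S)
    (hW : ∀ x ∈ W, x = v ∨ G.Adj v x) (hk : 2 * k ≤ adjCount G W W)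
    (h : HasSlack G v W (S \ W) t) (hkt : 5 ≤ k + t) : HasIsolationBound G S := by
  obtain ⟨D, hD, hc⟩ := h
  refine ⟨insert v D, hD.mono fun x hx => ?_, ?_⟩
  · simp only [residue, Finset.mem_filter, Finset.mem_sdiff] at hx ⊢
    refine ⟨⟨hx.1, fun hxW => ?_⟩, hx.2⟩
    have := hx.2 v (Finset.mem_insert_self _ _)
    have := hW x hxW
    tauto
  · have h1 := adjCount_union_self (G := G) (Finset.sdiff_disjoint (s := W) (t := S))
    rw [Finset.sdiff_union_of_subset hWS] at h1
    have := Finset.card_insert_le v D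
    omega

namespace IsFourCycle

variable {p q r s : V}

omit [DecidableRel G.Adj] [DecidableEq V] in
lemma rotate (h : IsFourCycle G p q r s) : IsFourCycle G q r s p :=
  ⟨h.qr, h.rs, h.sp, h.pq, h.qs, h.pr.symm⟩

lemma adjCount_left (h : IsFourCycle G p q r s) (B : Finset V) :
    adjCount G {p, q, r, s} B =
      adjCount G {p} B + adjCount G {q} B + adjCount G {r} B + adjCount G {s} B := by
  have := h.pq.ne; have := h.qr.ne; have := h.rs.ne; have := h.sp.ne.symm
  have := h.pr; have := h.qs
  rw [adjCount_eq_sum, Finset.sum_insert (by simp_all), Finset.sum_insert (by simp_all),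
    Finset.sum_insert (by simp_all), Finset.sum_singleton]
  ring

omit [DecidableRel G.Adj] in
lemma card_eq (h : IsFourCycle G p q r s) : #({p, q, r, s} : Finset V) = 4 := by
  have := h.pq.ne; have := h.qr.ne; have := h.rs.ne; have := h.sp.ne.symm
  have := h.pr; have := h.qs
  rw [Finset.card_insert_of_notMem (by simp_all), Finset.card_insert_of_notMem (by simp_all),
    Finset.card_insert_of_notMem (by simp_all), Finset.card_singleton]

lemma quad_rotate : ({q, r, s, p} : Finset V) = {p, q, r, s} := by
  ext; simp; tauto

lemma adjCount_first (h3 : ∀ a b c, G.Adj a b → G.Adj b c → ¬ G.Adj a c)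
    (h : IsFourCycle G p q r s) : adjCount G {p} {p, q, r, s} = 2 := by
  have h1 := h3 p q r h.pq h.qr
  have := h.pq.ne; have := h.qr.ne; have := h.rs.ne; have := h.sp.ne.symm
  have := h.pr
  simp [adjCount, -Finset.sum_boole, *, h.pq, h.sp.symm, h.qs]

end IsFourCycle

namespace SpansFourCycle

variable {A : Finset V}

omit [DecidableRel G.Adj] in
lemma card_eq (h : SpansFourCycle G A) : #A = 4 := by
  obtain ⟨p, q, r, s, rfl, h⟩ := h
  exact h.card_eq

omit [DecidableRel G.Adj] in
lemma nonempty (h : SpansFourCycle G A) : A.Nonempty := by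
  rw [← Finset.card_pos, h.card_eq]
  norm_num

lemma two_le (h : SpansFourCycle G A) {x : V} (hx : x ∈ A) : 2 ≤ adjCount G {x} A := by
  obtain ⟨p, q, r, s, rfl, h⟩ := h
  simp only [Finset.mem_insert, Finset.mem_singleton] at hx
  rcases hx with rfl | rfl | rfl | rfl
  · exact two_le_adjCount (by simp) (by simp) (by simp) h.qs h.pq h.sp.symm
  · exact two_le_adjCount (by simp) (by simp) (by simp) h.pr h.pq.symm h.qr
  · exact two_le_adjCount (by simp) (by simp) (by simp) h.qs h.qr.symm h.rs
  · exact two_le_adjCount (by simp) (by simp) (by simp) h.pr h.sp h.rs.symm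

lemma eight_le (h : SpansFourCycle G A) : 8 ≤ adjCount G A A := by
  rw [adjCount_eq_sum]
  calc 8 = ∑ x ∈ A, 2 := by simp [h.card_eq]
    _ ≤ _ := Finset.sum_le_sum fun x hx => h.two_le hx

lemma inducesForest_residue (h3 : ∀ a b c, G.Adj a b → G.Adj b c → ¬ G.Adj a c)
    (h : SpansFourCycle G A) {D : Finset V} {u x : V} (hu : u ∈ D) (hx : x ∈ A)
    (hux : x = u ∨ G.Adj u x) : InducesForest G (residue G A D) := by
  apply inducesForest_of_card_le_three h3
  have : residue G A D ⊂ A := by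
    refine Finset.ssubset_iff_of_subset (residue_subset _ _) |>.2 ⟨x, hx, fun hxr => ?_⟩
    simp only [residue, Finset.mem_filter] at hxr
    have := hxr.2 u hu
    tauto
  have := Finset.card_lt_card this
  rw [h.card_eq] at this
  omega

end SpansFourCycle

variable (G) in
/-- The closed neighbourhood of `v` within `S`. -/
def closedNbhdIn (S : Finset V) (v : V) : Finset V := insert v (S.filter (G.Adj v))

lemma mem_closedNbhdIn {S : Finset V} {v x : V} :
    x ∈ closedNbhdIn G S v ↔ x = v ∨ x ∈ S ∧ G.Adj v x := by
  simp [closedNbhdIn]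

lemma closedNbhdIn_subset {S : Finset V} {v : V} (hv : v ∈ S) : closedNbhdIn G S v ⊆ S := by
  intro x hx
  rcases mem_closedNbhdIn.1 hx with rfl | h
  exacts [hv, h.1]

lemma two_mul_degree_le_adjCount_closedNbhdIn (S : Finset V) (v : V) :
    2 * adjCount G {v} S ≤ adjCount G (closedNbhdIn G S v) (closedNbhdIn G S v) := by
  have hd : Disjoint {v} (S.filter (G.Adj v)) := by simp
  have h1 := adjCount_union_self (G := G) hd
  have h2 : adjCount G {v} (S.filter (G.Adj v)) = adjCount G {v} S := by
    simp [adjCount_singleton_left, Finset.filter_filter]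
  rw [h2] at h1
  have h3 : {v} ∪ S.filter (G.Adj v) = closedNbhdIn G S v := by
    rw [closedNbhdIn, Finset.insert_eq]
  rw [h3] at h1
  omega

/-- The cut of a component `C` of `S \ W` consists of the edges between `C` and `W`. -/
lemma adjCount_sdiff_eq {S W C : Finset V} (hWS : W ⊆ S) (hC : C ⊆ S \ W)
    (h0 : adjCount G C ((S \ W) \ C) = 0) : adjCount G C (S \ C) = adjCount G C W := by
  have hW : W ⊆ S \ C := by
    intro x hx
    refine Finset.mem_sdiff.2 ⟨hWS hx, fun hxC => ?_⟩
    exact (Finset.mem_sdiff.1 (hC hxC)).2 hx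
  rw [adjCount_sdiff_right hW, sdiff_sdiff_comm, h0, add_zero]

namespace IsMinimalCounterexample

variable {S : Finset V} (h : IsMinimalCounterexample G S)

include h

lemma not_inducesForest : ¬ InducesForest G S := fun hf =>
  h.not_bound ⟨∅, hf.mono (residue_subset _ _), by simp⟩

lemma hasSlack_of_not_spansFourCycle {v : V} {W C : Finset V} (hWS : W ⊆ S) (hW : W.Nonempty)
    (hC : C ⊆ S \ W) (hne : C.Nonempty) (h0 : adjCount G C ((S \ W) \ C) = 0)
    (hconn : InducesConnected G C) (hC4 : ¬ SpansFourCycle G C) :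
    1 ≤ adjCount G C W ∧ HasSlack G v W C (adjCount G C W - 1) := by
  have hss : C ⊂ S := hC.trans_ssubset (Finset.sdiff_ssubset hWS hW)
  have h1 := h.connected C hss.1 hne hss.ne
  rw [adjCount_sdiff_eq hWS hC h0] at h1
  obtain ⟨D, hD, hc⟩ := h.bound_of_ssubset C hss hne hconn hC4
  exact ⟨h1, D, hD.mono (residue_mono subset_rfl (Finset.subset_insert _ _)), by omega⟩

lemma adjCount_ne_one_of_spansFourCycle {T : Finset V} (hTS : T ⊆ S) (hT : SpansFourCycle G T) :
    adjCount G T (S \ T) ≠ 1 := by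
  intro hcut
  obtain ⟨x, hx, y, hy, hxy⟩ := exists_adj_of_adjCount_pos hcut.ge
  rw [Finset.mem_sdiff] at hy
  have hWS : {y} ⊆ S := by simpa using hy.1
  have hTR : T ⊆ S \ {y} := by
    intro z hz
    simp only [Finset.mem_sdiff, Finset.mem_singleton]
    exact ⟨hTS hz, fun e => hy.2 (e ▸ hz)⟩
  have hfour : ∀ C ⊆ S \ {y}, SpansFourCycle G C → 1 ≤ adjCount G C {y} →
      HasSlack G y {y} C (4 + adjCount G C {y}) := by
    intro C _ hC h1
    obtain ⟨a, ha, b, hb, hab⟩ := exists_adj_of_adjCount_pos h1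
    rw [Finset.mem_singleton] at hb
    subst hb
    refine ⟨∅, hC.inducesForest_residue h.triangleFree (Finset.mem_insert_self _ _) ha
      (Or.inr hab.symm), ?_⟩
    have := hC.eight_le
    simp
    omega
  have h1 : 1 ≤ adjCount G T {y} := adjCount_pos hx (Finset.mem_singleton_self y) hxy
  have h0 : adjCount G T ((S \ {y}) \ T) = 0 := by
    have hy' : {y} ⊆ S \ T := by simpa using hy
    have := adjCount_sdiff_right (G := G) hy' T
    rw [sdiff_sdiff_comm] at this
    omega
  have hslack := (hfour T hTR hT h1).mono (s := 5) (by omega)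
  refine h.not_bound (hasIsolationBound_of_hasSlack (v := y) (k := 0) (t := 5) hWS (by simp)
    (by simp) (hslack.extend ?_ hTR h0) (by simp))
  intro C hC hne hC0 hconn
  by_cases hC4 : SpansFourCycle G C
  · have hss : C ⊂ S := hC.trans_ssubset (Finset.sdiff_ssubset hWS (by simp))
    have h1 := h.connected C hss.1 hne hss.ne
    rw [adjCount_sdiff_eq hWS hC hC0] at h1
    exact (hfour C hC hC4 h1).mono (by simp)
  · exact (h.hasSlack_of_not_spansFourCycle hWS (by simp) hC hne hC0 hconn hC4).2.mono (by simp)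

omit h in
lemma inducesConnected_of_cut_eq_one (hS : InducesConnected G S) {T : Finset V} (hTS : T ⊆ S)
    (hcut : adjCount G T (S \ T) = 1) : InducesConnected G T := by
  intro U hUT hU hne
  by_contra! hlt
  have hne' : (T \ U).Nonempty := by
    rw [Finset.sdiff_nonempty]
    exact fun hTU => hne (hUT.antisymm hTU)
  have key : ∀ X ⊆ T, X.Nonempty → (T \ X).Nonempty → adjCount G X (T \ X) = 0 →
      1 ≤ adjCount G X (S \ T) := by
    intro X hXT hX hTX h0
    have h1 := hS X (hXT.trans hTS) hX (by
      rintro rfl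
      rw [Finset.sdiff_nonempty] at hTX
      exact hTX hTS)
    rw [adjCount_sdiff_right (Finset.sdiff_subset_sdiff hTS subset_rfl : T \ X ⊆ S \ X)] at h1
    have : (S \ X) \ (T \ X) ⊆ S \ T := by
      intro z
      simp only [Finset.mem_sdiff]
      tauto
    have := adjCount_mono (G := G) (subset_refl X) this
    omega
  have h1 := key U hUT hU hne' (by omega)
  have h2 := key (T \ U) Finset.sdiff_subset hne'
    (by rwa [sdiff_sdiff_right_self, Finset.inf_eq_inter, Finset.inter_eq_right.2 hUT])
    (by rw [sdiff_sdiff_right_self, Finset.inf_eq_inter, Finset.inter_eq_right.2 hUT,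
          adjCount_comm]; omega)
  have := adjCount_sdiff_left (G := G) hUT (S \ T)
  omega

/-- A minimal counterexample has no bridge. -/
lemma two_le_cut {T : Finset V} (hTS : T ⊆ S) (hT : T.Nonempty) (hne : T ≠ S) :
    2 ≤ adjCount G T (S \ T) := by
  have h1 := h.connected T hTS hT hne
  by_contra! hlt
  have hcut : adjCount G T (S \ T) = 1 := by omega
  have hU : (S \ T).Nonempty := by
    rw [Finset.sdiff_nonempty]
    exact fun hST => hne (hTS.antisymm hST)
  have hST : S \ (S \ T) = T := by
    rw [sdiff_sdiff_right_self, Finset.inf_eq_inter, Finset.inter_eq_right.2 hTS]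
  have hcut' : adjCount G (S \ T) (S \ (S \ T)) = 1 := by rw [hST, adjCount_comm, hcut]
  obtain ⟨D, hD, hDc⟩ := h.bound_of_ssubset T (hTS.ssubset_of_ne hne) hT
    (inducesConnected_of_cut_eq_one h.connected hTS hcut)
    (fun h4 => h.adjCount_ne_one_of_spansFourCycle hTS h4 hcut)
  obtain ⟨E, hE, hEc⟩ := h.bound_of_ssubset (S \ T) (Finset.sdiff_ssubset hTS hT) hU
    (inducesConnected_of_cut_eq_one h.connected Finset.sdiff_subset hcut')
    (fun h4 => h.adjCount_ne_one_of_spansFourCycle Finset.sdiff_subset h4 hcut')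
  have hd : Disjoint T (S \ T) := Finset.disjoint_sdiff
  refine h.not_bound ⟨D ∪ E, ?_, ?_⟩
  · have hle : adjCount G (residue G T D) (residue G (S \ T) E) ≤
        adjCount G T (S \ T) := adjCount_mono (residue_subset _ _) (residue_subset _ _)
    refine (hD.union hE (by omega)
      (hd.mono (residue_subset _ _) (residue_subset _ _))).mono fun x hx => ?_
    simp only [residue, Finset.mem_filter, Finset.mem_union, Finset.mem_sdiff] at hx ⊢
    by_cases hxT : x ∈ T
    · exact Or.inl ⟨hxT, fun u hu => hx.2 u (Or.inl hu)⟩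
    · exact Or.inr ⟨⟨hx.1, hxT⟩, fun u hu => hx.2 u (Or.inr hu)⟩
  · have h2 := adjCount_union_self (G := G) hd
    rw [Finset.union_sdiff_of_subset hTS] at h2
    have := Finset.card_union_le D E
    omega

lemma two_le_degree {x : V} (hx : x ∈ S) : 2 ≤ adjCount G {x} S := by
  have hx' : {x} ⊆ S := by simpa using hx
  refine (h.two_le_cut hx' (by simp) ?_).trans (adjCount_mono subset_rfl Finset.sdiff_subset)
  rintro rfl
  exact h.not_inducesForest (inducesForest_of_card_le_three h.triangleFree (by simp))

lemma two_le_adjCount_component {W C : Finset V} (hWS : W ⊆ S) (hW : W.Nonempty)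
    (hC : C ⊆ S \ W) (hne : C.Nonempty) (h0 : adjCount G C ((S \ W) \ C) = 0) :
    2 ≤ adjCount G C W := by
  have hss : C ⊂ S := hC.trans_ssubset (Finset.sdiff_ssubset hWS hW)
  rw [← adjCount_sdiff_eq hWS hC h0]
  exact h.two_le_cut hss.1 hne hss.ne

omit h in
lemma hasSlack_of_spansFourCycle (h3 : ∀ a b c, G.Adj a b → G.Adj b c → ¬ G.Adj a c)
    {v : V} {W C : Finset V} {t : ℕ} (hC : SpansFourCycle G C) (ht : t + 2 ≤ adjCount G C W) :
    HasSlack G v W C t := by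
  obtain ⟨p, hp⟩ := hC.nonempty
  refine ⟨{p}, hC.inducesForest_residue h3
    (Finset.mem_insert_of_mem (Finset.mem_singleton_self p)) hp (Or.inl rfl), ?_⟩
  have := hC.eight_le
  simp
  omega

lemma false_of_hasSlack {v : V} (hv : v ∈ S) {C : Finset V} {t : ℕ}
    (hC : C ⊆ S \ closedNbhdIn G S v)
    (h0 : adjCount G C ((S \ closedNbhdIn G S v) \ C) = 0)
    (hs : HasSlack G v (closedNbhdIn G S v) C t) (ht : 5 ≤ adjCount G {v} S + t) : False := by
  have hWS := closedNbhdIn_subset (G := G) hv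
  have hW : (closedNbhdIn G S v).Nonempty := ⟨v, mem_closedNbhdIn.2 (Or.inl rfl)⟩
  refine h.not_bound (hasIsolationBound_of_hasSlack (v := v) hWS
    (fun x hx => (mem_closedNbhdIn.1 hx).imp_right And.right)
    (two_mul_degree_le_adjCount_closedNbhdIn S v) (hs.extend ?_ hC h0) ht)
  intro C hC hne hC0 hconn
  by_cases hC4 : SpansFourCycle G C
  · exact hasSlack_of_spansFourCycle h.triangleFree hC4
      (by simpa using h.two_le_adjCount_component hWS hW hC hne hC0)
  · exact (h.hasSlack_of_not_spansFourCycle hWS hW hC hne hC0 hconn hC4).2.mono (by simp)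

/-- No vertex of degree at least three dominates the neighbourhood of another vertex. -/
lemma exists_adj_not_adj {v w : V} (hv : v ∈ S) (hw : w ∈ S) (hvw : v ≠ w)
    (hdeg : 3 ≤ adjCount G {v} S) : ∃ x ∈ S, G.Adj w x ∧ ¬ G.Adj v x := by
  by_contra! hN
  have hnadj : ¬ G.Adj v w := fun hadj => G.loopless.irrefl v (hN v hv hadj.symm)
  have hC : {w} ⊆ S \ closedNbhdIn G S v := by
    simp [mem_closedNbhdIn, hw, hvw.symm, hnadj]
  have h0 : adjCount G {w} ((S \ closedNbhdIn G S v) \ {w}) = 0 := by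
    rw [adjCount_eq_zero_iff]
    intro a ha b hb hab
    rw [Finset.mem_singleton] at ha
    subst ha
    simp only [Finset.mem_sdiff, mem_closedNbhdIn] at hb
    exact hb.1.2 (Or.inr ⟨hb.1.1, hN b hb.1.1 hab⟩)
  refine h.false_of_hasSlack hv hC h0 (t := 2) ⟨∅, ?_, ?_⟩ (by omega)
  · refine (inducesForest_of_card_le_three h.triangleFree (S := {w}) (by simp)).mono
      (residue_subset _ _)
  · have := h.two_le_adjCount_component (closedNbhdIn_subset hv)
      ⟨v, mem_closedNbhdIn.2 (Or.inl rfl)⟩ hC (by simp) h0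
    simp
    omega

lemma three_le_degree_opposite {p q r s : V} (hc : IsFourCycle G p q r s)
    (hS : {p, q, r, s} ⊆ S) (hp : 3 ≤ adjCount G {p} S) : 3 ≤ adjCount G {r} S := by
  simp only [Finset.insert_subset_iff, Finset.singleton_subset_iff] at hS
  obtain ⟨x, hx, hrx, hpx⟩ := h.exists_adj_not_adj hS.1 hS.2.2.1 hc.pr hp
  have hxq : x ≠ q := fun e => hpx (e ▸ hc.pq)
  have hxs : x ≠ s := fun e => hpx (e ▸ hc.sp.symm)
  rw [adjCount_singleton_left]
  calc 3 = #{x, q, s} := by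
        rw [Finset.card_eq_three.2 ⟨x, q, s, hxq, hxs, hc.qs, rfl⟩]
    _ ≤ _ := Finset.card_le_card (by
        simp [Finset.insert_subset_iff, hx, hS, hrx, hc.qr.symm, hc.rs])

lemma not_degrees_three_two_three_two {p q r s : V} (hc : IsFourCycle G p q r s)
    (hS : {p, q, r, s} ⊆ S) (hp : adjCount G {p} S = 3) (hq : adjCount G {q} S = 2)
    (hr : adjCount G {r} S = 3) (hs : adjCount G {s} S = 2) : False := by
  simp only [Finset.insert_subset_iff, Finset.singleton_subset_iff] at hS
  obtain ⟨hpS, hqS, hrS, hsS⟩ := hS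
  have hpr := h.triangleFree p q r hc.pq hc.qr
  have hrR : r ∈ S \ closedNbhdIn G S p := by
    simp [mem_closedNbhdIn, hrS, hpr, hc.pr.symm]
  obtain ⟨Q, hQR, hrQ, hQ0, hQconn⟩ := exists_component (G := G) hrR
  have hQS : Q ⊆ S := hQR.trans Finset.sdiff_subset
  have hWS := closedNbhdIn_subset (G := G) hpS
  have hQW : ∀ x ∈ Q, x ≠ p ∧ ¬ G.Adj p x := by
    intro x hx
    have := hQR hx
    simp only [Finset.mem_sdiff, mem_closedNbhdIn] at this
    tauto
  have hqQ : q ∉ Q := fun hx => (hQW q hx).2 hc.pq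
  have hsQ : s ∉ Q := fun hx => (hQW s hx).2 hc.sp.symm
  have hpQ : p ∉ Q := fun hx => (hQW p hx).1 rfl
  have hd : Disjoint Q {p, q, s} := by simp [hqQ, hsQ, hpQ]
  have hTS : Q ∪ {p, q, s} ⊆ S :=
    Finset.union_subset hQS (by simp [Finset.insert_subset_iff, *])
  have deg_sdiff : ∀ {x a b : V} {U : Finset V}, a ∈ S → b ∈ S → a ≠ b → G.Adj x a →
      G.Adj x b → U ⊆ S → a ∉ U → b ∉ U → 2 + adjCount G {x} U ≤ adjCount G {x} S := by
    intro x a b U ha hb hab hxa hxb hU haU hbU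
    rw [adjCount_sdiff_right hU, add_comm]
    have := two_le_adjCount (G := G) (Finset.mem_singleton_self x)
      (Finset.mem_sdiff.2 ⟨ha, haU⟩) (Finset.mem_sdiff.2 ⟨hb, hbU⟩) hab hxa hxb
    omega
  set T := Q ∪ {p, q, s} with hT
  have hpT : p ∈ T := by simp [hT]
  have hqT : q ∈ T := by simp [hT]
  have hsT : s ∈ T := by simp [hT]
  have hrT : r ∈ T := by simp [hT, hrQ]
  have hp1 := deg_sdiff hqS hsS hc.qs hc.pq hc.sp.symm (Finset.sdiff_subset (s := S) (t := T))
    (by simp [hqT]) (by simp [hsT])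
  have hq1 := deg_sdiff hpS hrS hc.pr hc.pq.symm hc.qr (Finset.sdiff_subset (s := S) (t := T))
    (by simp [hpT]) (by simp [hrT])
  have hs1 := deg_sdiff hpS hrS hc.pr hc.sp hc.rs.symm (Finset.sdiff_subset (s := S) (t := T))
    (by simp [hpT]) (by simp [hrT])
  have hr1 := deg_sdiff hqS hsS hc.qs hc.qr.symm hc.rs hQS hqQ hsQ
  have hTne : T ≠ S := by
    intro hTS
    have hsub : S.filter (G.Adj p) ⊆ {q, s} := by
      intro x hx
      rw [Finset.mem_filter, ← hTS, hT, Finset.mem_union] at hx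
      rcases hx with ⟨hx | hx, hpx⟩
      · exact absurd hpx (hQW x hx).2
      · simp only [Finset.mem_insert, Finset.mem_singleton] at hx ⊢
        rcases hx with rfl | hx
        · exact absurd hpx (G.loopless.irrefl _)
        · exact hx
    have := Finset.card_le_card hsub
    rw [← adjCount_singleton_left, hp, Finset.card_pair hc.qs] at this
    omega
  have hcut := h.two_le_cut hTS ⟨p, hpT⟩ hTne
  have hsplit := adjCount_union_left (G := G) hd (S \ T)
  rw [← hT] at hsplit
  have hpqs : adjCount G {p, q, s} (S \ T) =
      adjCount G {p} (S \ T) + adjCount G {q} (S \ T) + adjCount G {s} (S \ T) := by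
    rw [adjCount_eq_sum, Finset.sum_insert (by simp [hc.pq.ne, hc.sp.ne.symm]),
      Finset.sum_pair hc.qs, add_assoc]
  have hQ1 : adjCount G Q {q, s} + adjCount G Q (S \ T) ≤ adjCount G Q (S \ Q) := by
    rw [← adjCount_union_right]
    · refine adjCount_mono subset_rfl (Finset.union_subset ?_ ?_)
      · simp [Finset.insert_subset_iff, *]
      · exact Finset.sdiff_subset_sdiff subset_rfl Finset.subset_union_left
    · simp [Finset.disjoint_left, hqT, hsT]
  have hQ2 : 2 ≤ adjCount G Q {q, s} :=
    two_le_adjCount hrQ (by simp) (by simp) hc.qs hc.qr.symm hc.rs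
  rw [adjCount_sdiff_eq hWS hQR hQ0] at hQ1
  have hQ4 : ¬ SpansFourCycle G Q := fun h4 => by
    have := h4.two_le hrQ
    omega
  have hslack := (h.hasSlack_of_not_spansFourCycle (v := p) hWS
    ⟨p, mem_closedNbhdIn.2 (Or.inl rfl)⟩ hQR ⟨r, hrQ⟩ hQ0 hQconn hQ4).2
  exact h.false_of_hasSlack hpS hQR hQ0 hslack (by omega)

lemma adjCount_fourCycle_sdiff {p q r s : V} (hc : IsFourCycle G p q r s)
    (hS : {p, q, r, s} ⊆ S) :
    adjCount G {p, q, r, s} (S \ {p, q, r, s}) + 8 = adjCount G {p} S + adjCount G {q} S +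
      adjCount G {r} S + adjCount G {s} S := by
  have hA : adjCount G {p, q, r, s} {p, q, r, s} = 8 := by
    rw [hc.adjCount_left, hc.adjCount_first h.triangleFree,
      ← IsFourCycle.quad_rotate, hc.rotate.adjCount_first h.triangleFree,
      ← IsFourCycle.quad_rotate, hc.rotate.rotate.adjCount_first h.triangleFree,
      ← IsFourCycle.quad_rotate, hc.rotate.rotate.rotate.adjCount_first h.triangleFree]
  have h1 := adjCount_sdiff_right (G := G) hS {p, q, r, s}
  have h2 := hc.adjCount_left S
  omega

lemma three_le_cut_of_spansFourCycle {A : Finset V} (hA : SpansFourCycle G A) (hAS : A ⊆ S) :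
    3 ≤ adjCount G A (S \ A) := by
  have hne : A ≠ S := by
    rintro rfl
    exact h.not_fourCycle hA
  have hcut := h.two_le_cut hAS hA.nonempty hne
  obtain ⟨p, q, r, s, rfl, hc⟩ := hA
  have hsum := h.adjCount_fourCycle_sdiff hc hAS
  have hAS' := hAS
  simp only [Finset.insert_subset_iff, Finset.singleton_subset_iff] at hAS'
  have hp := h.two_le_degree hAS'.1
  have hq := h.two_le_degree hAS'.2.1
  have hr := h.two_le_degree hAS'.2.2.1
  have hs := h.two_le_degree hAS'.2.2.2
  have hS1 : {q, r, s, p} ⊆ S := by rwa [IsFourCycle.quad_rotate]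
  have hS2 : {r, s, p, q} ⊆ S := by rwa [IsFourCycle.quad_rotate]
  have hS3 : {s, p, q, r} ⊆ S := by rwa [IsFourCycle.quad_rotate]
  have h1 := h.three_le_degree_opposite hc hAS
  have h2 := h.three_le_degree_opposite hc.rotate hS1
  have h3 := h.three_le_degree_opposite hc.rotate.rotate hS2
  have h4 := h.three_le_degree_opposite hc.rotate.rotate.rotate hS3
  have h5 := h.not_degrees_three_two_three_two hc hAS
  have h6 := h.not_degrees_three_two_three_two hc.rotate hS1
  by_contra! hlt
  by_cases hp3 : 3 ≤ adjCount G {p} S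
  · have := h1 hp3
    exact h5 (by omega) (by omega) (by omega) (by omega)
  · have : ¬ 3 ≤ adjCount G {r} S := fun hr3 => hp3 (h3 hr3)
    by_cases hq3 : 3 ≤ adjCount G {q} S
    · have := h2 hq3
      exact h6 (by omega) (by omega) (by omega) (by omega)
    · have : ¬ 3 ≤ adjCount G {s} S := fun hs3 => hq3 (h4 hs3)
      omega

lemma hasSlack_one {v : V} (hv : v ∈ S) {C : Finset V} (hC : C ⊆ S \ closedNbhdIn G S v)
    (hne : C.Nonempty) (h0 : adjCount G C ((S \ closedNbhdIn G S v) \ C) = 0)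
    (hconn : InducesConnected G C) : HasSlack G v (closedNbhdIn G S v) C 1 := by
  have hWS := closedNbhdIn_subset (G := G) hv
  have hW : (closedNbhdIn G S v).Nonempty := ⟨v, mem_closedNbhdIn.2 (Or.inl rfl)⟩
  by_cases hC4 : SpansFourCycle G C
  · have := h.three_le_cut_of_spansFourCycle hC4 (hC.trans Finset.sdiff_subset)
    rw [adjCount_sdiff_eq hWS hC h0] at this
    exact hasSlack_of_spansFourCycle h.triangleFree hC4 (by omega)
  · have := h.two_le_adjCount_component hWS hW hC hne h0
    exact (h.hasSlack_of_not_spansFourCycle hWS hW hC hne h0 hconn hC4).2.mono (by omega)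

lemma one_le_adjCount_sdiff_closedNbhdIn {v a : V} (ha : a ∈ S) (hva : G.Adj v a) :
    1 ≤ adjCount G {a} (S \ closedNbhdIn G S v) := by
  obtain ⟨w, hw, hwv, haw⟩ := exists_adj_ne (z := v) (h.two_le_degree ha)
  refine adjCount_pos (Finset.mem_singleton_self a) (Finset.mem_sdiff.2 ⟨hw, ?_⟩) haw
  rw [mem_closedNbhdIn]
  have := h.triangleFree v a w hva haw
  tauto

lemma sdiff_closedNbhdIn_nonempty {v : V} (hv : v ∈ S) : (S \ closedNbhdIn G S v).Nonempty := by
  obtain ⟨a, ha, _, hva⟩ := exists_adj_ne (z := v) (h.two_le_degree hv)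
  obtain ⟨-, -, b, hb, -⟩ :=
    exists_adj_of_adjCount_pos (h.one_le_adjCount_sdiff_closedNbhdIn ha hva)
  exact ⟨b, hb⟩

lemma degree_le_three {v : V} (hv : v ∈ S) : adjCount G {v} S ≤ 3 := by
  by_contra! hlt
  obtain ⟨x, hx⟩ := h.sdiff_closedNbhdIn_nonempty hv
  obtain ⟨C, hC, hxC, h0, hconn⟩ := exists_component (G := G) hx
  exact h.false_of_hasSlack hv hC h0 (h.hasSlack_one hv hC ⟨x, hxC⟩ h0 hconn) (by omega)

lemma four_le_cut_of_spansFourCycle {A : Finset V} (hA : SpansFourCycle G A) (hAS : A ⊆ S) :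
    4 ≤ adjCount G A (S \ A) := by
  have hcut := h.three_le_cut_of_spansFourCycle hA hAS
  obtain ⟨p, q, r, s, rfl, hc⟩ := hA
  have hsum := h.adjCount_fourCycle_sdiff hc hAS
  have hAS' := hAS
  simp only [Finset.insert_subset_iff, Finset.singleton_subset_iff] at hAS'
  have hp := h.degree_le_three hAS'.1
  have hq := h.degree_le_three hAS'.2.1
  have hr := h.degree_le_three hAS'.2.2.1
  have hs := h.degree_le_three hAS'.2.2.2
  have hS1 : {q, r, s, p} ⊆ S := by rwa [IsFourCycle.quad_rotate]
  have hS2 : {r, s, p, q} ⊆ S := by rwa [IsFourCycle.quad_rotate]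
  have hS3 : {s, p, q, r} ⊆ S := by rwa [IsFourCycle.quad_rotate]
  have h1 := h.three_le_degree_opposite hc hAS
  have h2 := h.three_le_degree_opposite hc.rotate hS1
  have h3 := h.three_le_degree_opposite hc.rotate.rotate hS2
  have h4 := h.three_le_degree_opposite hc.rotate.rotate.rotate hS3
  omega

lemma degree_eq_two {v : V} (hv : v ∈ S) : adjCount G {v} S = 2 := by
  refine le_antisymm ?_ (h.two_le_degree hv)
  by_contra! hlt
  have hWS := closedNbhdIn_subset (G := G) hv
  have hW : (closedNbhdIn G S v).Nonempty := ⟨v, mem_closedNbhdIn.2 (Or.inl rfl)⟩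
  obtain ⟨x, hx⟩ := h.sdiff_closedNbhdIn_nonempty hv
  obtain ⟨C, hC, hxC, h0, hconn⟩ := exists_component (G := G) hx
  have hC1 := h.hasSlack_one hv hC ⟨x, hxC⟩ h0 hconn
  rcases ((S \ closedNbhdIn G S v) \ C).eq_empty_or_nonempty with he | ⟨y, hy⟩
  · have hCeq : C = S \ closedNbhdIn G S v := hC.antisymm (Finset.sdiff_eq_empty_iff_subset.1 he)
    have hcut : 3 ≤ adjCount G C (closedNbhdIn G S v) := by
      calc 3 ≤ adjCount G {v} S := hlt
        _ = ∑ a ∈ S.filter (G.Adj v), 1 := by simp [adjCount_singleton_left]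
        _ ≤ ∑ a ∈ S.filter (G.Adj v), adjCount G {a} C := by
            refine Finset.sum_le_sum fun a ha => ?_
            rw [Finset.mem_filter] at ha
            rw [hCeq]
            exact h.one_le_adjCount_sdiff_closedNbhdIn ha.1 ha.2
        _ = adjCount G (S.filter (G.Adj v)) C := (adjCount_eq_sum _ _).symm
        _ ≤ adjCount G (closedNbhdIn G S v) C :=
            adjCount_mono (Finset.subset_insert _ _) subset_rfl
        _ = _ := adjCount_comm _ _
    refine h.false_of_hasSlack hv hC h0 (t := 2) ?_ (by omega)
    by_cases hC4 : SpansFourCycle G C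
    · have := h.four_le_cut_of_spansFourCycle hC4 (hC.trans Finset.sdiff_subset)
      rw [adjCount_sdiff_eq hWS hC h0] at this
      exact hasSlack_of_spansFourCycle h.triangleFree hC4 (by omega)
    · exact (h.hasSlack_of_not_spansFourCycle hWS hW hC ⟨x, hxC⟩ h0 hconn hC4).2.mono (by omega)
  · obtain ⟨E, hE, hyE, hE0, hEconn⟩ := exists_component (G := G) hy
    have hER := hE.trans Finset.sdiff_subset
    have hE0' := (adjCount_sdiff_sdiff_eq_zero
      (adjCount_sdiff_sdiff_eq_zero (R := S \ closedNbhdIn G S v)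
        (S := S \ closedNbhdIn G S v) (by simp) h0 hC).2 hE0 hE).1
    have hE1 := h.hasSlack_one hv hER ⟨y, hyE⟩ hE0' hEconn
    have hd : Disjoint C E := Finset.disjoint_sdiff.mono_right hE
    have hCE : adjCount G C E = 0 := by
      have := adjCount_mono (G := G) (subset_refl C) hE
      omega
    refine h.false_of_hasSlack hv (Finset.union_subset hC hER) ?_ (hC1.union hE1 hd hCE)
      (by omega)
    rw [adjCount_union_left hd]
    have h1 := adjCount_mono (G := G) (subset_refl C) (Finset.sdiff_subset_sdiff
      (subset_refl (S \ closedNbhdIn G S v)) (Finset.subset_union_left (s₁ := C) (s₂ := E)))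
    have h2 := adjCount_mono (G := G) (subset_refl E) (Finset.sdiff_subset_sdiff
      (subset_refl (S \ closedNbhdIn G S v)) (Finset.subset_union_right (s₁ := C) (s₂ := E)))
    omega

lemma inducesForest_sdiff_closedNbhdIn {v : V} (hv : v ∈ S) :
    InducesForest G (S \ closedNbhdIn G S v) := by
  by_contra hf
  obtain ⟨X, hX, hne, hdeg⟩ := exists_minDegree_two_of_not_inducesForest hf
  have hXS := hX.trans Finset.sdiff_subset
  have hXv : X ≠ S := by
    rintro rfl
    have := hX hv
    simp [mem_closedNbhdIn] at this
  have hcut := h.connected X hXS hne hXv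
  obtain ⟨a, ha, b, hb, hab⟩ := exists_adj_of_adjCount_pos hcut
  have h1 := hdeg a ha
  have h2 := h.degree_eq_two (hXS ha)
  rw [adjCount_sdiff_right hXS] at h2
  have := adjCount_pos (Finset.mem_singleton_self a) hb hab
  omega

lemma five_le_card : 5 ≤ #S := by
  obtain ⟨v, hv⟩ : S.Nonempty := by
    by_contra! he
    exact h.not_inducesForest (he ▸ inducesForest_empty)
  obtain ⟨a, ha, _, hva⟩ := exists_adj_ne (z := v) (h.two_le_degree hv)
  obtain ⟨b, hb, hba, hvb⟩ := exists_adj_ne (z := a) (h.two_le_degree hv)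
  obtain ⟨w, hw, hwv, haw⟩ := exists_adj_ne (z := v) (h.two_le_degree ha)
  obtain ⟨x, hx, hxv, hbx⟩ := exists_adj_ne (z := v) (h.two_le_degree hb)
  have hab := h.triangleFree a v b hva.symm hvb
  have hwb : w ≠ b := fun e => hab (e ▸ haw)
  have hxa : x ≠ a := fun e => hab (e ▸ hbx).symm
  have h4 : #{v, a, b, w} = 4 := Finset.card_eq_four.2
    ⟨v, a, b, w, hva.ne, hvb.ne, hwv.symm, hba.symm, haw.ne, hwb.symm, rfl⟩
  have hsub : {v, a, b, w} ⊆ S := by simp [Finset.insert_subset_iff, *]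
  have hle := Finset.card_le_card hsub
  by_contra! hlt
  have hSeq : {v, a, b, w} = S := Finset.eq_of_subset_of_card_le hsub (by omega)
  have hxw : x = w := by
    have := hx
    rw [← hSeq] at this
    simp only [Finset.mem_insert, Finset.mem_singleton] at this
    rcases this with e | e | e | e
    · exact absurd e hxv
    · exact absurd e hxa
    · exact absurd e hbx.ne.symm
    · exact e
  subst hxw
  refine h.not_fourCycle ⟨v, a, x, b, ?_, hva, haw, hbx.symm, hvb.symm, hwv.symm, hba.symm⟩
  rw [← hSeq, Finset.pair_comm b x]

lemma false : False := by
  have h5 := h.five_le_card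
  obtain ⟨v, hv⟩ : S.Nonempty := Finset.card_pos.1 (by omega)
  refine h.not_bound ⟨{v}, (h.inducesForest_sdiff_closedNbhdIn hv).mono fun x hx => ?_, ?_⟩
  · simp only [residue, Finset.mem_filter, Finset.mem_singleton, forall_eq] at hx
    simp only [Finset.mem_sdiff, mem_closedNbhdIn]
    tauto
  · rw [adjCount_eq_sum, Finset.sum_congr rfl fun x hx => h.degree_eq_two hx]
    simp
    omega

end IsMinimalCounterexample

lemma hasIsolationBound_of_inducesConnected
    (h3 : ∀ a b c, G.Adj a b → G.Adj b c → ¬ G.Adj a c) (S : Finset V)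
    (hconn : InducesConnected G S) (h4 : ¬ SpansFourCycle G S) : HasIsolationBound G S := by
  induction S using Finset.strongInduction with
  | H S ih =>
    by_contra hno
    exact IsMinimalCounterexample.false
      ⟨h3, hconn, h4, hno, fun T hT _ hTc hT4 => ih T hT hTc hT4⟩

end IsolationOfCycles

/-- An injective homomorphism from a cycle cannot land in a forest. -/
lemma InducesForest.not_hasCopy {V : Type*} [DecidableEq V] {G : SimpleGraph V}
    [DecidableRel G.Adj] {S : Finset V} (hS : InducesForest G S) {n : ℕ} (hn : 3 ≤ n)
    (f : cycleGraph n →g G) (hf : Function.Injective f) (hfS : ∀ i, f i ∈ S) : False := by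
  obtain ⟨k, rfl⟩ : ∃ k, n = k + 3 := ⟨n - 3, by omega⟩
  have hforest := hS (Finset.univ.image f) (fun x hx => by
    obtain ⟨i, -, rfl⟩ := Finset.mem_image.1 hx
    exact hfS i) (by simp)
  have hmem : ∀ i, f i ∈ Finset.univ.image f := fun i => Finset.mem_image_of_mem f (by simp)
  have hle : 2 * (Finset.univ.image f).card ≤
      adjCount G (Finset.univ.image f) (Finset.univ.image f) := by
    rw [adjCount_eq_sum, mul_comm, ← smul_eq_mul, ← Finset.sum_const]
    refine Finset.sum_le_sum fun x hx => ?_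
    obtain ⟨i, -, rfl⟩ := Finset.mem_image.1 hx
    refine two_le_adjCount (Finset.mem_singleton_self _) (hmem (i + 1)) (hmem (i - 1)) ?_
      (f.map_rel ?_) (f.map_rel ?_)
    · intro he
      have h1 := hf he
      have h2 : (1 : Fin (k + 3)) + 1 = 0 := by
        have : i + 1 + 1 = i := by rw [h1]; abel
        simpa [add_assoc] using this
      have h3 : 2 % (k + 3) = 2 := Nat.mod_eq_of_lt (by omega)
      simp [Fin.ext_iff, Fin.val_add, h3] at h2
    · simp [cycleGraph_adj]
    · simp [cycleGraph_adj]
  omega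

lemma inducesConnected_univ {V : Type*} [Fintype V] [DecidableEq V] {G : SimpleGraph V}
    [DecidableRel G.Adj] (hG : G.Connected) : InducesConnected G Finset.univ := by
  intro T _ hne hT
  obtain ⟨a, ha⟩ := hne
  obtain ⟨b, hb⟩ : ∃ b, b ∉ T := by
    by_contra! hall
    exact hT (Finset.eq_univ_of_forall hall)
  obtain ⟨p⟩ := hG.preconnected a b
  obtain ⟨d, -, hd1, hd2⟩ := p.exists_boundary_dart (T : Set V) ha hb
  exact adjCount_pos hd1 (Finset.mem_sdiff.2 ⟨Finset.mem_univ _, hd2⟩) d.adj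

lemma adjCount_univ_univ {V : Type*} [Fintype V] (G : SimpleGraph V) [DecidableRel G.Adj] :
    adjCount G Finset.univ Finset.univ = 2 * G.edgeSet.ncard := by
  classical
  rw [← coe_edgeFinset, Set.ncard_coe_finset, ← sum_degrees_eq_twice_card_edges, adjCount_eq_sum]
  refine Finset.sum_congr rfl fun x _ => ?_
  rw [adjCount_singleton_left, ← card_neighborFinset_eq_degree]
  congr 1
  ext y
  simp

lemma not_adj_of_not_hasCopy_cycleGraph_three {V : Type*} {G : SimpleGraph V}
    (h : ¬ HasCopy (cycleGraph 3) G) (a b c : V) (hab : G.Adj a b) (hbc : G.Adj b c) :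
    ¬ G.Adj a c := by
  intro hac
  refine h ⟨⟨![a, b, c], ?_⟩, ?_⟩
  · intro i j hij
    fin_cases i <;> fin_cases j <;> simp_all [G.adj_comm]
  · have := hab.ne
    have := hbc.ne
    have := hac.ne
    intro i j hij
    fin_cases i <;> fin_cases j <;> simp_all

lemma not_spansFourCycle_univ {V : Type*} [Fintype V] [DecidableEq V] {G : SimpleGraph V}
    (h3 : ∀ a b c, G.Adj a b → G.Adj b c → ¬ G.Adj a c)
    (h : ¬ Nonempty (G ≃g cycleGraph 4)) : ¬ SpansFourCycle G Finset.univ := by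
  rintro ⟨p, q, r, s, huniv, hc⟩
  have hpr := h3 p q r hc.pq hc.qr
  have hqs := h3 q r s hc.qr hc.rs
  have hinj : Function.Injective ![p, q, r, s] := by
    have := hc.pq.ne; have := hc.qr.ne; have := hc.rs.ne; have := hc.sp.ne
    have := hc.pr; have := hc.qs
    intro i j hij
    fin_cases i <;> fin_cases j <;> simp_all
  have hsurj : Function.Surjective ![p, q, r, s] := by
    intro x
    have hx := Finset.mem_univ x
    rw [huniv] at hx
    simp only [Finset.mem_insert, Finset.mem_singleton] at hx
    rcases hx with rfl | rfl | rfl | rfl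
    exacts [⟨0, rfl⟩, ⟨1, rfl⟩, ⟨2, rfl⟩, ⟨3, rfl⟩]
  have hadj : ∀ i j, G.Adj (![p, q, r, s] i) (![p, q, r, s] j) ↔ (cycleGraph 4).Adj i j := by
    have h01 : (cycleGraph 4).Adj 0 1 ∧ (cycleGraph 4).Adj 1 2 ∧ (cycleGraph 4).Adj 2 3 ∧
        (cycleGraph 4).Adj 3 0 ∧ ¬ (cycleGraph 4).Adj 0 2 ∧ ¬ (cycleGraph 4).Adj 1 3 := by
      simp only [cycleGraph_adj]
      decide
    have h10 : (cycleGraph 4).Adj 1 0 ∧ (cycleGraph 4).Adj 2 1 ∧ (cycleGraph 4).Adj 3 2 ∧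
        (cycleGraph 4).Adj 0 3 ∧ ¬ (cycleGraph 4).Adj 2 0 ∧ ¬ (cycleGraph 4).Adj 3 1 := by
      simp only [cycleGraph_adj]
      decide
    intro i j
    fin_cases i <;> fin_cases j <;>
      simp [h01, h10, hc.pq, hc.qr, hc.rs, hc.sp, hpr, hqs, SimpleGraph.adj_comm _ q p,
        SimpleGraph.adj_comm _ r q, SimpleGraph.adj_comm _ s r, SimpleGraph.adj_comm _ p s,
        SimpleGraph.adj_comm _ r p, SimpleGraph.adj_comm _ s q]
  let e : cycleGraph 4 ≃g G := ⟨Equiv.ofBijective _ ⟨hinj, hsurj⟩, hadj _ _⟩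
  exact h ⟨e.symm⟩

/-- If `G` is a connected graph with exactly `m` edges, `G` contains no
triangle, and `G` is not a 4-cycle, then `ι(G, 𝓒) ≤ (m+1)/6`, where `𝓒` is the set of all
cycles. -/
theorem isolation_cycles_le_edges_of_triangleFree {V : Type*} [Fintype V] (G : SimpleGraph V)
    (m : ℕ) (hm : G.edgeSet.ncard = m) (hconn : G.Connected)
    (htri : ¬ HasCopy (cycleGraph 3) G)
    (hC4 : ¬ Nonempty (G ≃g cycleGraph 4)) :
    (iotaCycGE 3 G : ℝ) ≤ (m + 1) / 6 := by
  classical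
  have h3 := not_adj_of_not_hasCopy_cycleGraph_three htri
  obtain ⟨D, hD, hc⟩ := hasIsolationBound_of_inducesConnected h3 Finset.univ
    (inducesConnected_univ hconn) (not_spansFourCycle_univ h3 hC4)
  rw [adjCount_univ_univ, hm] at hc
  have hle : iotaCycGE 3 G ≤ D.card := by
    refine Nat.sInf_le ⟨D, Set.ncard_coe_finset D, ?_⟩
    rintro n hn ⟨f, hf⟩
    refine hD.not_hasCopy hn ((Embedding.induce _).toHom.comp f)
      (Subtype.val_injective.comp hf) fun i => ?_
    have hi := (f i).2
    simp only [closedNbhd, Set.mem_compl_iff, Set.mem_union, Set.mem_ofPred_eq, not_or,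
      not_exists, not_and] at hi
    simp only [residue, Finset.mem_filter, Finset.mem_univ, true_and]
    exact fun u hu => ⟨fun e => hi.1 (by rw [← e] at hu; exact hu), hi.2 u hu⟩
  have h6 : 6 * iotaCycGE 3 G ≤ m + 1 := by omega
  rw [le_div_iff₀ (by norm_num)]
  exact_mod_cast (mul_comm _ _).trans_le h6
end

section
/- For any integer k ≥ 1, if G is a connected graph with exactly n vertices, G is not isomorphic to the complete graph K_k, and it is not the case that k = 2 and G is a 5-cycle, then the K_k-isolation number of G satisfies ι(G, K_k) ≤ n/(k+1). -/
open SimpleGraph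

/-- `D` is an `F`-isolating set of `G` : the graph `G − N[D]` contains no copy of `F`. -/
def IsGraphIsolating {W V : Type*} (F : SimpleGraph W) (G : SimpleGraph V) (D : Set V) : Prop :=
  ¬ HasCopy F (G.induce (closedNbhd G D)ᶜ)

/-- The `F`-isolation number of `G` : the least cardinality of an `F`-isolating set. -/
noncomputable def iotaGraph {W V : Type*} (F : SimpleGraph W) (G : SimpleGraph V) : ℕ :=
  sInf {r | ∃ D : Set V, D.ncard = r ∧ IsGraphIsolating F G D}

namespace CliqueIsolation

variable {V : Type*} {G : SimpleGraph V} {k : ℕ} {S A B D E : Finset V}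

/-- The vertex `a` lies in the closed neighbourhood of `D`. -/
def Dom (G : SimpleGraph V) (D : Finset V) (a : V) : Prop :=
  a ∈ D ∨ ∃ d ∈ D, G.Adj d a

/-- Every `k`-clique inside `S` meets the closed neighbourhood of `D`. The set `D` need not be
contained in `S`. -/
def Isolates (G : SimpleGraph V) (k : ℕ) (S D : Finset V) : Prop :=
  ∀ C ⊆ S, G.IsNClique k C → ∃ c ∈ C, Dom G D c

/-- `S` has an isolating set of size at most `|S| / (k + 1)`. -/
def Solvable (G : SimpleGraph V) (k : ℕ) (S : Finset V) : Prop :=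
  ∃ D : Finset V, (k + 1) * D.card ≤ S.card ∧ Isolates G k S D

/-- `T` is closed under adjacency inside `S`. -/
def ClosedIn (G : SimpleGraph V) (S T : Finset V) : Prop :=
  ∀ a ∈ T, ∀ b ∈ S, G.Adj a b → b ∈ T

/-- `S` induces a connected subgraph, expressed through cuts. -/
def Conn (G : SimpleGraph V) (S : Finset V) : Prop :=
  S.Nonempty ∧ ∀ T ⊆ S, T.Nonempty → ClosedIn G S T → T = S

/-- `B` is the vertex set of a component of the subgraph induced by `S`. -/
structure IsComp (G : SimpleGraph V) (S B : Finset V) : Prop where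
  subset : B ⊆ S
  conn : Conn G B
  closed : ClosedIn G S B

/-- `a, b, c, d, e` is an induced 5-cycle. -/
structure IsInducedC5 (G : SimpleGraph V) (a b c d e : V) : Prop where
  ab : G.Adj a b
  bc : G.Adj b c
  cd : G.Adj c d
  de : G.Adj d e
  ea : G.Adj e a
  nac : ¬ G.Adj a c
  nad : ¬ G.Adj a d
  nbd : ¬ G.Adj b d
  nbe : ¬ G.Adj b e
  nce : ¬ G.Adj c e

lemma Dom.mono (h : D ⊆ E) {a : V} (ha : Dom G D a) : Dom G E a := by
  rcases ha with ha | ⟨d, hd, ha⟩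
  · exact Or.inl (h ha)
  · exact Or.inr ⟨d, h hd, ha⟩

lemma IsInducedC5.rotate {a b c d e : V} (h : IsInducedC5 G a b c d e) :
    IsInducedC5 G b c d e a :=
  ⟨h.bc, h.cd, h.de, h.ea, h.ab, h.nbd, h.nbe, h.nce, fun x => h.nac x.symm,
    fun x => h.nad x.symm⟩

lemma IsInducedC5.distinct {a b c d e : V} (h : IsInducedC5 G a b c d e) :
    a ≠ b ∧ a ≠ c ∧ a ≠ d ∧ a ≠ e ∧ b ≠ c ∧ b ≠ d ∧ b ≠ e ∧ c ≠ d ∧ c ≠ e ∧ d ≠ e := by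
  refine ⟨h.ab.ne, ?_, ?_, h.ea.ne', h.bc.ne, ?_, ?_, h.cd.ne, ?_, h.de.ne⟩
  · rintro rfl; exact h.nad h.cd
  · rintro rfl; exact h.nac h.cd.symm
  · rintro rfl; exact h.nbe h.de
  · rintro rfl; exact h.nbd h.de.symm
  · rintro rfl; exact h.nac h.ea.symm

lemma clique_nonempty {C : Finset V} (hk : 1 ≤ k) (hCk : G.IsNClique k C) : C.Nonempty :=
  Finset.card_pos.1 (by rw [hCk.card_eq]; omega)

lemma conn_univ [Fintype V] (hG : G.Connected) : Conn G Finset.univ := by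
  obtain ⟨a⟩ := hG.nonempty
  refine ⟨⟨a, Finset.mem_univ a⟩, fun T _ ⟨t, ht⟩ hcl => ?_⟩
  refine Finset.eq_univ_of_forall fun b => ?_
  obtain ⟨p⟩ := hG.preconnected t b
  induction p with
  | nil => exact ht
  | cons h p ih => exact ih (hcl _ ht _ (Finset.mem_univ _) h)

lemma nonempty_iso_top [Fintype V] (h : G.IsNClique k Finset.univ) :
    Nonempty (G ≃g (⊤ : SimpleGraph (Fin k))) := by
  refine ⟨⟨Fintype.equivFinOfCardEq h.card_eq, ?_⟩⟩
  intro a b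
  rw [SimpleGraph.top_adj, (Equiv.injective _).ne_iff]
  exact ⟨fun hab => h.isClique (by simp) (by simp) hab, fun hab => hab.ne⟩

lemma Isolates.mono (h : D ⊆ E) (hD : Isolates G k S D) : Isolates G k S E := fun C hC hk => by
  obtain ⟨c, hc, hd⟩ := hD C hC hk
  exact ⟨c, hc, hd.mono h⟩

variable [DecidableEq V]

/-- The exceptional vertex sets: `k`-cliques, and induced 5-cycles when `k = 2`. -/
def Bad (G : SimpleGraph V) (k : ℕ) (S : Finset V) : Prop :=
  G.IsNClique k S ∨ k = 2 ∧ ∃ a b c d e, IsInducedC5 G a b c d e ∧ S = {a, b, c, d, e}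

lemma IsInducedC5.card {a b c d e : V} (h : IsInducedC5 G a b c d e) :
    ({a, b, c, d, e} : Finset V).card = 5 := by
  obtain ⟨h1, h2, h3, h4, h5, h6, h7, h8, h9, h10⟩ := h.distinct
  simp [Finset.card_insert_of_notMem, *]

lemma IsInducedC5.exists_rotate {a b c d e y : V} (h : IsInducedC5 G a b c d e)
    (hy : y ∈ ({a, b, c, d, e} : Finset V)) : ∃ p q r s, IsInducedC5 G y p q r s ∧
      ({a, b, c, d, e} : Finset V) = {y, p, q, r, s} := by
  simp only [Finset.mem_insert, Finset.mem_singleton] at hy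
  rcases hy with rfl | rfl | rfl | rfl | rfl
  · exact ⟨_, _, _, _, h, rfl⟩
  · exact ⟨_, _, _, _, h.rotate, by ext; simp; tauto⟩
  · exact ⟨_, _, _, _, h.rotate.rotate, by ext; simp; tauto⟩
  · exact ⟨_, _, _, _, h.rotate.rotate.rotate, by ext; simp; tauto⟩
  · exact ⟨_, _, _, _, h.rotate.rotate.rotate.rotate, by ext; simp; tauto⟩

/-- A bad set has a small dominating set through any of its vertices. -/
lemma Bad.exists_dominating (hB : Bad G k B) {y : V} (hy : y ∈ B) :
    ∃ D : Finset V, y ∈ D ∧ (k + 1) * D.card ≤ B.card + 1 ∧ ∀ b ∈ B, Dom G D b := by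
  rcases hB with hB | ⟨rfl, a, b, c, d, e, h, rfl⟩
  · refine ⟨{y}, by simp, by simp [hB.card_eq], fun b hb => ?_⟩
    by_cases hby : b = y
    · exact Or.inl (by simp [hby])
    · exact Or.inr ⟨y, by simp, hB.isClique hy hb (Ne.symm hby)⟩
  · obtain ⟨p, q, r, s, h', he⟩ := h.exists_rotate hy
    rw [he]
    refine ⟨{y, q}, by simp, ?_, ?_⟩
    · rw [h'.card]
      have := Finset.card_le_two (a := y) (b := q)
      omega
    · intro b hb
      simp only [Finset.mem_insert, Finset.mem_singleton] at hb
      rcases hb with rfl | rfl | rfl | rfl | rfl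
      · exact Or.inl (by simp)
      · exact Or.inr ⟨y, by simp, h'.ab⟩
      · exact Or.inl (by simp)
      · exact Or.inr ⟨q, by simp, h'.cd⟩
      · exact Or.inr ⟨y, by simp, h'.ea.symm⟩

/-- After the removal of a vertex, a bad set is isolated by one vertex fewer. -/
lemma Bad.exists_isolating (hB : Bad G k B) {x y : V} (hy : y ∈ B) (hxy : G.Adj x y) :
    ∃ D : Finset V, (k + 1) * D.card + k ≤ B.card ∧ Isolates G k B (D ∪ {x}) := by
  rcases hB with hB | ⟨rfl, a, b, c, d, e, h, rfl⟩
  · refine ⟨∅, by simp [hB.card_eq], fun C hC hCk => ⟨y, ?_, Or.inr ⟨x, by simp, hxy⟩⟩⟩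
    rwa [Finset.eq_of_subset_of_card_le hC (by rw [hB.card_eq, hCk.card_eq])]
  · obtain ⟨p, q, r, s, h', he⟩ := h.exists_rotate hy
    rw [he]
    refine ⟨{q}, by rw [h'.card]; simp, fun C hC hCk => ?_⟩
    by_contra! hcon
    have hsub : C ⊆ {s} := by
      intro z hz
      have h1 := hcon z hz
      have h2 := hC hz
      simp only [Finset.mem_insert, Finset.mem_singleton] at h2 ⊢
      rcases h2 with rfl | rfl | rfl | rfl | rfl
      · exact absurd (Or.inr ⟨x, by simp, hxy⟩) h1
      · exact absurd (Or.inr ⟨q, by simp, h'.bc.symm⟩) h1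
      · exact absurd (Or.inl (by simp)) h1
      · exact absurd (Or.inr ⟨q, by simp, h'.cd⟩) h1
      · rfl
    have := Finset.card_le_card hsub
    rw [hCk.card_eq] at this
    simp at this

lemma Bad.conn (hk : 1 ≤ k) (hB : Bad G k B) : Conn G B := by
  rcases hB with hB | ⟨rfl, a, b, c, d, e, h, rfl⟩
  · refine ⟨Finset.card_pos.1 (by rw [hB.card_eq]; omega), ?_⟩
    rintro T hT ⟨t, ht⟩ hcl
    refine hT.antisymm fun b hb => ?_
    by_cases hbt : b = t
    · rwa [hbt]
    · exact hcl t ht b hb (hB.isClique (hT ht) hb (Ne.symm hbt))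
  · refine ⟨⟨a, by simp⟩, ?_⟩
    rintro T hT ⟨t, ht⟩ hcl
    refine hT.antisymm ?_
    obtain ⟨p, q, r, s, h', he⟩ := h.exists_rotate (hT ht)
    rw [he] at hcl ⊢
    have hp := hcl t ht p (by simp) h'.ab
    have hq := hcl p hp q (by simp) h'.bc
    have hr := hcl q hq r (by simp) h'.cd
    have hs := hcl r hr s (by simp) h'.de
    intro z hz
    simp only [Finset.mem_insert, Finset.mem_singleton] at hz
    rcases hz with rfl | rfl | rfl | rfl | rfl <;> assumption

lemma Conn.union (hA : Conn G A) (hB : Conn G B) {a b : V} (ha : a ∈ A) (hb : b ∈ B)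
    (hab : G.Adj a b ∨ a = b) : Conn G (A ∪ B) := by
  refine ⟨hA.1.mono Finset.subset_union_left, fun T hT hne hcl => ?_⟩
  have key : ∀ X, Conn G X → X ⊆ A ∪ B → (T ∩ X).Nonempty → X ⊆ T := by
    intro X hX hXS hn
    have := hX.2 (T ∩ X) Finset.inter_subset_right hn (fun p hp q hq hpq => by
      rw [Finset.mem_inter] at hp ⊢
      exact ⟨hcl p hp.1 q (hXS hq) hpq, hq⟩)
    exact Finset.inter_eq_right.1 this
  have hAT := key A hA Finset.subset_union_left
  have hBT := key B hB Finset.subset_union_right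
  have hab' : a ∈ T ↔ b ∈ T := by
    rcases hab with hab | rfl
    · exact ⟨fun h => hcl a h b (by simp [hb]) hab, fun h => hcl b h a (by simp [ha]) hab.symm⟩
    · rfl
  have hcases : (T ∩ A).Nonempty ∨ (T ∩ B).Nonempty := by
    obtain ⟨t, ht⟩ := hne
    rcases Finset.mem_union.1 (hT ht) with h | h
    · exact Or.inl ⟨t, by simp [ht, h]⟩
    · exact Or.inr ⟨t, by simp [ht, h]⟩
  refine hT.antisymm ?_
  rcases hcases with h | h
  · exact Finset.union_subset (hAT h) (hBT ⟨b, by simp [hb, hab'.1 (hAT h ha)]⟩)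
  · exact Finset.union_subset (hAT ⟨a, by simp [ha, hab'.2 (hBT h hb)]⟩) (hBT h)

lemma exists_isComp (hS : S.Nonempty) : ∃ B, IsComp G S B := by
  obtain ⟨B, ⟨hBS, hBn, hBc⟩, hmin⟩ := WellFounded.has_min
    (r := fun a b : Finset V => a < b) wellFounded_lt
    {T | T ⊆ S ∧ T.Nonempty ∧ ClosedIn G S T} ⟨S, subset_rfl, hS, fun _ _ b hb _ => hb⟩
  refine ⟨B, hBS, ⟨hBn, fun T hT hTn hTc => ?_⟩, hBc⟩
  by_contra hne
  exact hmin T ⟨hT.trans hBS, hTn, fun a ha b hb hab =>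
    hTc a ha b (hBc a (hT ha) b hb hab) hab⟩ (hT.ssubset_of_ne hne)

/-- A clique inside `S` meeting a set closed in `S` lies in it. -/
lemma clique_subset {C : Finset V} (hcl : ClosedIn G S B) (hC : C ⊆ S) (hCk : G.IsNClique k C)
    {c : V} (hc : c ∈ C) (hcB : c ∈ B) : C ⊆ B := fun z hz => by
  by_cases hzc : z = c
  · rwa [hzc]
  · exact hcl c hcB z (hC hz) (hCk.isClique hc hz (Ne.symm hzc))

/-- The bound may be verified component by component. -/
lemma solve_of_comp (hk : 1 ≤ k) (E : Finset V) (S : Finset V)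
    (h : ∀ B, IsComp G S B → ∃ D : Finset V, (k + 1) * D.card ≤ B.card ∧
      Isolates G k B (D ∪ E)) :
    ∃ D : Finset V, (k + 1) * D.card ≤ S.card ∧ Isolates G k S (D ∪ E) := by
  induction S using Finset.strongInduction with
  | H S ih =>
    rcases S.eq_empty_or_nonempty with rfl | hS
    · refine ⟨∅, by simp, fun C hC hCk => ?_⟩
      obtain ⟨c, hc⟩ := clique_nonempty hk hCk
      exact absurd (hC hc) (by simp)
    obtain ⟨B, hB⟩ := exists_isComp (G := G) hS
    have hcl : ClosedIn G S (S \ B) := fun a ha b hb hab => by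
      rw [Finset.mem_sdiff] at ha ⊢
      exact ⟨hb, fun hbB => ha.2 (hB.closed b hbB a ha.1 hab.symm)⟩
    obtain ⟨D1, hD1, hi1⟩ := h B hB
    obtain ⟨D2, hD2, hi2⟩ := ih (S \ B) (Finset.sdiff_ssubset hB.subset hB.conn.1)
      (fun B' hB' => h B' ⟨hB'.subset.trans Finset.sdiff_subset, hB'.conn,
        fun a ha b hb hab => hB'.closed a ha b (hcl a (hB'.subset ha) b hb hab) hab⟩)
    refine ⟨D1 ∪ D2, ?_, fun C hC hCk => ?_⟩
    · have h1 := Finset.card_union_le D1 D2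
      have h2 := Finset.card_sdiff_add_card_eq_card hB.subset
      nlinarith
    · obtain ⟨c, hc⟩ := clique_nonempty hk hCk
      by_cases hcB : c ∈ B
      · exact (hi1.mono (by grind)) C (clique_subset hB.closed hC hCk hc hcB) hCk
      · exact (hi2.mono (by grind)) C
          (clique_subset hcl hC hCk hc (by simp [hC hc, hcB])) hCk

lemma solvable_of_comp (hk : 1 ≤ k) (h : ∀ B, IsComp G S B → Solvable G k B) :
    Solvable G k S := by
  obtain ⟨D, h1, h2⟩ := solve_of_comp hk ∅ S (fun B hB => by simpa [Solvable] using h B hB)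
  exact ⟨D, h1, by simpa using h2⟩

/-- Removal of dominated vertices. -/
lemma Solvable.extend (hA : Solvable G k A) (E : Finset V)
    (hcard : (k + 1) * E.card + A.card ≤ S.card) (hdom : ∀ a ∈ S, a ∉ A → Dom G E a) :
    Solvable G k S := by
  obtain ⟨D, hD, hi⟩ := hA
  refine ⟨D ∪ E, ?_, fun C hC hCk => ?_⟩
  · have h1 := Finset.card_union_le D E
    nlinarith
  · by_cases hCA : C ⊆ A
    · exact (hi.mono Finset.subset_union_left) C hCA hCk
    · obtain ⟨c, hc, hcA⟩ := Finset.not_subset.1 hCA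
      exact ⟨c, hc, (hdom c (hC hc) hcA).mono Finset.subset_union_right⟩

lemma Bad.extend (hA : Bad G k A) (hk : 1 ≤ k) (E : Finset V)
    (hcard : (k + 1) * E.card + A.card + 1 ≤ S.card) (hdom : ∀ a ∈ S, a ∉ A → Dom G E a) :
    Solvable G k S := by
  obtain ⟨y, hy⟩ := (hA.conn hk).1
  obtain ⟨D, -, hD, hd⟩ := hA.exists_dominating hy
  refine ⟨D ∪ E, ?_, fun C hC hCk => ?_⟩
  · have h1 := Finset.card_union_le D E
    nlinarith
  · obtain ⟨c, hc⟩ := clique_nonempty hk hCk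
    by_cases hcA : c ∈ A
    · exact ⟨c, hc, (hd c hcA).mono Finset.subset_union_left⟩
    · exact ⟨c, hc, (hdom c (hC hc) hcA).mono Finset.subset_union_right⟩

/-- If deleting a vertex leaves a bad component, the bound follows. -/
lemma solvable_of_bad_comp (hk : 1 ≤ k) (hS : Conn G S)
    (ih : ∀ A : Finset V, A.card < S.card → Conn G A → ¬ Bad G k A → Solvable G k A)
    {x : V} (hx : x ∈ S) (hB : IsComp G (S.erase x) B) (hbad : Bad G k B) :
    Solvable G k S := by
  have hlink : ∀ B', IsComp G (S.erase x) B' → ∃ y ∈ B', G.Adj x y := by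
    intro B' hB'
    by_contra! hcon
    have hxB : x ∉ B' := fun h => by simpa using hB'.subset h
    have : B' = S := hS.2 B' (hB'.subset.trans (Finset.erase_subset _ _)) hB'.conn.1
      (fun a ha b hb hab => hB'.closed a ha b (Finset.mem_erase.2
        ⟨fun hbx => hcon a ha (hbx ▸ hab.symm), hb⟩) hab)
    exact hxB (this ▸ hx)
  have hcl : ClosedIn G (S.erase x) (S.erase x \ B) := fun a ha b hb hab => by
    rw [Finset.mem_sdiff] at ha ⊢
    exact ⟨hb, fun hbB => ha.2 (hB.closed b hbB a ha.1 hab.symm)⟩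
  obtain ⟨y, hy, hxy⟩ := hlink B hB
  obtain ⟨D1, hD1, hi1⟩ := hbad.exists_isolating hy hxy
  obtain ⟨D2, hD2, hi2⟩ := solve_of_comp hk {x} (S.erase x \ B) (G := G) (fun B' hB' => by
    have hB'' : IsComp G (S.erase x) B' := ⟨hB'.subset.trans Finset.sdiff_subset, hB'.conn,
        fun a ha b hb hab => hB'.closed a ha b (hcl a (hB'.subset ha) b hb hab) hab⟩
    by_cases hb : Bad G k B'
    · obtain ⟨y', hy', hxy'⟩ := hlink B' hB''
      obtain ⟨D, h1, h2⟩ := hb.exists_isolating hy' hxy'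
      exact ⟨D, by omega, h2⟩
    · obtain ⟨D, h1, h2⟩ := ih B'
        ((Finset.card_le_card hB''.subset).trans_lt (Finset.card_erase_lt_of_mem hx)) hB'.conn hb
      exact ⟨D, h1, h2.mono Finset.subset_union_left⟩)
  refine ⟨D1 ∪ D2 ∪ {x}, ?_, fun C hC hCk => ?_⟩
  · have h1 := Finset.card_union_le (D1 ∪ D2) {x}
    have h3 := Finset.card_union_le D1 D2
    have h2 := Finset.card_sdiff_add_card_eq_card hB.subset
    have h4 := Finset.card_erase_add_one hx
    simp only [Finset.card_singleton] at h1
    nlinarith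
  · by_cases hxC : x ∈ C
    · exact ⟨x, hxC, Or.inl (by simp)⟩
    have hC' : C ⊆ S.erase x := fun z hz =>
      Finset.mem_erase.2 ⟨fun h => hxC (h ▸ hz), hC hz⟩
    obtain ⟨c, hc⟩ := clique_nonempty hk hCk
    by_cases hcB : c ∈ B
    · exact (hi1.mono (by grind)) C (clique_subset hB.closed hC' hCk hc hcB) hCk
    · exact (hi2.mono (by grind)) C
        (clique_subset hcl hC' hCk hc (Finset.mem_sdiff.2 ⟨hC' hc, hcB⟩)) hCk

/-- A vertex `x` attached to two bad sets `K` and `H`, with the rest `U` of `S` attached only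
to `x`. -/
structure Config (G : SimpleGraph V) (k : ℕ) (S K H U : Finset V) (x v y : V) : Prop where
  eq : S = insert x (K ∪ H ∪ U)
  xK : x ∉ K
  xH : x ∉ H
  xU : x ∉ U
  KH : Disjoint K H
  KU : Disjoint K U
  HU : Disjoint H U
  vK : v ∈ K
  yH : y ∈ H
  xv : G.Adj x v
  xy : G.Adj x y
  nKU : ∀ a ∈ K, ∀ b ∈ U, ¬ G.Adj a b
  nHU : ∀ a ∈ H, ∀ b ∈ U, ¬ G.Adj a b
  badK : Bad G k K
  badH : Bad G k H
  connU : Conn G (insert x U)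
  solU : Solvable G k U

variable {K H U : Finset V} {x v y : V}

lemma Config.symm (c : Config G k S K H U x v y) : Config G k S H K U x y v :=
  ⟨by rw [c.eq, Finset.union_comm K H], c.xH, c.xK, c.xU, c.KH.symm, c.HU, c.KU, c.yH, c.vK, c.xy,
    c.xv, c.nHU, c.nKU, c.badH, c.badK, c.connU, c.solU⟩

lemma Config.card (c : Config G k S K H U x v y) :
    S.card = K.card + H.card + U.card + 1 := by
  rw [c.eq, Finset.card_insert_of_notMem (by simp [c.xK, c.xH, c.xU]),
    Finset.card_union_of_disjoint (Finset.disjoint_union_left.2 ⟨c.KU, c.HU⟩),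
    Finset.card_union_of_disjoint c.KH]

lemma solvable_of_dominated
    (ih : ∀ A : Finset V, A.card < S.card → Conn G A → ¬ Bad G k A → Solvable G k A)
    (E : Finset V) (hE : E.Nonempty) (hA : Conn G A) (hbad : ¬ Bad G k A)
    (hcard : (k + 1) * E.card + A.card ≤ S.card) (hdom : ∀ a ∈ S, a ∉ A → Dom G E a) :
    Solvable G k S := by
  have := hE.card_pos
  exact (ih A (by nlinarith) hA hbad).extend E hcard hdom

lemma conn_clique {C : Finset V} (hC : G.IsClique (C : Set V)) (hne : C.Nonempty) :
    Conn G C :=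
  Bad.conn (k := C.card) hne.card_pos (Or.inl ⟨hC, rfl⟩)

/-- A vertex `z` of the clique `H` with two neighbours in the clique `K`. -/
lemma Config.solvable_of_two (c : Config G k S K H U x v y) (hk : 1 ≤ k)
    (ih : ∀ A : Finset V, A.card < S.card → Conn G A → ¬ Bad G k A → Solvable G k A)
    (hK : G.IsNClique k K) (hH : G.IsNClique k H) {z s t : V} (hz : z ∈ H) (hs : s ∈ K)
    (ht : t ∈ K) (hst : s ≠ t) (hzs : G.Adj z s) (hzt : G.Adj z t)
    (hxs : ¬ G.Adj x s) (hxt : ¬ G.Adj x t) : Solvable G k S := by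
  have hvs : v ≠ s := by rintro rfl; exact hxs c.xv
  have hvt : v ≠ t := by rintro rfl; exact hxt c.xv
  set K' := K \ {s, t} with hK'
  have hvK' : v ∈ K' := by simp [hK', c.vK, hvs, hvt]
  have hconn : Conn G (insert x U ∪ K') :=
    c.connU.union (conn_clique (hK.isClique.subset (by simp [hK'])) ⟨v, hvK'⟩)
      (by simp) hvK' (Or.inl c.xv)
  have hcard : (insert x U ∪ K').card + (k + 2) = S.card := by
    have hsub : ({s, t} : Finset V) ⊆ K := by grind
    have h1 := Finset.card_sdiff_add_card_eq_card hsub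
    rw [Finset.card_pair hst, hK.card_eq] at h1
    rw [Finset.card_union_of_disjoint, Finset.card_insert_of_notMem c.xU, c.card, hK.card_eq,
      hH.card_eq]
    · have : K'.card + 2 = k := h1
      omega
    · rw [Finset.disjoint_insert_left]
      exact ⟨fun h => c.xK (Finset.sdiff_subset h), (c.KU.mono_left Finset.sdiff_subset).symm⟩
  have hdom : ∀ a ∈ S, a ∉ insert x U ∪ K' → Dom G {z} a := by
    intro a ha haA
    rw [c.eq] at ha
    have : a ∈ H ∨ a = s ∨ a = t := by grind
    rcases this with h | rfl | rfl
    · by_cases haz : a = z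
      · exact Or.inl (by simp [haz])
      · exact Or.inr ⟨z, by simp, hH.isClique hz h (Ne.symm haz)⟩
    · exact Or.inr ⟨z, by simp, hzs⟩
    · exact Or.inr ⟨z, by simp, hzt⟩
  by_cases hbad : Bad G k (insert x U ∪ K')
  · exact hbad.extend hk {z} (by rw [Finset.card_singleton]; omega) hdom
  · exact solvable_of_dominated ih {z} (by simp) hconn hbad
      (by rw [Finset.card_singleton]; omega) hdom

/-- Any clique of `S` that avoids `N(x)`, `x` and the isolating set of `U` lies in `K ∪ H`. -/
lemma Config.clique_subset (c : Config G k S K H U x v y) {C D : Finset V}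
    (hD : Isolates G k U D) (hC : C ⊆ S) (hCk : G.IsNClique k C) (hCD : ∀ a ∈ C, ¬ Dom G D a)
    (hxC : x ∉ C) : C ⊆ K ∪ H := by
  have hCS : C ⊆ K ∪ H ∪ U := fun z hz => by
    have h1 := hC hz
    rw [c.eq, Finset.mem_insert] at h1
    exact h1.resolve_left (fun h => hxC (h ▸ hz))
  intro z hz
  by_contra hzKH
  have hzU : z ∈ U := (Finset.mem_union.1 (hCS hz)).resolve_left hzKH
  have hcl : ClosedIn G (K ∪ H ∪ U) U := fun a ha b hb hab => by
    by_contra hbU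
    rcases Finset.mem_union.1 ((Finset.mem_union.1 hb).resolve_right hbU) with h | h
    · exact c.nKU b h a ha hab.symm
    · exact c.nHU b h a ha hab.symm
  obtain ⟨w, hw, hwD⟩ := hD C (CliqueIsolation.clique_subset hcl hCS hCk hz hzU) hCk
  exact hCD w hw hwD

/-- For `k = 2`, one vertex dominating all but one vertex of `K ∪ H ∪ {x}` suffices. -/
lemma Config.solvable_two_of_dominated (c : Config G 2 S K H U x v y) {z u : V}
    (hxz : G.Adj z x) (hdom : ∀ a ∈ K ∪ H, a ≠ u → Dom G {z} a) (hcard : 2 ≤ K.card + H.card) :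
    Solvable G 2 S := by
  obtain ⟨D, hD, hi⟩ := c.solU
  refine ⟨D ∪ {z}, ?_, fun C hC hCk => ?_⟩
  · have h1 := Finset.card_union_le D {z}
    have h2 := c.card
    simp only [Finset.card_singleton] at h1
    omega
  · by_contra! hcon
    have hxC : x ∉ C := fun h => hcon x h (Or.inr ⟨z, by simp, hxz⟩)
    have hsub := c.clique_subset hi hC hCk
      (fun a ha h => hcon a ha (h.mono Finset.subset_union_left)) hxC
    have hCu : C ⊆ {u} := fun a ha => by
      by_contra hau
      exact hcon a ha ((hdom a (hsub ha) (by simpa using hau)).mono Finset.subset_union_right)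
    have := Finset.card_le_card hCu
    rw [hCk.card_eq] at this
    simp at this

/-- Every vertex of an induced 5-cycle has two neighbours on it. -/
lemma IsInducedC5.exists_two_adj {a b c d e z : V} (h : IsInducedC5 G a b c d e)
    (hz : z ∈ ({a, b, c, d, e} : Finset V)) : ∃ p ∈ ({a, b, c, d, e} : Finset V),
      ∃ q ∈ ({a, b, c, d, e} : Finset V), p ≠ q ∧ G.Adj z p ∧ G.Adj z q := by
  obtain ⟨p, q, r, s, h', he⟩ := h.exists_rotate hz
  rw [he]
  exact ⟨p, by simp, s, by simp, h'.distinct.2.2.2.2.2.2.1, h'.ab, h'.ea.symm⟩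

lemma Config.solvable_edges (c : Config G 2 S K H U x v y)
    (ih : ∀ A : Finset V, A.card < S.card → Conn G A → ¬ Bad G 2 A → Solvable G 2 A)
    (hbad : ¬ Bad G 2 S) {w u : V} (hK : K = {v, w}) (hH : H = {y, u}) (hvw : G.Adj v w)
    (hyu : G.Adj y u) (hwu : G.Adj w u) (hxw : ¬ G.Adj x w) (hxu : ¬ G.Adj x u) :
    Solvable G 2 S := by
  have hKc : K.card = 2 := by rw [hK, Finset.card_pair hvw.ne]
  have hHc : H.card = 2 := by rw [hH, Finset.card_pair hyu.ne]
  have hSc := c.card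
  by_cases hvy : G.Adj v y
  · refine c.solvable_two_of_dominated (z := v) (u := u) c.xv.symm ?_ (by omega)
    intro a ha hau
    simp only [hK, hH, Finset.mem_union, Finset.mem_insert, Finset.mem_singleton] at ha
    rcases ha with (rfl | rfl) | rfl | rfl
    · exact Or.inl (by simp)
    · exact Or.inr ⟨v, by simp, hvw⟩
    · exact Or.inr ⟨v, by simp, hvy⟩
    · exact absurd rfl hau
  by_cases hvu : G.Adj v u
  · refine c.solvable_two_of_dominated (z := v) (u := y) c.xv.symm ?_ (by omega)
    intro a ha hau
    simp only [hK, hH, Finset.mem_union, Finset.mem_insert, Finset.mem_singleton] at ha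
    rcases ha with (rfl | rfl) | rfl | rfl
    · exact Or.inl (by simp)
    · exact Or.inr ⟨v, by simp, hvw⟩
    · exact absurd rfl hau
    · exact Or.inr ⟨v, by simp, hvu⟩
  by_cases hwy : G.Adj w y
  · refine c.symm.solvable_two_of_dominated (z := y) (u := v) c.xy.symm ?_ (by omega)
    intro a ha hau
    simp only [hK, hH, Finset.mem_union, Finset.mem_insert, Finset.mem_singleton] at ha
    rcases ha with (rfl | rfl) | rfl | rfl
    · exact Or.inl (by simp)
    · exact Or.inr ⟨y, by simp, hyu⟩
    · exact absurd rfl hau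
    · exact Or.inr ⟨y, by simp, hwy.symm⟩
  have hUne : U.Nonempty := by
    rw [Finset.nonempty_iff_ne_empty]
    rintro rfl
    refine hbad (Or.inr ⟨rfl, x, v, w, u, y, ⟨c.xv, hvw, hwu, hyu.symm, c.xy.symm, hxw, hxu,
      hvu, hvy, hwy⟩, ?_⟩)
    rw [c.eq, hK, hH]
    ext; simp; tauto
  have hyU : y ∉ insert x U := by
    rw [Finset.mem_insert, not_or]
    exact ⟨c.xy.ne', Finset.disjoint_left.1 c.HU c.yH⟩
  have hA : Conn G (insert x U ∪ {y}) :=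
    c.connU.union (conn_clique (by simp) (by simp)) (by simp) (by simp) (Or.inl c.xy)
  have hAc : (insert x U ∪ {y}).card = U.card + 2 := by
    rw [Finset.card_union_of_disjoint (by simpa using hyU), Finset.card_insert_of_notMem c.xU]
    simp
  have hUc := hUne.card_pos
  refine solvable_of_dominated ih {w} (by simp) hA ?_ (by rw [Finset.card_singleton]; omega) ?_
  · rintro (h | ⟨-, p, q, r, s, t, h, he⟩)
    · have := h.card_eq
      omega
    · obtain ⟨i, hi, j, hj, hij, hyi, hyj⟩ := h.exists_two_adj (z := y) (by rw [← he]; simp)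
      rw [← he] at hi hj
      have key : ∀ i ∈ insert x U ∪ {y}, G.Adj y i → i = x := by
        intro i hi hyi
        simp only [Finset.mem_union, Finset.mem_insert, Finset.mem_singleton] at hi
        rcases hi with (rfl | hi) | rfl
        · rfl
        · exact absurd hyi (c.nHU y c.yH i hi)
        · exact absurd hyi G.irrefl
      exact hij ((key i hi hyi).trans (key j hj hyj).symm)
  · intro a ha haA
    rw [c.eq] at ha
    have : a = v ∨ a = w ∨ a = u := by grind
    rcases this with rfl | rfl | rfl
    · exact Or.inr ⟨w, by simp, hvw.symm⟩
    · exact Or.inl (by simp)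
    · exact Or.inr ⟨w, by simp, hwu⟩

lemma exists_pair_of_card_two {a : V} (hA : A.card = 2) (ha : a ∈ A) : ∃ b, A = {a, b} := by
  obtain ⟨p, q, -, rfl⟩ := Finset.card_eq_two.1 hA
  simp only [Finset.mem_insert, Finset.mem_singleton] at ha
  rcases ha with rfl | rfl
  · exact ⟨q, rfl⟩
  · exact ⟨p, Finset.pair_comm _ _⟩

lemma Config.solvable_cliques (c : Config G k S K H U x v y) (hk : 1 ≤ k)
    (ih : ∀ A : Finset V, A.card < S.card → Conn G A → ¬ Bad G k A → Solvable G k A)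
    (hbad : ¬ Bad G k S) (hK : G.IsNClique k K) (hH : G.IsNClique k H) : Solvable G k S := by
  obtain ⟨D, hD, hi⟩ := c.solU
  by_cases hsol : Isolates G k S (D ∪ {x})
  · refine ⟨_, ?_, hsol⟩
    have h1 := Finset.card_union_le D {x}
    have h2 := c.card
    rw [hK.card_eq, hH.card_eq] at h2
    simp only [Finset.card_singleton] at h1
    nlinarith
  unfold Isolates at hsol
  push Not at hsol
  obtain ⟨C, hC, hCk, hCD⟩ := hsol
  have hxC : x ∉ C := fun h => hCD x h (Or.inl (by simp))
  have hxa : ∀ a ∈ C, ¬ G.Adj x a := fun a ha h => hCD a ha (Or.inr ⟨x, by simp, h⟩)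
  have hsub := c.clique_subset hi hC hCk
    (fun a ha h => hCD a ha (h.mono Finset.subset_union_left)) hxC
  have hnot : ∀ {L : Finset V} {l : V}, G.IsNClique k L → l ∈ L → G.Adj x l → ¬ C ⊆ L := by
    intro L l hL hl hxl hCL
    have := Finset.eq_of_subset_of_card_le hCL (by rw [hL.card_eq, hCk.card_eq])
    exact hxa l (this ▸ hl) hxl
  obtain ⟨u, huC, huK⟩ := Finset.not_subset.1 (hnot hK c.vK c.xv)
  obtain ⟨w, hwC, hwH⟩ := Finset.not_subset.1 (hnot hH c.yH c.xy)
  have huH := (Finset.mem_union.1 (hsub huC)).resolve_left huK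
  have hwK := (Finset.mem_union.1 (hsub hwC)).resolve_right hwH
  have hwu : w ≠ u := by rintro rfl; exact hwH huH
  have hadj := hCk.isClique hwC huC hwu
  have hvw : v ≠ w := by rintro rfl; exact hxa _ hwC c.xv
  have hyu : y ≠ u := by rintro rfl; exact hxa _ huC c.xy
  by_cases hC3 : C ⊆ {w, u}
  · have hk2 : k = 2 := by
      rw [← hCk.card_eq, Finset.eq_of_subset_of_card_le hC3, Finset.card_pair hwu]
      exact Finset.card_le_card (by grind)
    subst hk2
    obtain ⟨w', hw'⟩ := exists_pair_of_card_two hK.card_eq c.vK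
    obtain ⟨u', hu'⟩ := exists_pair_of_card_two hH.card_eq c.yH
    have e1 : w = w' := by grind
    have e2 : u = u' := by grind
    subst e1 e2
    exact c.solvable_edges ih hbad hw' hu' (hK.isClique c.vK hwK hvw) (hH.isClique c.yH huH hyu)
      hadj (hxa _ hwC) (hxa _ huC)
  · obtain ⟨s, hsC, hs⟩ := Finset.not_subset.1 hC3
    simp only [Finset.mem_insert, Finset.mem_singleton, not_or] at hs
    rcases Finset.mem_union.1 (hsub hsC) with h | h
    · exact c.solvable_of_two hk ih hK hH huH hwK h (Ne.symm hs.1) hadj.symm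
        (hCk.isClique huC hsC (Ne.symm hs.2)) (hxa _ hwC) (hxa _ hsC)
    · exact c.symm.solvable_of_two hk ih hH hK hwK huH h (Ne.symm hs.2) hadj
        (hCk.isClique hwC hsC (Ne.symm hs.1)) (hxa _ huC) (hxa _ hsC)

lemma Bad.card_ge (hA : Bad G 2 A) : 2 ≤ A.card := by
  rcases hA with h | ⟨-, a, b, c, d, e, h, rfl⟩
  · exact h.card_eq.ge
  · rw [h.card]
    norm_num

/-- In an induced 5-cycle on a path `x, v, w` and an edge `a b`, exactly one of `a`, `b` is
adjacent to `x`, and the other one is adjacent to `w`. -/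
lemma IsInducedC5.path_edge {p q r s t x v w a b : V} (h : IsInducedC5 G p q r s t)
    (he : ({p, q, r, s, t} : Finset V) = {x, v, w, a, b}) (hxv : G.Adj x v) (hvw : G.Adj v w)
    (hab : G.Adj a b) (hd : [x, v, w, a, b].Nodup) :
    (G.Adj x a ∧ ¬ G.Adj x b ∧ G.Adj w b) ∨ (G.Adj x b ∧ ¬ G.Adj x a ∧ G.Adj w a) := by
  obtain ⟨q, r, s, t, h', he'⟩ := h.exists_rotate (y := v) (by rw [he]; simp)
  rw [he] at he'
  obtain ⟨d2, d3, d4, d5, d6, d7, d8⟩ :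
      x ≠ w ∧ x ≠ a ∧ x ≠ b ∧ v ≠ a ∧ v ≠ b ∧ w ≠ a ∧ w ≠ b := by
    simp only [List.nodup_cons, List.mem_cons, List.not_mem_nil, or_false, not_or] at hd
    tauto
  have mx : x = v ∨ x = q ∨ x = r ∨ x = s ∨ x = t := by
    have : x ∈ ({x, v, w, a, b} : Finset V) := by simp
    rw [he'] at this
    simpa using this
  have mw : w = v ∨ w = q ∨ w = r ∨ w = s ∨ w = t := by
    have : w ∈ ({x, v, w, a, b} : Finset V) := by simp
    rw [he'] at this
    simpa using this
  have ma : a = v ∨ a = q ∨ a = r ∨ a = s ∨ a = t := by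
    have : a ∈ ({x, v, w, a, b} : Finset V) := by simp
    rw [he'] at this
    simpa using this
  have mb : b = v ∨ b = q ∨ b = r ∨ b = s ∨ b = t := by
    have : b ∈ ({x, v, w, a, b} : Finset V) := by simp
    rw [he'] at this
    simpa using this
  have hxqt : x = q ∨ x = t := by
    rcases mx with rfl | rfl | rfl | rfl | rfl
    · exact absurd hxv G.irrefl
    · exact Or.inl rfl
    · exact absurd hxv.symm h'.nac
    · exact absurd hxv.symm h'.nad
    · exact Or.inr rfl
  have hwqt : w = q ∨ w = t := by
    rcases mw with rfl | rfl | rfl | rfl | rfl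
    · exact absurd hvw G.irrefl
    · exact Or.inl rfl
    · exact absurd hvw h'.nac
    · exact absurd hvw h'.nad
    · exact Or.inr rfl
  have hars : (a = r ∧ b = s) ∨ (a = s ∧ b = r) := by
    have := hab.ne
    grind
  have hrt : ¬ G.Adj t r := fun h => h'.nce h.symm
  rcases hxqt with rfl | rfl <;> rcases hwqt with rfl | rfl <;>
    rcases hars with ⟨rfl, rfl⟩ | ⟨rfl, rfl⟩
  all_goals first
    | exact absurd rfl d2
    | exact Or.inl ⟨h'.bc, h'.nbd, h'.de.symm⟩
    | exact Or.inr ⟨h'.bc, h'.nbd, h'.de.symm⟩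
    | exact Or.inl ⟨h'.de.symm, hrt, h'.bc⟩
    | exact Or.inr ⟨h'.de.symm, hrt, h'.bc⟩

lemma Config.cycle_step (c : Config G 2 S K H U x v y)
    (ih : ∀ A : Finset V, A.card < S.card → Conn G A → ¬ Bad G 2 A → Solvable G 2 A)
    (hns : ¬ Solvable G 2 S) {a b p q r : V} (h : IsInducedC5 G a b p q r)
    (hH : H = {a, b, p, q, r}) (hl : ∃ t ∈ insert x K, G.Adj a t) :
    (∃ t ∈ insert x K, G.Adj b t) ∧ (G.Adj x a ↔ ¬ G.Adj x b) := by
  obtain ⟨t, ht, hat⟩ := hl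
  set A := insert x U ∪ K ∪ {a, b} with hA
  have hSc := c.card
  have hHc : H.card = 5 := by rw [hH, h.card]
  have hAc : A.card = U.card + 1 + K.card + 2 := by
    rw [hA, Finset.card_union_of_disjoint, Finset.card_union_of_disjoint,
      Finset.card_insert_of_notMem c.xU, Finset.card_pair h.ab.ne]
    · rw [Finset.disjoint_insert_left]
      exact ⟨c.xK, c.KU.symm⟩
    · refine Finset.disjoint_of_subset_right (show {a, b} ⊆ H by rw [hH]; grind) ?_
      rw [Finset.disjoint_union_left, Finset.disjoint_insert_left]
      exact ⟨⟨c.xH, c.HU.symm⟩, c.KH⟩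
  have hKc := c.badK.card_ge
  have hconn : Conn G A :=
    (c.connU.union (c.badK.conn (by norm_num)) (by simp) c.vK (Or.inl c.xv)).union
      (a := t) (b := a)
      (conn_clique (by simp [h.ab]) (by simp))
      (by grind) (by simp) (Or.inl hat.symm)
  have hbad : Bad G 2 A := by
    by_contra hbad
    refine hns (solvable_of_dominated ih {q} (by simp) hconn hbad
      (by rw [Finset.card_singleton]; omega) fun d hd hdA => ?_)
    rw [c.eq, hH] at hd
    have : d = p ∨ d = q ∨ d = r := by grind
    rcases this with rfl | rfl | rfl
    · exact Or.inr ⟨q, by simp, h.cd.symm⟩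
    · exact Or.inl (by simp)
    · exact Or.inr ⟨q, by simp, h.de⟩
  rcases hbad with hb | ⟨-, p1, p2, p3, p4, p5, h5, he⟩
  · have := hb.card_eq
    omega
  have h5c := h5.card
  rw [← he] at h5c
  have hU : U = ∅ := Finset.card_eq_zero.1 (by omega)
  have hK2 : K.card = 2 := by omega
  obtain ⟨w, hw⟩ := exists_pair_of_card_two hK2 c.vK
  have hvw : G.Adj v w := by
    rcases c.badK with hk | ⟨-, q1, q2, q3, q4, q5, hq, hqe⟩
    · refine hk.isClique c.vK (by simp [hw]) ?_
      rintro rfl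
      simp [hw] at hK2
    · have := hq.card
      rw [← hqe] at this
      omega
  have hset : ({p1, p2, p3, p4, p5} : Finset V) = {x, v, w, a, b} := by
    rw [← he, hA, hU, hw]
    ext; simp; tauto
  have hnodup : [x, v, w, a, b].Nodup := by
    have hx : x ∉ K := c.xK
    have hx' : x ∉ H := c.xH
    have hd := Finset.disjoint_left.1 c.KH
    have h1 := h.ab.ne
    have h2 := hvw.ne
    grind
  rcases h5.path_edge hset c.xv hvw h.ab hnodup with ⟨h1, h2, h3⟩ | ⟨h1, h2, h3⟩
  · exact ⟨⟨w, by simp [hw], h3.symm⟩, by tauto⟩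
  · exact ⟨⟨x, by simp, h1.symm⟩, by tauto⟩

lemma Config.solvable_cycle (c : Config G 2 S K H U x v y)
    (ih : ∀ A : Finset V, A.card < S.card → Conn G A → ¬ Bad G 2 A → Solvable G 2 A)
    {a b p q r : V} (h : IsInducedC5 G a b p q r) (hH : H = {a, b, p, q, r}) :
    Solvable G 2 S := by
  by_contra hns
  obtain ⟨y1, y2, y3, y4, h0, he⟩ := h.exists_rotate (y := y) (hH ▸ c.yH)
  rw [← hH] at he
  have r1 := c.cycle_step ih hns h0 he ⟨x, by simp, c.xy.symm⟩
  have r2 := c.cycle_step ih hns h0.rotate (by rw [he]; ext; simp; tauto) r1.1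
  have r3 := c.cycle_step ih hns h0.rotate.rotate (by rw [he]; ext; simp; tauto) r2.1
  have r4 := c.cycle_step ih hns h0.rotate.rotate.rotate (by rw [he]; ext; simp; tauto) r3.1
  have r5 := c.cycle_step ih hns h0.rotate.rotate.rotate.rotate
    (by rw [he]; ext; simp; tauto) r4.1
  tauto

lemma Config.solvable (c : Config G k S K H U x v y) (hk : 1 ≤ k)
    (ih : ∀ A : Finset V, A.card < S.card → Conn G A → ¬ Bad G k A → Solvable G k A)
    (hbad : ¬ Bad G k S) : Solvable G k S := by
  rcases c.badH with hH | ⟨rfl, a, b, p, q, r, h, hH⟩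
  · rcases c.badK with hK | ⟨rfl, a, b, p, q, r, h, hK⟩
    · exact c.solvable_cliques hk ih hbad hK hH
    · exact c.symm.solvable_cycle ih h hK
  · exact c.solvable_cycle ih h hH

/-- A proper nonempty subset of a connected set has a neighbour outside. -/
lemma Conn.exists_adj (hS : Conn G S) (hB : B ⊆ S) (hne : B.Nonempty) (hBS : B ≠ S) :
    ∃ a ∈ B, ∃ b ∈ S, b ∉ B ∧ G.Adj a b := by
  by_contra! hcon
  refine hBS (hS.2 B hB hne fun a ha b hb hab => ?_)
  by_contra hbB
  exact hcon a ha b hb hbB hab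

open Classical in
theorem solvable_of_conn (hk : 1 ≤ k) (S : Finset V) (hS : Conn G S) (hbad : ¬ Bad G k S) :
    Solvable G k S := by
  induction hn : S.card using Nat.strong_induction_on generalizing S with
  | _ n ih' =>
  have ih : ∀ A : Finset V, A.card < S.card → Conn G A → ¬ Bad G k A → Solvable G k A :=
    fun A hA hAc hAb => ih' _ (hn ▸ hA) A hAc hAb rfl
  clear ih' hn
  by_contra hns
  have hpoint : ∀ x ∈ S, ∀ B, IsComp G (S.erase x) B → ¬ Bad G k B := fun x hx B hB hb =>
    hns (solvable_of_bad_comp hk hS ih hx hB hb)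
  have hrest : ∀ T ⊆ S, T ≠ S → (∀ B, IsComp G T B → ¬ Bad G k B) → Solvable G k T :=
    fun T hT hTS h => solvable_of_comp hk fun B hB =>
      ih B (Finset.card_lt_card (hB.subset.trans_ssubset (hT.ssubset_of_ne hTS)))
        hB.conn (h B hB)
  have hex : ∃ C ⊆ S, G.IsNClique k C := by
    by_contra! hcon
    exact hns ⟨∅, by simp, fun C hC hCk => absurd hCk (hcon C hC)⟩
  obtain ⟨C, hC, hCk⟩ := hex
  obtain ⟨v, hvC, u, huS, huC, hvu⟩ := hS.exists_adj hC (clique_nonempty hk hCk)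
    (fun h => hbad (Or.inl (h ▸ hCk)))
  have hvS := hC hvC
  set R := S.filter (fun a => a = v ∨ G.Adj v a) with hR
  have hRS : R ⊆ S := Finset.filter_subset _ _
  have hvR : v ∈ R := by simp [hR, hvS]
  have hRcard : k + 1 ≤ R.card := by
    rw [← hCk.card_eq, ← Finset.card_insert_of_notMem huC]
    refine Finset.card_le_card fun a ha => ?_
    rw [hR, Finset.mem_filter]
    rcases Finset.mem_insert.1 ha with rfl | ha
    · exact ⟨huS, Or.inr hvu⟩
    · refine ⟨hC ha, ?_⟩
      by_cases hav : a = v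
      · exact Or.inl hav
      · exact Or.inr (hCk.isClique hvC ha (Ne.symm hav))
  have hexH : ∃ H, IsComp G (S \ R) H ∧ Bad G k H := by
    by_contra! hcon
    have h1 := hrest (S \ R) Finset.sdiff_subset (fun h => by
      rw [← h] at hvS
      exact (Finset.mem_sdiff.1 hvS).2 hvR) hcon
    refine hns (h1.extend {v} ?_ fun a ha haR => ?_)
    · rw [Finset.card_singleton]
      have := Finset.card_sdiff_add_card_eq_card hRS
      omega
    · have : a ∈ R := by simpa [ha] using haR
      rcases (Finset.mem_filter.1 this).2 with rfl | h
      · exact Or.inl (by simp)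
      · exact Or.inr ⟨v, by simp, h⟩
  obtain ⟨H, hH, hHb⟩ := hexH
  have hHS : H ⊆ S := hH.subset.trans Finset.sdiff_subset
  have hHR : ∀ a ∈ H, a ∉ R := fun a ha => (Finset.mem_sdiff.1 (hH.subset ha)).2
  have hvH : v ∉ H := fun h => hHR v h hvR
  have hHnbr : ∀ a ∈ H, ∀ b ∈ S, b ∉ H → G.Adj a b → G.Adj v b := by
    intro a ha b hb hbH hab
    have hbR : b ∈ R := by
      by_contra hbR
      exact hbH (hH.closed a ha b (Finset.mem_sdiff.2 ⟨hb, hbR⟩) hab)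
    rcases (Finset.mem_filter.1 hbR).2 with rfl | h
    · exact absurd (Finset.mem_filter.2 ⟨hHS ha, Or.inr hab.symm⟩) (hHR a ha)
    · exact h
  obtain ⟨y, hy, x, hx, hxH, hyx⟩ := hS.exists_adj hHS hH.conn.1 (fun h => hvH (h ▸ hvS))
  have hvx := hHnbr y hy x hx hxH hyx
  set T := (S.erase x) \ H with hT
  have hTS : T ⊆ S := Finset.sdiff_subset.trans (Finset.erase_subset _ _)
  have hxT : x ∉ T := by simp [hT]
  have hvT : v ∈ T := by simp [hT, hvx.ne, hvS, hvH]
  have hTcard : T.card + H.card + 1 = S.card := by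
    have hsub : H ⊆ S.erase x := fun a ha =>
      Finset.mem_erase.2 ⟨fun h => hxH (h ▸ ha), hHS ha⟩
    have h1 := Finset.card_sdiff_add_card_eq_card hsub
    have h2 := Finset.card_erase_add_one hx
    have h3 : T.card + H.card = (S.erase x).card := h1
    omega
  have hexK : ∃ K, IsComp G T K ∧ Bad G k K := by
    by_contra! hcon
    have h1 := hrest T hTS (fun h => hxT (h ▸ hx)) hcon
    obtain ⟨D, hyD, hD, hdom⟩ := hHb.exists_dominating hy
    refine hns (h1.extend D (by omega) fun a ha haT => ?_)
    by_cases haH : a ∈ H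
    · exact hdom a haH
    · have : a = x := by
        by_contra hax
        exact haT (by simp [hT, hax, ha, haH])
      exact this ▸ Or.inr ⟨y, hyD, hyx⟩
  obtain ⟨K, hK, hKb⟩ := hexK
  have hxK : x ∉ K := fun h => hxT (hK.subset h)
  have hKH : Disjoint K H := Finset.disjoint_left.2 fun a ha =>
    (Finset.mem_sdiff.1 (hK.subset ha)).2
  have hvK : v ∈ K := by
    have hnc : ¬ ClosedIn G (S.erase x) K := fun h =>
      hpoint x hx K ⟨hK.subset.trans Finset.sdiff_subset, hK.conn, h⟩ hKb
    unfold ClosedIn at hnc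
    push Not at hnc
    obtain ⟨q, hq, p, hp, hqp, hpK⟩ := hnc
    have hpH : p ∈ H := by
      by_contra hpH
      exact hpK (hK.closed q hq p (Finset.mem_sdiff.2 ⟨hp, hpH⟩) hqp)
    have hvq := hHnbr p hpH q (hTS (hK.subset hq)) (Finset.disjoint_left.1 hKH hq) hqp.symm
    exact hK.closed q hq v hvT hvq.symm
  set U := T \ K with hU
  have hxU : x ∉ U := fun h => hxT (Finset.sdiff_subset h)
  have hKU : Disjoint K U := Finset.disjoint_sdiff
  have hHU : Disjoint H U := Finset.disjoint_left.2 fun a ha haU =>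
    (Finset.mem_sdiff.1 (Finset.sdiff_subset haU : a ∈ T)).2 ha
  have hnKU : ∀ a ∈ K, ∀ b ∈ U, ¬ G.Adj a b := fun a ha b hb hab =>
    (Finset.mem_sdiff.1 hb).2 (hK.closed a ha b (Finset.sdiff_subset hb) hab)
  have hnHU : ∀ a ∈ H, ∀ b ∈ U, ¬ G.Adj a b := fun a ha b hb hab => by
    have hvb := hHnbr a ha b (hTS (Finset.sdiff_subset hb))
      (Finset.disjoint_right.1 hHU hb) hab
    exact hnKU v hvK b hb hvb
  have hSeq : S = insert x (K ∪ H ∪ U) := by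
    ext a
    have h1 : a ∈ K → a ∈ T := fun h => hK.subset h
    have h2 : a ∈ H → a ∈ S := fun h => hHS h
    have h3 : a = x → a ∈ S := fun h => h ▸ hx
    simp only [hU, hT, Finset.mem_insert, Finset.mem_union, Finset.mem_sdiff,
      Finset.mem_erase] at h1 ⊢
    tauto
  have hUclosed : ClosedIn G (S.erase x) U := by
    intro a ha b hb hab
    rw [hSeq] at hb
    simp only [Finset.mem_erase, Finset.mem_insert, Finset.mem_union] at hb
    rcases hb with ⟨hbx, h | (h | h) | h⟩
    · exact absurd h hbx
    · exact absurd hab.symm (hnKU b h a ha)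
    · exact absurd hab.symm (hnHU b h a ha)
    · exact h
  have hconn : Conn G (insert x U) := by
    refine ⟨by simp, fun W hW hWn hWc => ?_⟩
    have hWS : W ⊆ S := hW.trans (by rw [hSeq]; grind)
    by_cases hxW : x ∈ W
    · have h1 := hS.2 (W ∪ (K ∪ H)) (by rw [hSeq]; grind) (hWn.mono Finset.subset_union_left) ?_
      · refine hW.antisymm fun a ha => ?_
        rcases Finset.mem_insert.1 ha with rfl | haU
        · exact hxW
        · have : a ∈ W ∪ (K ∪ H) := by rw [h1, hSeq]; simp [haU]
          have h2 := Finset.disjoint_right.1 hKU haU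
          have h3 := Finset.disjoint_right.1 hHU haU
          simpa [h2, h3] using this
      · intro a ha b hb hab
        rw [hSeq] at hb
        simp only [Finset.mem_insert, Finset.mem_union] at ha hb ⊢
        rcases hb with rfl | (h | h) | h
        · exact Or.inl hxW
        · exact Or.inr (Or.inl h)
        · exact Or.inr (Or.inr h)
        · rcases ha with ha | ha | ha
          · exact Or.inl (hWc a ha b (by simp [h]) hab)
          · exact absurd hab (hnKU a ha b h)
          · exact absurd hab (hnHU a ha b h)
    · have hWU : W ⊆ U := fun a ha =>
        (Finset.mem_insert.1 (hW ha)).resolve_left fun h => hxW (h ▸ ha)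
      have h1 := hS.2 W hWS hWn fun a ha b hb hab => by
        by_cases hbx : b = x
        · exact hWc a ha b (by simp [hbx]) hab
        · exact hWc a ha b (by
            simp [hUclosed a (hWU ha) b (Finset.mem_erase.2 ⟨hbx, hb⟩) hab]) hab
      exact absurd (h1 ▸ hx) hxW
  have hsolU : Solvable G k U := by
    refine hrest U (Finset.sdiff_subset.trans hTS)
      (fun h => hxU (h ▸ hx)) fun B hB => hpoint x hx B ⟨?_, hB.conn, ?_⟩
    · exact hB.subset.trans (Finset.sdiff_subset.trans Finset.sdiff_subset)
    · exact fun a ha b hb hab => hB.closed a ha b (hUclosed a (hB.subset ha) b hb hab) hab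
  have c : Config G k S K H U x v y := ⟨hSeq, hxK, hxH, hxU, hKH, hKU, hHU, hvK, hy, hvx.symm,
    hyx.symm, hnKU, hnHU, hKb, hHb, hconn, hsolU⟩
  exact hns (c.solvable hk ih hbad)

lemma nonempty_iso_cycleGraph [Fintype V] {a b c d e : V} (h : IsInducedC5 G a b c d e)
    (hu : (Finset.univ : Finset V) = {a, b, c, d, e}) :
    Nonempty (G ≃g SimpleGraph.cycleGraph 5) := by
  let f : Fin 5 → V := ![a, b, c, d, e]
  have hadj : ∀ i j, G.Adj (f i) (f j) ↔ (SimpleGraph.cycleGraph 5).Adj i j := by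
    obtain ⟨h1, h2, h3, h4, h5, h6, h7, h8, h9, h10⟩ := h
    intro i j
    have h1' := h1.symm
    have h2' := h2.symm
    have h3' := h3.symm
    have h4' := h4.symm
    have h5' := h5.symm
    have h6' : ¬ G.Adj c a := fun h => h6 h.symm
    have h7' : ¬ G.Adj d a := fun h => h7 h.symm
    have h8' : ¬ G.Adj d b := fun h => h8 h.symm
    have h9' : ¬ G.Adj e b := fun h => h9 h.symm
    have h10' : ¬ G.Adj e c := fun h => h10 h.symm
    fin_cases i <;> fin_cases j <;>
      simp only [f, SimpleGraph.cycleGraph_adj, Fin.zero_eta, Fin.mk_one, Fin.reduceFinMk,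
        Matrix.cons_val, SimpleGraph.irrefl, *] <;> decide
  have hsurj : Function.Surjective f := by
    intro z
    have : z ∈ (Finset.univ : Finset V) := Finset.mem_univ z
    rw [hu] at this
    simp only [Finset.mem_insert, Finset.mem_singleton] at this
    rcases this with rfl | rfl | rfl | rfl | rfl
    exacts [⟨0, rfl⟩, ⟨1, rfl⟩, ⟨2, rfl⟩, ⟨3, rfl⟩, ⟨4, rfl⟩]
  have hbij : Function.Bijective f := by
    rw [Fintype.bijective_iff_surjective_and_card]
    refine ⟨hsurj, ?_⟩
    rw [Fintype.card_fin, ← Finset.card_univ, hu, h.card]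
  exact ⟨(⟨Equiv.ofBijective f hbij, hadj _ _⟩ : SimpleGraph.cycleGraph 5 ≃g G).symm⟩

lemma isGraphIsolating_of_isolates [Fintype V] (h : Isolates G k Finset.univ D) :
    IsGraphIsolating (⊤ : SimpleGraph (Fin k)) G (D : Set V) := by
  rintro ⟨f, hf⟩
  have hinj : Function.Injective fun i => (f i : V) := Subtype.val_injective.comp hf
  obtain ⟨c, hc, hd⟩ := h (Finset.univ.image fun i => (f i : V)) (Finset.subset_univ _) (by
    refine ⟨?_, by rw [Finset.card_image_of_injective _ hinj]; simp⟩
    intro p hp q hq hpq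
    simp only [Finset.coe_image, Finset.coe_univ, Set.image_univ, Set.mem_range] at hp hq
    obtain ⟨i, rfl⟩ := hp
    obtain ⟨j, rfl⟩ := hq
    exact f.map_adj (show (⊤ : SimpleGraph (Fin k)).Adj i j from fun hij => hpq (by rw [hij])))
  simp only [Finset.mem_image, Finset.mem_univ, true_and] at hc
  obtain ⟨i, rfl⟩ := hc
  exact (f i).2 hd

end CliqueIsolation

/-- For any `k ≥ 1`, if `G` is a connected `n`-vertex graph, `G` is not a
copy of the complete graph `K_k`, and it is not the case that `k = 2` and `G` is a 5-cycle,
then `ι(G, K_k) ≤ n/(k+1)`. -/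
theorem isolation_completeGraph_le_card {V : Type*} [Fintype V] (k : ℕ) (hk : 1 ≤ k)
    (G : SimpleGraph V) (n : ℕ) (hn : Fintype.card V = n) (hconn : G.Connected)
    (hKk : ¬ Nonempty (G ≃g (⊤ : SimpleGraph (Fin k))))
    (hC5 : ¬ (k = 2 ∧ Nonempty (G ≃g cycleGraph 5))) :
    (iotaGraph (⊤ : SimpleGraph (Fin k)) G : ℝ) ≤ n / (k + 1) := by
  classical
  obtain ⟨D, hD, hi⟩ := CliqueIsolation.solvable_of_conn hk Finset.univ
    (CliqueIsolation.conn_univ hconn) (by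
      rintro (h | ⟨h2, a, b, c, d, e, h, hu⟩)
      · exact hKk (CliqueIsolation.nonempty_iso_top h)
      · exact hC5 ⟨h2, CliqueIsolation.nonempty_iso_cycleGraph h hu⟩)
  have hle : iotaGraph (⊤ : SimpleGraph (Fin k)) G ≤ D.card :=
    Nat.sInf_le ⟨D, Set.ncard_coe_finset D, CliqueIsolation.isGraphIsolating_of_isolates hi⟩
  rw [Finset.card_univ, hn] at hD
  rw [le_div_iff₀ (by positivity), mul_comm]
  exact_mod_cast (Nat.mul_le_mul_left (k + 1) hle).trans hD
end

section
/- For any integer k ≥ 1, if G is a connected graph with exactly m edges and G is not isomorphic to the complete graph K_k, then the K_k-isolation number of G satisfies ι(G, K_k) ≤ (m+1)/(binom(k,2)+2). -/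
open SimpleGraph

namespace IsolationClique

open Finset

open scoped Classical in
/-- The number of ordered pairs of adjacent vertices `(u, v)` with `u ∈ A` and `v ∈ B`. -/
noncomputable def adjCount {V : Type*} (G : SimpleGraph V) (A B : Finset V) : ℕ :=
  ∑ u ∈ A, ∑ v ∈ B, if G.Adj u v then 1 else 0

/-- `C` is a union of connected components of the subgraph of `G` induced by `U`. -/
def IsClosedIn {V : Type*} (G : SimpleGraph V) (U C : Finset V) : Prop :=
  C ⊆ U ∧ ∀ a ∈ C, ∀ b ∈ U, b ∉ C → ¬ G.Adj a b

/-- Connectedness of the subgraph of `G` induced by `S`, in terms of cuts. -/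
def CutConnected {V : Type*} (G : SimpleGraph V) (S : Finset V) : Prop :=
  ∀ A, IsClosedIn G S A → A.Nonempty → A = S

/-- The closed neighbourhood of `D` meets `K`. -/
def Dominates {V : Type*} (G : SimpleGraph V) (D K : Finset V) : Prop :=
  ∃ d ∈ D, ∃ x ∈ K, d = x ∨ G.Adj d x

variable {V : Type*} {G : SimpleGraph V}

lemma Dominates.mono {D D' K : Finset V} (h : Dominates G D K) (hD : D ⊆ D') :
    Dominates G D' K := by
  obtain ⟨d, hd, x, hx, h⟩ := h
  exact ⟨d, hD hd, x, hx, h⟩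

lemma adjCount_comm (A B : Finset V) : adjCount G A B = adjCount G B A := by
  unfold adjCount
  rw [sum_comm]
  exact sum_congr rfl fun u _ => sum_congr rfl fun v _ => by rw [G.adj_comm]

lemma adjCount_mono {A A' B B' : Finset V} (hA : A ⊆ A') (hB : B ⊆ B') :
    adjCount G A B ≤ adjCount G A' B' := by
  unfold adjCount
  exact (sum_le_sum fun u _ => sum_le_sum_of_subset hB).trans (sum_le_sum_of_subset hA)

lemma one_le_adjCount {A B : Finset V} {a b : V} (ha : a ∈ A) (hb : b ∈ B) (h : G.Adj a b) :
    1 ≤ adjCount G A B := by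
  have := adjCount_mono (G := G) (singleton_subset_iff.2 ha) (singleton_subset_iff.2 hb)
  simpa [adjCount, h, filter_singleton] using this

lemma two_le_adjCount {A B : Finset V} {a b c d : V} (ha : a ∈ A) (hb : b ∈ B) (h : G.Adj a b)
    (hc : c ∈ A) (hd : d ∈ B) (h' : G.Adj c d) (hne : ¬ (c = a ∧ d = b)) :
    2 ≤ adjCount G A B := by
  classical
  have hcard : adjCount G A B = #{p ∈ A ×ˢ B | G.Adj p.1 p.2} := by
    rw [card_filter, sum_product]; rfl
  rw [hcard]
  apply one_lt_card.2
  exact ⟨(a, b), by simp [*], (c, d), by simp [*], fun he => hne (by simp_all)⟩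

variable [DecidableEq V]

lemma adjCount_union_left {A A' : Finset V} (B : Finset V) (h : Disjoint A A') :
    adjCount G (A ∪ A') B = adjCount G A B + adjCount G A' B :=
  sum_union h

lemma adjCount_union_right {B B' : Finset V} (A : Finset V) (h : Disjoint B B') :
    adjCount G A (B ∪ B') = adjCount G A B + adjCount G A B' := by
  rw [adjCount_comm, adjCount_union_left _ h, adjCount_comm B, adjCount_comm B']

lemma adjCount_union_self {A B : Finset V} (h : Disjoint A B) :
    adjCount G (A ∪ B) (A ∪ B) = adjCount G A A + 2 * adjCount G A B + adjCount G B B := by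
  rw [adjCount_union_left _ h, adjCount_union_right _ h, adjCount_union_right _ h,
    adjCount_comm B A]
  ring

lemma adjCount_of_isNClique {K : Finset V} {k : ℕ} (h : G.IsNClique k K) :
    adjCount G K K = k * (k - 1) := by
  classical
  unfold adjCount
  have : ∀ u ∈ K, (∑ v ∈ K, if G.Adj u v then 1 else 0) = k - 1 := by
    intro u hu
    rw [← card_filter, ← h.card_eq, ← card_erase_of_mem hu]
    congr 1
    ext v
    simp only [mem_filter, mem_erase]
    constructor
    · rintro ⟨hv, ha⟩
      exact ⟨ha.ne', hv⟩
    · rintro ⟨hne, hv⟩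
      exact ⟨hv, h.isClique hu hv (Ne.symm hne)⟩
  rw [← smul_eq_mul, ← h.card_eq, ← sum_const, h.card_eq]
  convert sum_congr rfl this

lemma IsClosedIn.sdiff {U C : Finset V} (h : IsClosedIn G U C) : IsClosedIn G U (U \ C) := by
  refine ⟨sdiff_subset, fun a ha b hb hbC hab => ?_⟩
  simp only [mem_sdiff, not_and, not_not] at ha hbC
  exact h.2 b (hbC hb) a ha.1 ha.2 hab.symm

omit [DecidableEq V] in
lemma IsClosedIn.trans {U C A : Finset V} (h : IsClosedIn G U C) (hA : IsClosedIn G C A) :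
    IsClosedIn G U A := by
  refine ⟨hA.1.trans h.1, fun a ha b hb hbA => ?_⟩
  by_cases hbC : b ∈ C
  · exact hA.2 a ha b hbC hbA
  · exact h.2 a (hA.1 ha) b hb hbC

/-- A clique lies on one side of a closed set. -/
lemma IsClosedIn.clique_subset {U C K : Finset V} {k : ℕ} (h : IsClosedIn G U C)
    (hK : G.IsNClique k K) (hKU : K ⊆ U) : K ⊆ C ∨ K ⊆ U \ C := by
  by_contra! hcon
  obtain ⟨b, hb, hbC⟩ := not_subset.1 hcon.1
  obtain ⟨a, ha, haC⟩ := not_subset.1 hcon.2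
  have haC : a ∈ C := by simpa [hKU ha] using haC
  exact h.2 a haC b (hKU hb) hbC (hK.isClique ha hb (by rintro rfl; exact hbC haC))

omit [DecidableEq V] in
/-- A nonempty vertex set contains a connected component. -/
lemma exists_component {U : Finset V} (hU : U.Nonempty) :
    ∃ C, IsClosedIn G U C ∧ C.Nonempty ∧ CutConnected G C := by
  induction U using Finset.strongInduction with
  | H U ih =>
    by_cases hc : CutConnected G U
    · exact ⟨U, ⟨Subset.rfl, fun a _ b hb hb' => absurd hb hb'⟩, hU, hc⟩
    · unfold CutConnected at hc
      push Not at hc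
      obtain ⟨A, hA, hne, hAU⟩ := hc
      obtain ⟨C, hC, hCne, hCc⟩ := ih A (hA.1.ssubset_of_ne hAU) hne
      exact ⟨C, hA.trans hC, hCne, hCc⟩

/-- Isolating sets of the components of `U` combine to an isolating set of `U`. -/
lemma exists_of_components {k q : ℕ} {R D₀ : Finset V} (U : Finset V)
    (H : ∀ C, IsClosedIn G U C → C.Nonempty → CutConnected G C →
      ∃ D : Finset V, q * #D ≤ adjCount G C C + 2 * adjCount G C R ∧
        ∀ K ⊆ C, G.IsNClique k K → Dominates G (D₀ ∪ D) K) (hk : 1 ≤ k) :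
    ∃ D : Finset V, q * #D ≤ adjCount G U U + 2 * adjCount G U R ∧
      ∀ K ⊆ U, G.IsNClique k K → Dominates G (D₀ ∪ D) K := by
  induction U using Finset.strongInduction with
  | H U ih =>
    obtain rfl | hU := U.eq_empty_or_nonempty
    · refine ⟨∅, by simp, fun K hK hKc => ?_⟩
      have := hKc.card_eq
      rw [subset_empty.1 hK, card_empty] at this
      omega
    obtain ⟨C, hC, hne, hconn⟩ := exists_component (G := G) hU
    obtain ⟨D₁, hD₁, hd₁⟩ := H C hC hne hconn
    obtain ⟨D₂, hD₂, hd₂⟩ := ih (U \ C) (sdiff_ssubset hC.1 hne)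
      fun A hA => H A (hC.sdiff.trans hA)
    refine ⟨D₁ ∪ D₂, ?_, fun K hKU hK => ?_⟩
    · have e₁ := adjCount_union_self (G := G) (disjoint_sdiff (s := C) (t := U))
      have e₂ := adjCount_union_left (G := G) R (disjoint_sdiff (s := C) (t := U))
      rw [union_sdiff_of_subset hC.1] at e₁ e₂
      have := Nat.mul_le_mul_left q (card_union_le D₁ D₂)
      linarith
    · obtain h | h := hC.clique_subset hK hKU
      · exact (hd₁ K h hK).mono (by grind)
      · exact (hd₂ K h hK).mono (by grind)

/-- The edge bound for a connected vertex set, with all edge counts doubled. -/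
lemma exists_isolating {k : ℕ} (hk : 1 ≤ k) (S : Finset V) (hS : CutConnected G S)
    (hnot : ¬ G.IsNClique k S) :
    ∃ D : Finset V, (k * (k - 1) + 4) * #D ≤ adjCount G S S + 2 ∧
      ∀ K ⊆ S, G.IsNClique k K → Dominates G D K := by
  classical
  induction S using Finset.strongInduction with
  | H S ih =>
  by_cases hno : ∀ K ⊆ S, ¬ G.IsNClique k K
  · exact ⟨∅, by simp, fun K hK hc => absurd hc (hno K hK)⟩
  have hcut : ∀ A ⊆ S, A.Nonempty → A ≠ S → ∃ a ∈ A, ∃ b ∈ S, b ∉ A ∧ G.Adj a b := by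
    intro A hA hne hAS
    by_contra! h
    exact hAS (hS A ⟨hA, h⟩ hne)
  by_cases hpend : ∃ H ⊆ S, G.IsNClique k H ∧ ∃ x ∈ S, x ∉ H ∧ ∃ y ∈ H, G.Adj y x ∧
      ∀ b ∈ H, ∀ c ∈ S, c ∉ H → G.Adj b c → b = y ∧ c = x
  · obtain ⟨H, hHS, hH, x, hxS, hxH, y, hyH, hyx, huniq⟩ := hpend
    have hsub : S \ insert x H ⊂ S := sdiff_ssubset (by grind) ⟨x, by simp⟩
    obtain ⟨D, hD, hdom⟩ := exists_of_components (G := G) (k := k) (q := k * (k - 1) + 4)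
      (R := {x}) (D₀ := {x}) (S \ insert x H) (by
        intro C hC hne hconn
        have hCS : C ⊆ S := hC.1.trans hsub.1
        have hxC : x ∉ C := fun h => by simpa using hC.1 h
        obtain ⟨a, ha, b, hb, hbC, hab⟩ := hcut C hCS hne (by rintro rfl; exact hxC hxS)
        have haU := hC.1 ha
        simp only [mem_sdiff, mem_insert, not_or] at haU
        have hbx : b = x := by
          by_contra hbx
          by_cases hbH : b ∈ H
          · exact haU.2.1 (huniq b hbH a haU.1 haU.2.2 hab.symm).2
          · exact hC.2 a ha b (by simp [*]) hbC hab
        subst hbx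
        by_cases hcl : G.IsNClique k C
        · refine ⟨∅, by simp, fun K hKC hK => ?_⟩
          have : K = C := eq_of_subset_of_card_le hKC (by rw [hcl.card_eq, hK.card_eq])
          subst this
          exact ⟨b, by simp, a, ha, Or.inr hab.symm⟩
        · obtain ⟨D, hD, hd⟩ := ih C (hC.1.trans_ssubset hsub) hconn hcl
          refine ⟨D, ?_, fun K hKC hK => (hd K hKC hK).mono subset_union_right⟩
          have := one_le_adjCount (G := G) ha (mem_singleton_self b) hab
          omega) hk
    refine ⟨{x} ∪ D, ?_, fun K hKS hK => ?_⟩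
    · have e₁ := adjCount_union_self (G := G) (disjoint_sdiff (s := insert x H) (t := S)).symm
      rw [sdiff_union_of_subset (by grind)] at e₁
      have e₂ := adjCount_union_self (G := G) (disjoint_singleton_left.2 hxH)
      rw [← insert_eq, adjCount_of_isNClique hH] at e₂
      have e₃ := one_le_adjCount (G := G) (mem_singleton_self x) hyH hyx.symm
      have e₄ := adjCount_mono (G := G) (Subset.refl (S \ insert x H))
        (singleton_subset_iff.2 (mem_insert_self x H))
      have := Nat.mul_le_mul_left (k * (k - 1) + 4) (card_union_le {x} D)
      rw [card_singleton] at this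
      linarith
    · by_cases hxK : x ∈ K
      · exact ⟨x, by simp, x, hxK, Or.inl rfl⟩
      by_cases hyK : y ∈ K
      · exact ⟨x, by simp, y, hyK, Or.inr hyx.symm⟩
      have hclosed : IsClosedIn G (S.erase x) H := by
        refine ⟨by grind, fun a ha b hb hbH hab => ?_⟩
        rw [mem_erase] at hb
        exact hb.1 (huniq a ha b hb.2 hbH hab).2
      obtain h | h := hclosed.clique_subset hK (by grind)
      · have : K = H := eq_of_subset_of_card_le h (by rw [hH.card_eq, hK.card_eq])
        exact absurd hyH (this ▸ hyK)
      · exact hdom K (by grind) hK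
  · push Not at hno
    obtain ⟨H, hHS, hH⟩ := hno
    have hHne : H.Nonempty := card_pos.1 (by rw [hH.card_eq]; omega)
    obtain ⟨v, hv, w, hwS, hwH, hvw⟩ := hcut H hHS hHne (by rintro rfl; exact hnot hH)
    set R := {u ∈ S | v = u ∨ G.Adj v u} with hR
    have hRS : R ⊆ S := filter_subset _ _
    have hvR : v ∈ R := by simp [hR, hHS hv]
    have hsub : S \ R ⊂ S := sdiff_ssubset hRS ⟨v, hvR⟩
    obtain ⟨D, hD, hdom⟩ := exists_of_components (G := G) (k := k) (q := k * (k - 1) + 4)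
      (R := R) (D₀ := {v}) (S \ R) (by
        intro C hC hne hconn
        have hCS : C ⊆ S := hC.1.trans hsub.1
        have hvC : v ∉ C := fun h => (mem_sdiff.1 (hC.1 h)).2 hvR
        have hout : ∀ a ∈ C, ∀ b ∈ S, b ∉ C → G.Adj a b → b ∈ R := by
          intro a ha b hb hbC hab
          by_contra hbR
          exact hC.2 a ha b (mem_sdiff.2 ⟨hb, hbR⟩) hbC hab
        obtain ⟨a, ha, b, hb, hbC, hab⟩ := hcut C hCS hne (by rintro rfl; exact hvC (hHS hv))
        have hbR := hout a ha b hb hbC hab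
        by_cases hcl : G.IsNClique k C
        · have htwo : 2 ≤ adjCount G C R := by
            push Not at hpend
            obtain ⟨c, hc, d, hd, hdC, hcd, hne⟩ := hpend C hCS hcl b hb hbC a ha hab
            exact two_le_adjCount ha hbR hab hc (hout c hc d hd hdC hcd) hcd
              fun h => hne h.1 h.2
          refine ⟨{a}, ?_, fun K hKC hK => ?_⟩
          · rw [adjCount_of_isNClique hcl, card_singleton]
            omega
          · have : K = C := eq_of_subset_of_card_le hKC (by rw [hcl.card_eq, hK.card_eq])
            subst this
            exact ⟨a, by simp, a, ha, Or.inl rfl⟩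
        · obtain ⟨D, hD, hd⟩ := ih C (hC.1.trans_ssubset hsub) hconn hcl
          refine ⟨D, ?_, fun K hKC hK => (hd K hKC hK).mono subset_union_right⟩
          have := one_le_adjCount (G := G) ha hbR hab
          omega) hk
    refine ⟨{v} ∪ D, ?_, fun K hKS hK => ?_⟩
    · have e₁ := adjCount_union_self (G := G) (disjoint_sdiff (s := R) (t := S)).symm
      rw [sdiff_union_of_subset hRS] at e₁
      have e₂ := adjCount_union_self (G := G) (disjoint_singleton_left.2 hwH)
      rw [adjCount_of_isNClique hH] at e₂
      have e₃ := one_le_adjCount (G := G) (mem_singleton_self w) hv hvw.symm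
      have hsubR : {w} ∪ H ⊆ R := by
        intro u hu
        rw [mem_union, mem_singleton] at hu
        obtain rfl | hu := hu
        · exact mem_filter.2 ⟨hwS, Or.inr hvw⟩
        · exact mem_filter.2 ⟨hHS hu, or_iff_not_imp_left.2 (hH.isClique hv hu)⟩
      have e₄ := adjCount_mono (G := G) hsubR hsubR
      have := Nat.mul_le_mul_left (k * (k - 1) + 4) (card_union_le {v} D)
      rw [card_singleton] at this
      linarith
    · by_cases hKR : K ⊆ S \ R
      · exact hdom K hKR hK
      · obtain ⟨u, hu, huR⟩ := not_subset.1 hKR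
        have huR : u ∈ R := by simpa [hKS hu] using huR
        exact ⟨v, by simp, u, hu, (mem_filter.1 huR).2⟩

omit [DecidableEq V] in
lemma adjCount_univ [Fintype V] : adjCount G univ univ = 2 * G.edgeSet.ncard := by
  classical
  rw [← coe_edgeFinset, Set.ncard_coe_finset, ← sum_degrees_eq_twice_card_edges]
  refine sum_congr rfl fun u _ => ?_
  rw [← card_filter, ← card_neighborFinset_eq_degree, neighborFinset_eq_filter]

omit [DecidableEq V] in
lemma cutConnected_univ [Fintype V] (h : G.Preconnected) : CutConnected G univ := by
  rintro A hA ⟨a, ha⟩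
  refine eq_univ_iff_forall.2 fun b => ?_
  obtain ⟨p⟩ := h a b
  induction p with
  | nil => exact ha
  | cons hadj _ ih =>
    refine ih ?_
    by_contra hv
    exact hA.2 _ ha _ (mem_univ _) hv hadj

omit [DecidableEq V] in
lemma nonempty_iso_of_isNClique_univ [Fintype V] {k : ℕ} (h : G.IsNClique k univ) :
    Nonempty (G ≃g (⊤ : SimpleGraph (Fin k))) := by
  have e : V ≃ Fin k := Fintype.equivFinOfCardEq h.card_eq
  refine ⟨⟨e, fun {a b} => ?_⟩⟩
  rw [top_adj, e.injective.ne_iff]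
  exact ⟨h.isClique (mem_coe.2 (mem_univ a)) (mem_coe.2 (mem_univ b)), Adj.ne⟩

lemma isGraphIsolating_of_dominates {k : ℕ} {D : Finset V}
    (h : ∀ K, G.IsNClique k K → Dominates G D K) :
    IsGraphIsolating (⊤ : SimpleGraph (Fin k)) G (D : Set V) := by
  rintro ⟨f, hf⟩
  have hg : Function.Injective fun i => (f i : V) := Subtype.val_injective.comp hf
  have hK : G.IsNClique k (univ.image fun i => (f i : V)) := by
    refine ⟨?_, by rw [card_image_of_injective _ hg, card_univ, Fintype.card_fin]⟩
    intro a ha b hb hab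
    simp only [coe_image, coe_univ, Set.image_univ, Set.mem_range] at ha hb
    obtain ⟨i, rfl⟩ := ha
    obtain ⟨j, rfl⟩ := hb
    exact f.map_rel ((top_adj i j).2 fun hij => hab (by rw [hij]))
  obtain ⟨d, hd, x, hx, hdx⟩ := h _ hK
  obtain ⟨i, -, rfl⟩ := mem_image.1 hx
  refine (f i).2 ?_
  obtain rfl | hdx := hdx
  · exact Or.inl hd
  · exact Or.inr ⟨d, hd, hdx⟩

end IsolationClique

/-- For any `k ≥ 1`, if `G` is a connected `m`-edge graph that is not a copy
of the complete graph `K_k`, then `ι(G, K_k) ≤ (m+1)/(C(k,2)+2)`. -/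
theorem isolation_completeGraph_le_edges {V : Type*} [Fintype V] (k : ℕ) (hk : 1 ≤ k)
    (G : SimpleGraph V) (m : ℕ) (hm : G.edgeSet.ncard = m) (hconn : G.Connected)
    (hKk : ¬ Nonempty (G ≃g (⊤ : SimpleGraph (Fin k)))) :
    (iotaGraph (⊤ : SimpleGraph (Fin k)) G : ℝ) ≤ (m + 1) / (k.choose 2 + 2) := by
  classical
  obtain ⟨D, hD, hdom⟩ := IsolationClique.exists_isolating hk Finset.univ
    (IsolationClique.cutConnected_univ hconn.preconnected)
    fun h => hKk (IsolationClique.nonempty_iso_of_isNClique_univ h)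
  have hle : iotaGraph (⊤ : SimpleGraph (Fin k)) G ≤ D.card := Nat.sInf_le
    ⟨D, Set.ncard_coe_finset D, IsolationClique.isGraphIsolating_of_dominates
      fun K => hdom K (Finset.subset_univ K)⟩
  have hchoose : k * (k - 1) = 2 * k.choose 2 := by
    rw [Nat.choose_two_right, Nat.mul_div_cancel' (Nat.even_mul_pred_self k).two_dvd]
  rw [IsolationClique.adjCount_univ, hm, hchoose] at hD
  have hmul : D.card * (k.choose 2 + 2) ≤ m + 1 := by linarith
  rw [le_div_iff₀ (by positivity)]
  exact_mod_cast (Nat.mul_le_mul_right _ hle).trans hmul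
end

section
/- If G is a connected graph with exactly n vertices, n ≥ 3, and G is not a 5-cycle, then the K_2-isolation number of G satisfies ι(G, K_2) ≤ n/3. -/
open SimpleGraph

section Isolation

variable {V : Type*} {G : SimpleGraph V} {S : Finset V}

/-- `u` lies in the closed neighbourhood of the finite set `D`. -/
def Dominates (G : SimpleGraph V) (D : Finset V) (u : V) : Prop :=
  ∃ d ∈ D, d = u ∨ G.Adj d u

/-- Every edge of `G[S]` has an end dominated by `D`. -/
def IsolatesOn (G : SimpleGraph V) (D S : Finset V) : Prop :=
  ∀ u ∈ S, ∀ w ∈ S, G.Adj u w → Dominates G D u ∨ Dominates G D w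

/-- The edges of `G[S]` can be isolated by at most `|S| / 3` vertices of `G`. -/
def ThirdIsolable (G : SimpleGraph V) (S : Finset V) : Prop :=
  ∃ D : Finset V, 3 * D.card ≤ S.card ∧ IsolatesOn G D S

/-- `a b c d e` is an induced 5-cycle of `G`. -/
structure IsC5 (G : SimpleGraph V) (a b c d e : V) : Prop where
  ab : G.Adj a b
  bc : G.Adj b c
  cd : G.Adj c d
  de : G.Adj d e
  ea : G.Adj e a
  ac : ¬ G.Adj a c
  bd : ¬ G.Adj b d
  ce : ¬ G.Adj c e
  da : ¬ G.Adj d a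
  eb : ¬ G.Adj e b
  ac_ne : a ≠ c
  bd_ne : b ≠ d
  ce_ne : c ≠ e
  da_ne : d ≠ a
  eb_ne : e ≠ b

theorem IsC5.rotate {a b c d e : V} (h : IsC5 G a b c d e) : IsC5 G b c d e a :=
  ⟨h.bc, h.cd, h.de, h.ea, h.ab, h.bd, h.ce, fun k => h.da k, h.eb, h.ac,
    h.bd_ne, h.ce_ne, h.da_ne, h.eb_ne, h.ac_ne⟩

theorem card_le_of_neighbors_subset [DecidableRel G.Adj] {v u : V} {A B : Finset V}
    (hmax : (S.filter (G.Adj u)).card ≤ (S.filter (G.Adj v)).card)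
    (hA : ∀ w ∈ S, G.Adj v w → w ∈ A) (hB : ∀ w ∈ B, w ∈ S ∧ G.Adj u w) :
    B.card ≤ A.card :=
  ((Finset.card_le_card fun w hw => Finset.mem_filter.2 (hB w hw)).trans hmax).trans
    (Finset.card_le_card fun w hw =>
      hA w (Finset.mem_filter.1 hw).1 (Finset.mem_filter.1 hw).2)

theorem IsC5.nonempty_iso {a b c d e : V} (h : IsC5 G a b c d e)
    (hall : ∀ u, u = a ∨ u = b ∨ u = c ∨ u = d ∨ u = e) : Nonempty (G ≃g cycleGraph 5) := by
  have h1 := h.ab; have h2 := h.bc; have h3 := h.cd; have h4 := h.de; have h5 := h.ea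
  have h6 := h.ac; have h7 := h.bd; have h8 := h.ce; have h9 := h.da; have h10 := h.eb
  have h11 := h.ac_ne; have h12 := h.bd_ne; have h13 := h.ce_ne
  have h14 := h.da_ne; have h15 := h.eb_ne
  have hbij : Function.Bijective ![a, b, c, d, e] := by
    constructor
    · have := h1.ne; have := h2.ne; have := h3.ne; have := h4.ne; have := h5.ne
      intro i j hij
      fin_cases i <;> fin_cases j <;> simp_all
    · intro u
      rcases hall u with rfl | rfl | rfl | rfl | rfl
      exacts [⟨0, rfl⟩, ⟨1, rfl⟩, ⟨2, rfl⟩, ⟨3, rfl⟩, ⟨4, rfl⟩]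
  refine ⟨(RelIso.mk (Equiv.ofBijective _ hbij) ?_).symm⟩
  intro i j
  fin_cases i <;> fin_cases j <;>
    simp [cycleGraph_adj, h1, h2, h3, h4, h5, h6, h7, h8, h9, h10, h1.symm, h2.symm, h3.symm,
      h4.symm, h5.symm, G.adj_comm c a, G.adj_comm d b, G.adj_comm e c, G.adj_comm a d,
      G.adj_comm b e] <;> decide

theorem eq_univ_of_closed [Fintype V] (hconn : G.Connected) {C : Finset V} {a : V} (ha : a ∈ C)
    (hC : ∀ u ∈ C, ∀ w, G.Adj u w → w ∈ C) (w : V) : w ∈ C := by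
  obtain ⟨p⟩ := hconn.preconnected a w
  induction p with
  | nil => exact ha
  | cons h _ ih => exact ih (hC _ ha _ h)

theorem isGraphIsolating_of_isolatesOn_univ [Fintype V] {D : Finset V}
    (hD : IsolatesOn G D Finset.univ) :
    IsGraphIsolating (⊤ : SimpleGraph (Fin 2)) G (D : Set V) := by
  rintro ⟨f, -⟩
  have hmem : ∀ {u}, Dominates G D u → u ∈ closedNbhd G (D : Set V) := by
    rintro u ⟨d, hd, rfl | h⟩
    · exact Or.inl hd
    · exact Or.inr ⟨d, hd, h⟩
  have hadj : G.Adj (f 0 : V) (f 1) := f.map_adj (by simp : (⊤ : SimpleGraph (Fin 2)).Adj 0 1)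
  rcases hD _ (by simp) _ (by simp) hadj with h | h
  · exact (f 0).2 (hmem h)
  · exact (f 1).2 (hmem h)

variable [DecidableEq V]

theorem IsC5.card_eq {a b c d e : V} (h : IsC5 G a b c d e) :
    ({a, b, c, d, e} : Finset V).card = 5 := by
  have := h.ab.ne; have := h.bc.ne; have := h.cd.ne; have := h.de.ne; have := h.ea.ne
  have := h.ac_ne; have := h.bd_ne; have := h.ce_ne; have := h.da_ne; have := h.eb_ne
  grind

/-- `G[C]` is a copy of `K_2` or of the 5-cycle. -/
def IsExceptional (G : SimpleGraph V) (C : Finset V) : Prop :=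
  (∃ a b, G.Adj a b ∧ C = {a, b}) ∨
    ∃ a b c d e, IsC5 G a b c d e ∧ C = {a, b, c, d, e}

/-- `C` is a component of `G[S]` isomorphic to `K_2` or to the 5-cycle. -/
structure IsExceptionalComponent (G : SimpleGraph V) (S C : Finset V) : Prop where
  subset : C ⊆ S
  exceptional : IsExceptional G C
  closed : ∀ u ∈ C, ∀ w ∈ S, G.Adj u w → w ∈ C

theorem IsExceptional.exists_starting_at {C : Finset V} (h : IsExceptional G C) {y : V}
    (hy : y ∈ C) :
    (∃ b, G.Adj y b ∧ C = {y, b}) ∨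
      ∃ b c d e, IsC5 G y b c d e ∧ C = {y, b, c, d, e} := by
  rcases h with ⟨a, b, hab, rfl⟩ | ⟨a, b, c, d, e, h, rfl⟩
  · left
    simp only [Finset.mem_insert, Finset.mem_singleton] at hy
    rcases hy with rfl | rfl
    · exact ⟨b, hab, rfl⟩
    · exact ⟨a, hab.symm, Finset.pair_comm _ _⟩
  · right
    simp only [Finset.mem_insert, Finset.mem_singleton] at hy
    rcases hy with rfl | rfl | rfl | rfl | rfl
    · exact ⟨_, _, _, _, h, rfl⟩
    · exact ⟨_, _, _, _, h.rotate, by grind⟩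
    · exact ⟨_, _, _, _, h.rotate.rotate, by grind⟩
    · exact ⟨_, _, _, _, h.rotate.rotate.rotate, by grind⟩
    · exact ⟨_, _, _, _, h.rotate.rotate.rotate.rotate, by grind⟩

/-- If the closed neighbourhood of `D` misses at most two, nonadjacent, vertices of `Y` and
separates `Y` from `S \ Y`, then it remains to isolate the edges of `S \ Y`. -/
theorem ThirdIsolable.of_sdiff {Y D : Finset V} (hY : Y ⊆ S) (hD : 3 * D.card ≤ Y.card)
    {p q : V} (hpq : ¬ G.Adj p q) (hdom : ∀ u ∈ Y, Dominates G D u ∨ u = p ∨ u = q)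
    (hcross : ∀ u ∈ Y, ∀ w ∈ S \ Y, G.Adj u w → Dominates G D u)
    (hK : ThirdIsolable G (S \ Y)) : ThirdIsolable G S := by
  obtain ⟨E, hE, hiso⟩ := hK
  have mono : ∀ {F u}, F ⊆ D ∪ E → Dominates G F u → Dominates G (D ∪ E) u := by
    rintro F u hF ⟨d, hd, h⟩
    exact ⟨d, hF hd, h⟩
  have monoL : ∀ {u}, Dominates G D u → Dominates G (D ∪ E) u :=
    mono Finset.subset_union_left
  have monoR : ∀ {u}, Dominates G E u → Dominates G (D ∪ E) u :=
    mono Finset.subset_union_right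
  refine ⟨D ∪ E, ?_, ?_⟩
  · have := Finset.card_union_le D E
    have := Finset.card_sdiff_add_card_eq_card hY
    omega
  · intro u hu w hw huw
    by_cases huY : u ∈ Y <;> by_cases hwY : w ∈ Y
    · have hqp : ¬ G.Adj q p := fun h => hpq h.symm
      rcases hdom u huY with h | rfl | rfl
      · exact Or.inl (monoL h)
      · rcases hdom w hwY with h | rfl | rfl
        · exact Or.inr (monoL h)
        · exact (G.irrefl huw).elim
        · exact (hpq huw).elim
      · rcases hdom w hwY with h | rfl | rfl
        · exact Or.inr (monoL h)
        · exact (hqp huw).elim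
        · exact (G.irrefl huw).elim
    · exact Or.inl (monoL (hcross u huY w (Finset.mem_sdiff.2 ⟨hw, hwY⟩) huw))
    · exact Or.inr (monoL (hcross w hwY u (Finset.mem_sdiff.2 ⟨hu, huY⟩) huw.symm))
    · exact (hiso u (Finset.mem_sdiff.2 ⟨hu, huY⟩) w (Finset.mem_sdiff.2 ⟨hw, hwY⟩) huw).imp
        monoR monoR

/-- A vertex adjacent to an exceptional set saves a vertex when isolating it. -/
theorem IsExceptional.exists_isolatesOn_insert {C : Finset V} (hC : IsExceptional G C) {x y : V}
    (hy : y ∈ C) (hxy : G.Adj x y) :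
    ∃ D : Finset V, IsolatesOn G (insert x D) C ∧ 3 * D.card + 2 ≤ C.card := by
  rcases hC.exists_starting_at hy with ⟨b, hb, rfl⟩ | ⟨b, c, d, e, h, rfl⟩
  · refine ⟨∅, ?_, by simp [Finset.card_pair hb.ne]⟩
    have hdy : Dominates G (insert x ∅) y := ⟨x, by simp, Or.inr hxy⟩
    intro u hu w hw huw
    simp only [Finset.mem_insert, Finset.mem_singleton] at hu hw
    rcases hu with rfl | rfl
    · exact Or.inl hdy
    · rcases hw with rfl | rfl
      · exact Or.inr hdy
      · exact (G.irrefl huw).elim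
  · refine ⟨{c}, ?_, by simp [h.card_eq]⟩
    have key : ∀ u ∈ ({y, b, c, d, e} : Finset V), Dominates G (insert x {c}) u ∨ u = e := by
      intro u hu
      simp only [Finset.mem_insert, Finset.mem_singleton] at hu
      rcases hu with rfl | rfl | rfl | rfl | rfl
      · exact Or.inl ⟨x, by simp, Or.inr hxy⟩
      · exact Or.inl ⟨c, by simp, Or.inr h.bc.symm⟩
      · exact Or.inl ⟨_, by simp, Or.inl rfl⟩
      · exact Or.inl ⟨c, by simp, Or.inr h.cd⟩
      · exact Or.inr rfl
    intro u hu w hw huw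
    rcases key u hu with h1 | rfl
    · exact Or.inl h1
    · rcases key w hw with h2 | rfl
      · exact Or.inr h2
      · exact (G.irrefl huw).elim

theorem exists_isolatesOn_insert {x : V} (T : Finset V)
    (hx : ∀ C, IsExceptionalComponent G T C → ∃ y ∈ C, G.Adj x y)
    (hT : ∀ U ⊆ T, (∀ C, ¬ IsExceptionalComponent G U C) → ThirdIsolable G U) :
    ∃ D : Finset V, IsolatesOn G (insert x D) T ∧ 3 * D.card ≤ T.card ∧
      ((∃ C, IsExceptionalComponent G T C) → 3 * D.card + 2 ≤ T.card) := by
  induction T using Finset.strongInduction with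
  | H T ih =>
    by_cases hbad : ∃ C, IsExceptionalComponent G T C
    · obtain ⟨C, hC⟩ := hbad
      obtain ⟨y, hy, hxy⟩ := hx C hC
      obtain ⟨D, hD, hDcard⟩ := hC.exceptional.exists_isolatesOn_insert hy hxy
      obtain ⟨E, hE, hEcard, -⟩ := ih (T \ C) (Finset.sdiff_ssubset hC.subset ⟨y, hy⟩)
        (by
          intro C' hC'
          refine hx C' ⟨hC'.subset.trans Finset.sdiff_subset, hC'.exceptional, ?_⟩
          intro u hu w hw huw
          refine hC'.closed u hu w (Finset.mem_sdiff.2 ⟨hw, fun hwC => ?_⟩) huw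
          have hu' := Finset.mem_sdiff.1 (hC'.subset hu)
          exact hu'.2 (hC.closed w hwC u hu'.1 huw.symm))
        (fun U hU => hT U (hU.trans Finset.sdiff_subset))
      have hcard : 3 * (D ∪ E).card + 2 ≤ T.card := by
        have := Finset.card_union_le D E
        have := Finset.card_sdiff_add_card_eq_card hC.subset
        omega
      have mono : ∀ {F u}, F ⊆ D ∪ E → Dominates G (insert x F) u →
          Dominates G (insert x (D ∪ E)) u := by
        rintro F u hF ⟨d, hd, h⟩
        exact ⟨d, Finset.insert_subset_insert x hF hd, h⟩
      refine ⟨D ∪ E, ?_, by omega, fun _ => hcard⟩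
      intro u hu w hw huw
      by_cases huC : u ∈ C
      · exact (hD u huC w (hC.closed u huC w hw huw) huw).imp
          (mono Finset.subset_union_left) (mono Finset.subset_union_left)
      · have hwC : w ∉ C := fun hwC => huC (hC.closed w hwC u hu huw.symm)
        exact (hE u (Finset.mem_sdiff.2 ⟨hu, huC⟩) w (Finset.mem_sdiff.2 ⟨hw, hwC⟩) huw).imp
          (mono Finset.subset_union_right) (mono Finset.subset_union_right)
    · obtain ⟨D, hD, hiso⟩ := hT T subset_rfl (not_exists.1 hbad)
      refine ⟨D, ?_, hD, fun h => (hbad h).elim⟩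
      have mono : ∀ {u}, Dominates G D u → Dominates G (insert x D) u := by
        rintro u ⟨d, hd, h⟩
        exact ⟨d, Finset.mem_insert_of_mem hd, h⟩
      exact fun u hu w hw huw => (hiso u hu w hw huw).imp mono mono

/-- If deleting a vertex creates an exceptional component, that vertex is a good choice. -/
theorem ThirdIsolable.of_exceptionalComponent_erase {x : V} {C : Finset V} (hx : x ∈ S)
    (hS : ∀ C, ¬ IsExceptionalComponent G S C)
    (hC : IsExceptionalComponent G (S.erase x) C)
    (ih : ∀ U ⊂ S, (∀ C, ¬ IsExceptionalComponent G U C) → ThirdIsolable G U) :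
    ThirdIsolable G S := by
  obtain ⟨D, hD, -, hcard⟩ := exists_isolatesOn_insert (G := G) (x := x) (S.erase x)
    (by
      intro C' hC'
      by_contra! hno
      refine hS C' ⟨hC'.subset.trans (Finset.erase_subset _ _), hC'.exceptional, ?_⟩
      intro u hu w hw huw
      refine hC'.closed u hu w (Finset.mem_erase.2 ⟨?_, hw⟩) huw
      rintro rfl
      exact hno u hu huw.symm)
    (fun U hU => ih U (hU.trans_ssubset (Finset.erase_ssubset hx)))
  have h1 := hcard ⟨C, hC⟩
  have h2 := Finset.card_erase_add_one hx
  refine ⟨insert x D, ?_, ?_⟩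
  · have := Finset.card_insert_le x D
    omega
  · have hdom : Dominates G (insert x D) x := ⟨x, by simp, Or.inl rfl⟩
    intro u hu w hw huw
    by_cases hux : u = x
    · exact Or.inl (hux ▸ hdom)
    by_cases hwx : w = x
    · exact Or.inr (hwx ▸ hdom)
    exact hD u (Finset.mem_erase.2 ⟨hux, hu⟩) w (Finset.mem_erase.2 ⟨hwx, hw⟩) huw

/-- An exceptional set, enlarged by an outside neighbour, is dominated by a third of its
vertices. -/
theorem IsExceptional.exists_dominates_insert {H : Finset V} (hH : IsExceptional G H) {x y : V}
    (hy : y ∈ H) (hyx : G.Adj y x) (hx : x ∉ H) :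
    ∃ D : Finset V, 3 * D.card ≤ (insert x H).card ∧ ∀ u ∈ insert x H, Dominates G D u := by
  rw [Finset.card_insert_of_notMem hx]
  rcases hH.exists_starting_at hy with ⟨b, hb, rfl⟩ | ⟨b, c, d, e, h, rfl⟩
  · refine ⟨{y}, by simp [Finset.card_pair hb.ne], fun u hu => ⟨y, by simp, ?_⟩⟩
    simp only [Finset.mem_insert, Finset.mem_singleton] at hu
    rcases hu with rfl | rfl | rfl
    exacts [Or.inr hyx, Or.inl rfl, Or.inr hb]
  · refine ⟨{y, c}, ?_, fun u hu => ?_⟩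
    · rw [h.card_eq, Finset.card_pair h.ac_ne]
    · simp only [Finset.mem_insert, Finset.mem_singleton] at hu
      rcases hu with rfl | rfl | rfl | rfl | rfl | rfl
      · exact ⟨y, by simp, Or.inr hyx⟩
      · exact ⟨_, by simp, Or.inl rfl⟩
      · exact ⟨y, by simp, Or.inr h.ab⟩
      · exact ⟨_, by simp, Or.inl rfl⟩
      · exact ⟨c, by simp, Or.inr h.cd⟩
      · exact ⟨y, by simp, Or.inr h.ea.symm⟩

/-- Two vertices isolate the edges of a 5-cycle and a `K_2` joined by a path through `x`, and
they can be chosen to dominate `x`. -/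
theorem IsC5.exists_isolating_pair {v a b c d x y z : V} (h : IsC5 G v a b c d)
    (hvx : G.Adj v x) (hyx : G.Adj y x) (hyz : G.Adj y z) :
    ∃ D : Finset V, ∃ p q, D.card ≤ 2 ∧ Dominates G D x ∧ ¬ G.Adj p q ∧
      ∀ u ∈ insert x ({y, z} ∪ {v, a, b, c, d} : Finset V),
        Dominates G D u ∨ u = p ∨ u = q := by
  have := h.ab; have := h.bc; have := h.cd; have := h.de; have := h.ea
  have hs : ∀ {s t}, G.Adj s t → G.Adj t s := fun h => h.symm
  by_cases h1 : G.Adj z d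
  · by_cases h2 : G.Adj z a
    · by_cases h3 : G.Adj c y
      · refine ⟨{v, y}, b, b, Finset.card_le_two, ⟨v, by simp, Or.inr hvx⟩, G.irrefl, ?_⟩
        simp only [Dominates, Finset.mem_insert, Finset.mem_union, Finset.mem_singleton,
          exists_eq_or_imp, exists_eq_left]
        grind
      · refine ⟨{v, a}, c, y, Finset.card_le_two, ⟨v, by simp, Or.inr hvx⟩, h3, ?_⟩
        simp only [Dominates, Finset.mem_insert, Finset.mem_union, Finset.mem_singleton,
          exists_eq_or_imp, exists_eq_left]
        grind
    · refine ⟨{x, c}, z, a, Finset.card_le_two, ⟨x, by simp, Or.inl rfl⟩, h2, ?_⟩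
      simp only [Dominates, Finset.mem_insert, Finset.mem_union, Finset.mem_singleton,
        exists_eq_or_imp, exists_eq_left]
      grind
  · refine ⟨{x, b}, z, d, Finset.card_le_two, ⟨x, by simp, Or.inl rfl⟩, h1, ?_⟩
    simp only [Dominates, Finset.mem_insert, Finset.mem_union, Finset.mem_singleton,
      exists_eq_or_imp, exists_eq_left]
    grind

/-- Three vertices, one of them `x`, isolate the edges of two 5-cycles joined by a path through
`x`, unless there are too many edges between the cycles. -/
theorem IsC5.exists_isolating_triple {v a b c d x y₁ y₂ y₃ y₄ y₅ : V} (h : IsC5 G v a b c d)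
    (h' : IsC5 G y₁ y₂ y₃ y₄ y₅) (hvx : G.Adj v x) (hyx : G.Adj y₁ x)
    (hd : ¬ (G.Adj d y₂ ∧ G.Adj d y₅)) :
    ∃ D : Finset V, ∃ p q, D.card ≤ 3 ∧ Dominates G D x ∧ ¬ G.Adj p q ∧
      ∀ u ∈ insert x ({y₁, y₂, y₃, y₄, y₅} ∪ {v, a, b, c, d} : Finset V),
        Dominates G D u ∨ u = p ∨ u = q := by
  have := h.ab; have := h.bc; have := h.cd; have := h.de; have := h.ea
  have := h'.ab; have := h'.bc; have := h'.cd; have := h'.de; have := h'.ea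
  have hs : ∀ {s t}, G.Adj s t → G.Adj t s := fun h => h.symm
  by_cases h1 : G.Adj d y₂
  · refine ⟨{x, b, y₃}, d, y₅, Finset.card_le_three, ⟨x, by simp, Or.inl rfl⟩,
      fun h2 => hd ⟨h1, h2⟩, ?_⟩
    simp only [Dominates, Finset.mem_insert, Finset.mem_union, Finset.mem_singleton,
      exists_eq_or_imp, exists_eq_left]
    grind
  · refine ⟨{x, b, y₄}, d, y₂, Finset.card_le_three, ⟨x, by simp, Or.inl rfl⟩, h1, ?_⟩
    simp only [Dominates, Finset.mem_insert, Finset.mem_union, Finset.mem_singleton,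
      exists_eq_or_imp, exists_eq_left]
    grind

/-- In a graph of maximum degree at most two, a 5-cycle is a component. -/
theorem isExceptionalComponent_of_cycle {v x y z w : V}
    (hdeg : ∀ u ∈ S, ∀ p ∈ S, ∀ q ∈ S, ∀ r ∈ S, G.Adj u p → G.Adj u q → G.Adj u r →
      p ≠ q → r = p ∨ r = q)
    (hv : v ∈ S) (hx : x ∈ S) (hy : y ∈ S) (hz : z ∈ S) (hw : w ∈ S)
    (hvx : G.Adj v x) (hxy : G.Adj x y) (hyz : G.Adj y z) (hzw : G.Adj z w) (hwv : G.Adj w v)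
    (hvy : v ≠ y) (hxz : x ≠ z) (hyw : y ≠ w) (hzv : z ≠ v) (hwx : w ≠ x) :
    IsExceptionalComponent G S {v, x, y, z, w} := by
  have nv : ∀ r ∈ S, G.Adj v r → r = w ∨ r = x := fun r hr =>
    (hdeg v hv w hw x hx r hr hwv.symm hvx · hwx)
  have nx : ∀ r ∈ S, G.Adj x r → r = v ∨ r = y := fun r hr =>
    (hdeg x hx v hv y hy r hr hvx.symm hxy · hvy)
  have ny : ∀ r ∈ S, G.Adj y r → r = x ∨ r = z := fun r hr =>
    (hdeg y hy x hx z hz r hr hxy.symm hyz · hxz)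
  have nz : ∀ r ∈ S, G.Adj z r → r = y ∨ r = w := fun r hr =>
    (hdeg z hz y hy w hw r hr hyz.symm hzw · hyw)
  have nw : ∀ r ∈ S, G.Adj w r → r = z ∨ r = v := fun r hr =>
    (hdeg w hw z hz v hv r hr hzw.symm hwv · hzv)
  have := hvx.ne; have := hxy.ne; have := hyz.ne; have := hzw.ne; have := hwv.ne
  refine ⟨by simp [Finset.insert_subset_iff, *], Or.inr ⟨v, x, y, z, w, ?_, rfl⟩, ?_⟩
  · constructor <;> first | assumption | grind
  · intro s hs t ht hst
    simp only [Finset.mem_insert, Finset.mem_singleton] at hs ⊢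
    rcases hs with rfl | rfl | rfl | rfl | rfl
    · have := nv t ht hst; tauto
    · have := nx t ht hst; tauto
    · have := ny t ht hst; tauto
    · have := nz t ht hst; tauto
    · have := nw t ht hst; tauto

/-- The final configuration of the induction: `H` and `C` are exceptional sets linked through
`x`, the vertex `v ∈ C` has maximum degree in `G[S]`, and all other vertices of `S` are linked
to `H ∪ C` only through `x`. -/
theorem ThirdIsolable.of_two_exceptional [DecidableRel G.Adj] {v x y : V} {H C : Finset V}
    (hS : ∀ C, ¬ IsExceptionalComponent G S C)
    (hmax : ∀ u ∈ S, (S.filter (G.Adj u)).card ≤ (S.filter (G.Adj v)).card)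
    (hxS : x ∈ S) (hHS : H ⊆ S) (hCS : C ⊆ S) (hxH : x ∉ H) (hxC : x ∉ C)
    (hHC : Disjoint H C) (hH : IsExceptional G H) (hC : IsExceptional G C)
    (hvC : v ∈ C) (hyH : y ∈ H) (hvx : G.Adj v x) (hyx : G.Adj y x)
    (hvH : ∀ u ∈ H, ¬ G.Adj v u)
    (hlink : ∃ u ∈ H, ∃ w ∈ S, G.Adj v w ∧ w ≠ x ∧ G.Adj u w)
    (hcross : ∀ u ∈ insert x (H ∪ C), ∀ w ∈ S \ insert x (H ∪ C), G.Adj u w → u = x)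
    (hK : ThirdIsolable G (S \ insert x (H ∪ C))) : ThirdIsolable G S := by
  have hYS : insert x (H ∪ C) ⊆ S :=
    Finset.insert_subset hxS (Finset.union_subset hHS hCS)
  have hYcard : (insert x (H ∪ C)).card = H.card + C.card + 1 := by
    rw [Finset.card_insert_of_notMem (by simp [hxH, hxC]), Finset.card_union_of_disjoint hHC]
  have hNv : ∀ w ∈ S, G.Adj v w → w = x ∨ w ∈ C := by
    intro w hw hvw
    by_contra! hcon
    have hwH : w ∉ H := fun h => hvH w h hvw
    refine hvx.ne (hcross v (by simp [hvC]) w ?_ hvw)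
    simp [hw, hcon, hwH]
  rcases hC.exists_starting_at hvC with ⟨x', hvx', rfl⟩ | ⟨a, b, c, d, h5, rfl⟩
  · have hdeg : ∀ u ∈ S, ∀ B : Finset V, (∀ w ∈ B, w ∈ S ∧ G.Adj u w) → B.card ≤ 2 := by
      intro u hu B hB
      refine (card_le_of_neighbors_subset (hmax u hu) (A := {x, x'}) ?_ hB).trans
        Finset.card_le_two
      intro w hw hvw
      have := hNv w hw hvw
      have := hvw.ne
      grind
    have hyS := hHS hyH
    have three : ∀ u ∈ S, ∀ p ∈ S, ∀ q ∈ S, ∀ r ∈ S, G.Adj u p → G.Adj u q → G.Adj u r →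
        p ≠ q → r = p ∨ r = q := by
      intro u hu p hp q hq r hr h1 h2 h3 hpq
      by_contra! hcon
      have := hdeg u hu {p, q, r} (by grind)
      rw [Finset.card_eq_three.2 ⟨p, q, r, hpq, hcon.1.symm, hcon.2.symm, rfl⟩] at this
      omega
    rcases hH.exists_starting_at hyH with ⟨z, hyz, rfl⟩ | ⟨y₂, y₃, y₄, y₅, h5, rfl⟩
    · obtain ⟨u, hu, w, hw, hvw, hwx, huw⟩ := hlink
      have hwx' : w = x' := by
        have := hNv w hw hvw
        have := hvw.ne
        grind
      subst hwx'
      have hs : ∀ {s t}, G.Adj s t → G.Adj t s := fun h => h.symm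
      have hzS : z ∈ S := hHS (by simp)
      have hvS : v ∈ S := hCS (by simp)
      have hne : Disjoint ({y, z} : Finset V) {v, w} := hHC
      simp only [Finset.disjoint_left, Finset.mem_insert, Finset.mem_singleton] at hne hxH hxC hvH hu
      have hzx : z ≠ x := by grind
      have hzw : G.Adj z w := by
        rcases hu with rfl | rfl
        · have := three u hyS x hxS z hzS w hw hyx hyz huw (by grind)
          grind
        · exact huw
      exact (hS _ (isExceptionalComponent_of_cycle three hvS hxS hyS hzS hw hvx hyx.symm hyz hzw
        hvw.symm (by grind) hzx.symm (by grind) (by grind) hwx)).elim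
    · simp only [Finset.mem_insert, Finset.mem_singleton, not_or] at hxH
      rcases three y hyS x hxS y₂ (hHS (by simp)) y₅ (hHS (by simp)) hyx h5.ab h5.ea.symm
        hxH.2.1 with h | h
      · exact (hxH.2.2.2.2 h.symm).elim
      · exact (h5.eb_ne h).elim
  · have finish : ∀ D : Finset V, ∀ p q, 3 * D.card ≤ H.card + 6 → Dominates G D x →
        ¬ G.Adj p q → (∀ u ∈ insert x (H ∪ {v, a, b, c, d}), Dominates G D u ∨ u = p ∨ u = q) →
        ThirdIsolable G S := by
      intro D p q hD hx hpq hdom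
      refine ThirdIsolable.of_sdiff hYS ?_ hpq hdom
        (fun u hu w hw huw => hcross u hu w hw huw ▸ hx) hK
      rw [hYcard, h5.card_eq]
      exact hD
    rcases hH.exists_starting_at hyH with ⟨z, hyz, rfl⟩ | ⟨y₂, y₃, y₄, y₅, h5', rfl⟩
    · obtain ⟨D, p, q, hD, hx, hpq, hdom⟩ := h5.exists_isolating_pair hvx hyx hyz
      refine finish D p q ?_ hx hpq hdom
      rw [Finset.card_pair hyz.ne]
      omega
    · have hd : ¬ (G.Adj d y₂ ∧ G.Adj d y₅) := by
        rintro ⟨hd2, hd5⟩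
        have hB := card_le_of_neighbors_subset (hmax d (hCS (by simp))) (A := {x, a, d})
          (B := {v, c, y₂, y₅})
          (by
            intro w hw hvw
            have hmem := hNv w hw hvw
            simp only [Finset.mem_insert, Finset.mem_singleton] at hmem ⊢
            rcases hmem with rfl | rfl | rfl | rfl | rfl | rfl
            · exact Or.inl rfl
            · exact (G.irrefl hvw).elim
            · exact Or.inr (Or.inl rfl)
            · exact (h5.ac hvw).elim
            · exact (h5.da hvw.symm).elim
            · exact Or.inr (Or.inr rfl))
          (by
            intro w hw
            simp only [Finset.mem_insert, Finset.mem_singleton] at hw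
            rcases hw with rfl | rfl | rfl | rfl
            · exact ⟨hCS (by simp), h5.ea⟩
            · exact ⟨hCS (by simp), h5.de.symm⟩
            · exact ⟨hHS (by simp), hd2⟩
            · exact ⟨hHS (by simp), hd5⟩)
        have h3 : ({x, a, d} : Finset V).card ≤ 3 := Finset.card_le_three
        have h4 : ({v, c, y₂, y₅} : Finset V).card = 4 := by
          have := h5.da_ne
          have := h5'.eb_ne
          rw [Finset.disjoint_left] at hHC
          grind
        omega
      obtain ⟨D, p, q, hD, hx, hpq, hdom⟩ := h5.exists_isolating_triple h5' hvx hyx hd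
      refine finish D p q ?_ hx hpq hdom
      rw [h5'.card_eq]
      omega

theorem thirdIsolable_of_no_exceptionalComponent (S : Finset V)
    (hS : ∀ C, ¬ IsExceptionalComponent G S C) : ThirdIsolable G S := by
  classical
  induction S using Finset.strongInduction with
  | H S ih =>
    by_contra hP
    have herase : ∀ x ∈ S, ∀ C, ¬ IsExceptionalComponent G (S.erase x) C := fun x hx C hC =>
      hP (.of_exceptionalComponent_erase hx hS hC ih)
    have hedge : ∃ a ∈ S, ∃ b ∈ S, G.Adj a b := by
      by_contra! hno
      exact hP ⟨∅, by simp, fun u hu w hw huw => (hno u hu w hw huw).elim⟩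
    obtain ⟨a, ha, b, hb, hab⟩ := hedge
    obtain ⟨v, hv, hmax⟩ :=
      Finset.exists_max_image S (fun u => (S.filter (G.Adj u)).card) ⟨a, ha⟩
    have hdeg : 2 ≤ (S.filter (G.Adj v)).card := by
      by_contra! hlt
      have hone : ∀ u ∈ S, ∀ p ∈ S, ∀ q ∈ S, G.Adj u p → G.Adj u q → p = q := by
        intro u hu p hp q hq h1 h2
        exact Finset.card_le_one.1 (by have := hmax u hu; omega) p
          (Finset.mem_filter.2 ⟨hp, h1⟩) q (Finset.mem_filter.2 ⟨hq, h2⟩)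
      refine hS {a, b} ⟨by grind, Or.inl ⟨a, b, hab, rfl⟩, ?_⟩
      intro u hu w hw huw
      simp only [Finset.mem_insert, Finset.mem_singleton] at hu ⊢
      rcases hu with rfl | rfl
      · exact Or.inr (hone u ha w hw b hb huw hab)
      · exact Or.inl (hone u hb w hw a ha huw hab.symm)
    set N := insert v (S.filter (G.Adj v)) with hN
    have hNS : N ⊆ S := Finset.insert_subset hv (Finset.filter_subset _ _)
    have hmemN : ∀ {u}, u ∈ S → (u ∈ N ↔ u = v ∨ G.Adj v u) := by
      intro u hu
      simp [hN, hu]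
    have hNcard : 3 ≤ N.card := by
      rw [hN, Finset.card_insert_of_notMem (by simp)]
      omega
    obtain ⟨H, hH⟩ : ∃ H, IsExceptionalComponent G (S \ N) H := by
      by_contra! hno
      have hdom : ∀ u ∈ N, Dominates G {v} u := by
        intro u hu
        rcases (hmemN (hNS hu)).1 hu with rfl | h
        · exact ⟨u, by simp, Or.inl rfl⟩
        · exact ⟨v, by simp, Or.inr h⟩
      exact hP (.of_sdiff hNS (D := {v}) (by simpa using hNcard) (G.irrefl (v := v))
        (fun u hu => Or.inl (hdom u hu)) (fun u hu _ _ _ => hdom u hu)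
        (ih _ (Finset.sdiff_ssubset hNS ⟨v, by simp [hN]⟩) hno))
    have hHS : H ⊆ S := hH.subset.trans Finset.sdiff_subset
    have hHv : ∀ u ∈ H, u ≠ v ∧ ¬ G.Adj v u := by
      intro u hu
      have := (Finset.mem_sdiff.1 (hH.subset hu)).2
      rw [hmemN (hHS hu)] at this
      exact not_or.1 this
    have hHout : ∀ u ∈ H, ∀ w ∈ S, G.Adj u w → w ∉ H → G.Adj v w := by
      intro u hu w hw huw hwH
      by_contra hvw
      have hwv : w ≠ v := by
        rintro rfl
        exact (hHv u hu).2 huw.symm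
      refine hwH (hH.closed u hu w (Finset.mem_sdiff.2 ⟨hw, ?_⟩) huw)
      rw [hmemN hw]
      exact not_or.2 ⟨hwv, hvw⟩
    obtain ⟨y, hyH, x, hxS, hyx, hxH⟩ : ∃ y ∈ H, ∃ x ∈ S, G.Adj y x ∧ x ∉ H := by
      by_contra! hno
      exact hS H ⟨hHS, hH.exceptional, hno⟩
    have hvx : G.Adj v x := hHout y hyH x hxS hyx hxH
    have hvH : v ∉ H := fun h => (hHv v h).1 rfl
    have hXS : insert x H ⊆ S := Finset.insert_subset hxS hHS
    obtain ⟨C, hC⟩ : ∃ C, IsExceptionalComponent G (S \ insert x H) C := by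
      by_contra! hno
      obtain ⟨D, hD, hdom⟩ := hH.exceptional.exists_dominates_insert hyH hyx hxH
      exact hP (.of_sdiff hXS hD (G.irrefl (v := v)) (fun u hu => Or.inl (hdom u hu))
        (fun u hu _ _ _ => hdom u hu)
        (ih _ (Finset.sdiff_ssubset hXS ⟨x, by simp⟩) hno))
    have hCmem : ∀ {u}, u ∈ C → u ∈ S ∧ u ≠ x ∧ u ∉ H := by
      intro u hu
      have := hC.subset hu
      simpa using this
    have hCclosed : ∀ u ∈ C, ∀ w ∈ S, w ≠ x → w ∉ H → G.Adj u w → w ∈ C := by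
      intro u hu w hw hwx hwH huw
      exact hC.closed u hu w (by simp [hw, hwx, hwH]) huw
    have hvC : v ∈ C := by
      by_contra hvC
      refine herase x hxS C ⟨fun u hu => Finset.mem_erase.2 ⟨(hCmem hu).2.1, (hCmem hu).1⟩,
        hC.exceptional, ?_⟩
      intro u hu w hw huw
      obtain ⟨hwx, hwS⟩ := Finset.mem_erase.1 hw
      refine hCclosed u hu w hwS hwx (fun hwH => ?_) huw
      have hvu := hHout w hwH u (hCmem hu).1 huw.symm (hCmem hu).2.2
      exact hvC (hCclosed u hu v hv hvx.ne hvH hvu.symm)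
    have hcross : ∀ u ∈ insert x (H ∪ C), ∀ w ∈ S \ insert x (H ∪ C), G.Adj u w → u = x := by
      intro u hu w hw huw
      simp only [Finset.mem_sdiff, Finset.mem_insert, Finset.mem_union, not_or] at hu hw
      obtain ⟨hwS, hwx, hwH, hwC⟩ := hw
      rcases hu with rfl | hu | hu
      · rfl
      · exact (hwC (hCclosed v hvC w hwS hwx hwH (hHout u hu w hwS huw hwH))).elim
      · exact (hwC (hCclosed u hu w hwS hwx hwH huw)).elim
    refine hP (.of_two_exceptional hS hmax hxS hHS (fun u hu => (hCmem hu).1) hxH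
      (fun h => (hCmem h).2.1 rfl) (Finset.disjoint_right.2 fun u hu => (hCmem hu).2.2)
      hH.exceptional hC.exceptional hvC hyH hvx hyx (fun u hu => (hHv u hu).2) ?_ hcross ?_)
    · by_contra! hno
      refine herase x hxS H ⟨fun u hu => Finset.mem_erase.2 ⟨?_, hHS hu⟩, hH.exceptional, ?_⟩
      · rintro rfl
        exact hxH hu
      · intro u hu w hw huw
        obtain ⟨hwx, hwS⟩ := Finset.mem_erase.1 hw
        by_contra hwH
        exact hno u hu w hwS (hHout u hu w hwS huw hwH) hwx huw
    · have hYS : insert x (H ∪ C) ⊆ S :=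
        Finset.insert_subset hxS (Finset.union_subset hHS fun u hu => (hCmem hu).1)
      refine ih _ (Finset.sdiff_ssubset hYS ⟨x, by simp⟩) fun C' hC' => ?_
      refine herase x hxS C' ⟨fun u hu => ?_, hC'.exceptional, ?_⟩
      · have := hC'.subset hu
        simp only [Finset.mem_sdiff, Finset.mem_insert, not_or] at this
        exact Finset.mem_erase.2 ⟨this.2.1, this.1⟩
      · intro u hu w hw huw
        obtain ⟨hwx, hwS⟩ := Finset.mem_erase.1 hw
        refine hC'.closed u hu w (Finset.mem_sdiff.2 ⟨hwS, fun hwY => ?_⟩) huw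
        exact hwx (hcross w hwY u (hC'.subset hu) huw.symm)

theorem not_isExceptionalComponent_univ [Fintype V] (hconn : G.Connected)
    (hcard : 3 ≤ Fintype.card V) (hC5 : ¬ Nonempty (G ≃g cycleGraph 5)) (C : Finset V) :
    ¬ IsExceptionalComponent G Finset.univ C := by
  intro hC
  have hclosed : ∀ u ∈ C, ∀ w, G.Adj u w → w ∈ C := fun u hu w => hC.closed u hu w (by simp)
  rcases hC.exceptional with ⟨a, b, -, rfl⟩ | ⟨a, b, c, d, e, h, rfl⟩
  · have hall := eq_univ_of_closed hconn (a := a) (by simp) hclosed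
    rw [← Finset.card_univ, ← Finset.eq_univ_iff_forall.2 hall] at hcard
    have : ({a, b} : Finset V).card ≤ 2 := Finset.card_le_two
    omega
  · have hall := eq_univ_of_closed hconn (a := a) (by simp) hclosed
    exact hC5 (h.nonempty_iso (by simpa using hall))

end Isolation

/-- If `G` is a connected graph with exactly `n` vertices, `n ≥ 3`, and `G`
is not a 5-cycle, then `ι(G, K_2) ≤ n/3`. -/
theorem isolation_K2_le_card_div_three {V : Type*} [Fintype V] (G : SimpleGraph V) (n : ℕ)
    (hn : Fintype.card V = n) (hn3 : 3 ≤ n) (hconn : G.Connected)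
    (hC5 : ¬ Nonempty (G ≃g cycleGraph 5)) :
    (iotaGraph (⊤ : SimpleGraph (Fin 2)) G : ℝ) ≤ n / 3 := by
  classical
  obtain ⟨D, hcard, hD⟩ := thirdIsolable_of_no_exceptionalComponent (G := G) Finset.univ
    (not_isExceptionalComponent_univ hconn (by omega) hC5)
  have hle : iotaGraph (⊤ : SimpleGraph (Fin 2)) G ≤ D.card :=
    Nat.sInf_le ⟨D, Set.ncard_coe_finset D, isGraphIsolating_of_isolatesOn_univ hD⟩
  rw [Finset.card_univ, hn] at hcard
  rw [le_div_iff₀ (by norm_num)]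
  exact_mod_cast (by omega : iotaGraph (⊤ : SimpleGraph (Fin 2)) G * 3 ≤ n)
end

section
/- If G is a connected graph with exactly n vertices and G is not isomorphic to K_1 (so n ≥ 2), then the domination number of G is at most n/2. -/
open SimpleGraph

/-- The domination number of `G` : the least cardinality of a set `D` of vertices with
`N[D] = V(G)`. -/
noncomputable def dominationNumber {V : Type*} (G : SimpleGraph V) : ℕ :=
  sInf {r | ∃ D : Set V, D.ncard = r ∧ closedNbhd G D = Set.univ}

/-- Every finite graph without isolated vertices has domination number at most half its order. -/
theorem two_mul_dominationNumber_le_card {V : Type*} [Fintype V] (G : SimpleGraph V)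
    (hG : ∀ v, ∃ w, G.Adj v w) : 2 * dominationNumber G ≤ Fintype.card V := by
  have hne : {r | ∃ D : Set V, D.ncard = r ∧ closedNbhd G D = Set.univ}.Nonempty :=
    ⟨_, Set.univ, rfl, by simp [closedNbhd]⟩
  obtain ⟨D, hcard, hD⟩ := Nat.sInf_mem hne
  have hle (E : Set V) (hE : closedNbhd G E = Set.univ) : dominationNumber G ≤ E.ncard :=
    Nat.sInf_le ⟨E, rfl, hE⟩
  have hcompl : closedNbhd G Dᶜ = Set.univ := by
    refine Set.eq_univ_of_forall fun v => ?_
    by_contra hv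
    simp only [closedNbhd, Set.mem_union, Set.mem_compl_iff, Set.mem_ofPred_eq, not_or, not_not,
      not_exists, not_and] at hv
    obtain ⟨hvD, hnbr⟩ := hv
    have hmem (u : V) (h : G.Adj u v) : u ∈ D := by
      by_contra hu
      exact hnbr u hu h
    have hdom : closedNbhd G (D \ {v}) = Set.univ := by
      refine Set.eq_univ_of_forall fun u => ?_
      by_cases huv : u = v
      · subst huv
        obtain ⟨w, hw⟩ := hG u
        exact Or.inr ⟨w, ⟨hmem w hw.symm, hw.ne'⟩, hw.symm⟩
      · rcases hD.symm.subset (Set.mem_univ u) with hu | ⟨x, hx, hxu⟩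
        · exact Or.inl ⟨hu, huv⟩
        · by_cases hxv : x = v
          · exact Or.inl ⟨hmem u (hxv ▸ hxu.symm), huv⟩
          · exact Or.inr ⟨x, ⟨hx, hxv⟩, hxu⟩
    have hlt : (D \ {v}).ncard < D.ncard := Set.ncard_sdiff_singleton_lt_of_mem hvD
    exact absurd (hle _ hdom) (not_le.mpr (hlt.trans_eq hcard))
  have hsum := Set.ncard_add_ncard_compl D
  rw [Nat.card_eq_fintype_card] at hsum
  have h₁ := hle D hD
  have h₂ := hle Dᶜ hcompl
  omega

/-- If `G` is a connected graph with exactly `n` vertices and `G` is not a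
copy of `K_1`, then the domination number of `G` is at most `n/2`. -/
theorem dominationNumber_le_card_div_two {V : Type*} [Fintype V] (G : SimpleGraph V) (n : ℕ)
    (hn : Fintype.card V = n) (hconn : G.Connected)
    (hK1 : ¬ Nonempty (G ≃g (⊤ : SimpleGraph (Fin 1)))) :
    (dominationNumber G : ℝ) ≤ n / 2 := by
  have hnontriv : Nontrivial V := by
    by_contra h
    rw [not_nontrivial_iff_subsingleton] at h
    obtain ⟨v⟩ := hconn.nonempty
    have : Unique V := uniqueOfSubsingleton v
    refine hK1 ⟨⟨Equiv.ofUnique V (Fin 1), fun {a b} => ?_⟩⟩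
    simp [Subsingleton.elim a b]
  have h := two_mul_dominationNumber_le_card G
    fun v => hconn.preconnected.exists_adj_of_nontrivial v
  rw [hn] at h
  have h' : (2 : ℝ) * dominationNumber G ≤ n := by exact_mod_cast h
  linarith
end
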